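/- There exists a constant c > 0 such that for every integer N ≥ 2, every cube C = (0,N]² + Nξ₀ with ξ₀ ∈ ℤ², every interval I ⊂ ℝ with |I| ≤ 1/Log N, and every function a : ℤ² → ℂ supported on C ∩ ℤ², the function u(t,x) = Σ_{ξ∈C∩ℤ²} a(ξ) e^{i(ξ·x − t|ξ|²)} satisfies (∫_I ∫_{𝕋²} |u(t,x)|⁴ dx dt)^{1/4} ≤ c (Σ_ξ |a(ξ)|²)^{1/2}. -/

import Mathlib

open MeasureTheory
open scoped BigOperators Real

section SzemerediTrotter

/-- The height at abscissa `t` of the line with slope `ℓ.1` and intercept `ℓ.2`. -/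
def lineAt (ℓ : ℝ × ℝ) (t : ℝ) : ℝ := ℓ.1 * t + ℓ.2

/-- A segment: a line together with the abscissas of its left and right endpoints. -/
abbrev Seg := (ℝ × ℝ) × (ℝ × ℝ)

/-- Segments joining consecutive points of the graph of `Y` over `P`. -/
structure IsDrawing (P : Finset ℝ) (Y : ℝ → ℝ) (E : Finset Seg) : Prop where
  lt : ∀ e ∈ E, e.2.1 < e.2.2
  left_mem : ∀ e ∈ E, e.2.1 ∈ P
  right_mem : ∀ e ∈ E, e.2.2 ∈ P
  left_on : ∀ e ∈ E, lineAt e.1 e.2.1 = Y e.2.1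
  right_on : ∀ e ∈ E, lineAt e.1 e.2.2 = Y e.2.2
  vert : ∀ e ∈ E, ∀ w ∈ P, e.2.1 < w → w < e.2.2 → lineAt e.1 w ≠ Y w

/-- The open segments `e` and `e'` share a point. -/
def SegMeet (e e' : Seg) : Prop :=
  ∃ t, e.2.1 < t ∧ t < e.2.2 ∧ e'.2.1 < t ∧ t < e'.2.2 ∧ lineAt e.1 t = lineAt e'.1 t

/-- A drawing in which distinct segments do not cross. -/
structure IsPlane (P : Finset ℝ) (Y : ℝ → ℝ) (E : Finset Seg) : Prop extends
    IsDrawing P Y E where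
  noCross : ∀ e ∈ E, ∀ e' ∈ E, SegMeet e e' → e = e'

theorem lineAt_crossing {ℓ ℓ' : ℝ × ℝ} {w t : ℝ} (hwt : w < t)
    (h1 : lineAt ℓ w < lineAt ℓ' w) (h2 : lineAt ℓ' t < lineAt ℓ t) :
    ∃ s, w < s ∧ s < t ∧ lineAt ℓ s = lineAt ℓ' s := by
  have hc : ContinuousOn (fun s => lineAt ℓ s - lineAt ℓ' s) (Set.Icc w t) := by
    unfold lineAt; fun_prop
  have := intermediate_value_Ioo hwt.le hc
  obtain ⟨s, hs, h0⟩ := this (show (0:ℝ) ∈ _ from ⟨by linarith, by linarith⟩)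
  exact ⟨s, hs.1, hs.2, by simpa [sub_eq_zero] using h0⟩

theorem line_eq_of_two {ℓ ℓ' : ℝ × ℝ} {s t : ℝ} (hst : s ≠ t)
    (h1 : lineAt ℓ s = lineAt ℓ' s) (h2 : lineAt ℓ t = lineAt ℓ' t) : ℓ = ℓ' := by
  unfold lineAt at h1 h2
  have h3 : (ℓ.1 - ℓ'.1) * (s - t) = 0 := by linarith
  rcases mul_eq_zero.1 h3 with h | h
  · have h4 : ℓ.1 = ℓ'.1 := by linarith
    refine Prod.ext h4 ?_
    rw [h4] at h1; linarith
  · exact absurd (sub_eq_zero.1 h) hst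

theorem IsPlane.not_cross {P : Finset ℝ} {Y : ℝ → ℝ} {E : Finset Seg} (h : IsPlane P Y E)
    {e e' : Seg} (he : e ∈ E) (he' : e' ∈ E) {w t : ℝ} (hw : e.2.1 ≤ w) (hw' : e'.2.1 ≤ w)
    (hwt : w < t) (ht : t ≤ e.2.2) (ht' : t ≤ e'.2.2)
    (hlt : lineAt e.1 w < lineAt e'.1 w) : lineAt e.1 t ≤ lineAt e'.1 t := by
  by_contra! hc
  obtain ⟨s, h1, h2, h3⟩ := lineAt_crossing hwt hlt hc
  have := h.noCross e he e' he' ⟨s, by linarith, by linarith, by linarith, by linarith, h3⟩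
  subst this
  exact lt_irrefl _ hlt

/-- Two segments arriving at the same right endpoint with the same slope coincide. -/
theorem IsPlane.eq_of_slope {P : Finset ℝ} {Y : ℝ → ℝ} {E : Finset Seg} (h : IsPlane P Y E)
    {e e' : Seg} (he : e ∈ E) (he' : e' ∈ E) (hr : e.2.2 = e'.2.2) (hs : e.1.1 = e'.1.1) :
    e = e' := by
  have h1 := h.lt e he
  have h2 := h.lt e' he'
  have h3 := h.right_on e he
  have h4 := h.right_on e' he'
  rw [← hr] at h4 h2
  have hl : max e.2.1 e'.2.1 < e.2.2 := max_lt h1 h2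
  obtain ⟨t, ht1, ht2⟩ := exists_between hl
  refine h.noCross e he e' he' ⟨t, (le_max_left _ _).trans_lt ht1, ht2,
    (le_max_right _ _).trans_lt ht1, hr ▸ ht2, ?_⟩
  unfold lineAt at *
  rw [hs] at h3 ⊢
  linarith

/-- `e₂` is the segment arriving at the right endpoint of `e₁` immediately above `e₁`, and `w` is
the last vertex of the wedge between them. -/
structure IsWedge (P : Finset ℝ) (Y : ℝ → ℝ) (E : Finset Seg) (e₁ e₂ : Seg) (w : ℝ) : Prop where
  mem₁ : e₁ ∈ E
  mem₂ : e₂ ∈ E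
  right_eq : e₂.2.2 = e₁.2.2
  slope_lt : e₂.1.1 < e₁.1.1
  adj : ∀ g ∈ E, g.2.2 = e₁.2.2 → e₂.1.1 < g.1.1 → e₁.1.1 ≤ g.1.1
  w_mem : w ∈ P
  left₁ : e₁.2.1 ≤ w
  left₂ : e₂.2.1 ≤ w
  w_lt : w < e₁.2.2
  low : lineAt e₁.1 w ≤ Y w
  high : Y w ≤ lineAt e₂.1 w
  last : ∀ v ∈ P, w < v → v < e₁.2.2 → lineAt e₁.1 v ≤ Y v → ¬ Y v ≤ lineAt e₂.1 v

theorem IsWedge.not_between {P : Finset ℝ} {Y : ℝ → ℝ} {E : Finset Seg} (h : IsPlane P Y E)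
    {e₁ e₂ g : Seg} {w : ℝ} (hW : IsWedge P Y E e₁ e₂ w) (hg : g ∈ E) (hgl : g.2.1 < w)
    (hgr : w < g.2.2) (hlo : lineAt e₁.1 w < lineAt g.1 w)
    (hhi : lineAt g.1 w < lineAt e₂.1 w) : False := by
  have hr := hW.right_eq
  have hw := hW.w_lt
  rcases lt_or_ge g.2.2 e₁.2.2 with hc | hc
  · have h1 := h.not_cross hW.mem₁ hg hW.left₁ hgl.le hgr hc.le le_rfl hlo
    have h2 := h.not_cross hg hW.mem₂ hgl.le hW.left₂ hgr le_rfl (by linarith) hhi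
    rw [h.right_on g hg] at h1 h2
    exact hW.last _ (h.right_mem g hg) hgr hc h1 h2
  · have h1 := h.not_cross hW.mem₁ hg hW.left₁ hgl.le hw le_rfl hc hlo
    have h2 := h.not_cross hg hW.mem₂ hgl.le hW.left₂ hw hc (by linarith) hhi
    have h3 := h.right_on _ hW.mem₁
    have h4 := h.right_on _ hW.mem₂
    rw [hr] at h4
    rw [h3] at h1
    rw [h4] at h2
    have h5 : lineAt g.1 e₁.2.2 = Y e₁.2.2 := le_antisymm h2 h1
    rcases hc.lt_or_eq with hc | hc
    · exact h.vert g hg _ (h.right_mem _ hW.mem₁) (by linarith) hc h5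
    · have h6 : e₂.1.1 < g.1.1 := by
        by_contra! hcon
        unfold lineAt at *
        nlinarith
      have h7 := hW.adj g hg hc.symm h6
      unfold lineAt at *
      nlinarith

open Classical in
theorem IsPlane.exists_wedge {P : Finset ℝ} {Y : ℝ → ℝ} {E : Finset Seg} (h : IsPlane P Y E)
    {e₁ : Seg} (he₁ : e₁ ∈ E) (hex : ∃ e ∈ E, e.2.2 = e₁.2.2 ∧ e.1.1 < e₁.1.1) :
    ∃ e₂ w, IsWedge P Y E e₁ e₂ w := by
  obtain ⟨e, he, hee⟩ := hex
  obtain ⟨e₂, he₂, hmax⟩ := Finset.exists_max_image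
    (E.filter fun e => e.2.2 = e₁.2.2 ∧ e.1.1 < e₁.1.1) (fun e => e.1.1)
    ⟨e, Finset.mem_filter.2 ⟨he, hee⟩⟩
  obtain ⟨he₂, hr, hs⟩ := Finset.mem_filter.1 he₂
  have l1 := h.lt _ he₁
  have l2 := h.lt _ he₂
  have r1 := h.right_on _ he₁
  have r2 := h.right_on _ he₂
  rw [hr] at r2
  have key : ∀ t, t < e₁.2.2 → lineAt e₁.1 t < lineAt e₂.1 t := by
    intro t ht
    unfold lineAt at *
    nlinarith
  set W := P.filter fun v => e₁.2.1 ≤ v ∧ e₂.2.1 ≤ v ∧ v < e₁.2.2 ∧ lineAt e₁.1 v ≤ Y v ∧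
    Y v ≤ lineAt e₂.1 v with hWdef
  have hne : W.Nonempty := by
    rcases le_total e₁.2.1 e₂.2.1 with hc | hc
    · refine ⟨e₂.2.1, Finset.mem_filter.2 ⟨h.left_mem _ he₂, hc, le_rfl, by linarith, ?_, ?_⟩⟩
      · rw [← h.left_on _ he₂]; exact (key _ (by linarith)).le
      · rw [← h.left_on _ he₂]
    · refine ⟨e₁.2.1, Finset.mem_filter.2 ⟨h.left_mem _ he₁, le_rfl, hc, by linarith, ?_, ?_⟩⟩
      · rw [← h.left_on _ he₁]
      · rw [← h.left_on _ he₁]; exact (key _ (by linarith)).le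
  obtain ⟨w, hw, hwmax⟩ := Finset.exists_max_image W id hne
  obtain ⟨m0, m1, m2, m3, m4, m5⟩ := Finset.mem_filter.1 hw
  refine ⟨e₂, w, he₁, he₂, hr, hs, ?_, m0, m1, m2, m3, m4, m5, ?_⟩
  · intro g hg hgr hgs
    by_contra! hcon
    have := hmax g (Finset.mem_filter.2 ⟨hg, hgr, hcon⟩)
    linarith
  · intro v hv hwv hv1 hlo hhi
    have := hwmax v (Finset.mem_filter.2 ⟨hv, by linarith, by linarith, hv1, hlo, hhi⟩)
    simp only [id] at this
    linarith

open Classical in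
/-- A drawing without crossings has at most three times as many segments as points. -/
theorem IsPlane.card_le {P : Finset ℝ} {Y : ℝ → ℝ} {E : Finset Seg} (h : IsPlane P Y E) :
    E.card ≤ 3 * P.card := by
  set nonTop : Seg → Prop := fun e₁ => ∃ e ∈ E, e.2.2 = e₁.2.2 ∧ e.1.1 < e₁.1.1 with hnt
  have hex : ∀ e : Seg, ∃ q : Seg × ℝ, e ∈ E → nonTop e → IsWedge P Y E e q.1 q.2 := by
    intro e
    by_cases he : e ∈ E ∧ nonTop e
    · obtain ⟨e₂, w, hw⟩ := h.exists_wedge he.1 he.2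
      exact ⟨(e₂, w), fun _ _ => hw⟩
    · exact ⟨(e, 0), fun h1 h2 => absurd ⟨h1, h2⟩ he⟩
  choose q hq using hex
  set T := E.filter fun e => ¬ nonTop e
  set U := E.filter fun e => nonTop e ∧ (q e).2 ≠ (q e).1.2.1
  set D := E.filter fun e => nonTop e ∧ (q e).2 = (q e).1.2.1
  have hcover : E ⊆ T ∪ U ∪ D := by
    intro e he
    simp only [T, U, D, Finset.mem_union, Finset.mem_filter]
    by_cases h1 : nonTop e
    · by_cases h2 : (q e).2 = (q e).1.2.1
      · exact Or.inr ⟨he, h1, h2⟩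
      · exact Or.inl (Or.inr ⟨he, h1, h2⟩)
    · exact Or.inl (Or.inl ⟨he, h1⟩)
  have hT : T.card ≤ P.card := by
    refine Finset.card_le_card_of_injOn (fun e => e.2.2)
      (fun e he => h.right_mem e (Finset.mem_filter.1 he).1) ?_
    intro e he e' he' hr
    obtain ⟨he, hn⟩ := Finset.mem_filter.1 he
    obtain ⟨he', hn'⟩ := Finset.mem_filter.1 he'
    refine h.eq_of_slope he he' hr (le_antisymm ?_ ?_)
    · by_contra! hc; exact hn ⟨e', he', hr.symm, hc⟩
    · by_contra! hc; exact hn' ⟨e, he, hr, hc⟩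
  have hU : U.card ≤ P.card := by
    have hdat : ∀ e ∈ U, IsWedge P Y E e (q e).1 (q e).2 ∧ (q e).1.2.1 < (q e).2 ∧
        Y (q e).2 < lineAt (q e).1.1 (q e).2 := by
      intro e he
      obtain ⟨he, hn, hne⟩ := Finset.mem_filter.1 he
      have hw := hq e he hn
      have h1 : (q e).1.2.1 < (q e).2 := lt_of_le_of_ne hw.left₂ (Ne.symm hne)
      exact ⟨hw, h1, lt_of_le_of_ne hw.high
        (h.vert _ hw.mem₂ _ hw.w_mem h1 (hw.right_eq ▸ hw.w_lt)).symm⟩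
    refine Finset.card_le_card_of_injOn (fun e => (q e).2)
      (fun e he => (hdat e he).1.w_mem) ?_
    have hle : ∀ e ∈ U, ∀ e' ∈ U, (q e).2 = (q e').2 →
        lineAt (q e').1.1 (q e).2 ≤ lineAt (q e).1.1 (q e).2 := by
      intro e he e' he' heq
      obtain ⟨a1, a2, a3⟩ := hdat e he
      obtain ⟨b1, b2, b3⟩ := hdat e' he'
      by_contra! hc
      have hl := b1.low
      rw [heq] at hc a3 a2
      have hwl := a1.w_lt
      exact b1.not_between h a1.mem₂ a2 (by rw [a1.right_eq, ← heq]; exact hwl)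
        (by linarith) hc
    have hsl : ∀ e ∈ U, ∀ e' ∈ U, (q e).1 = (q e').1 → e.1.1 ≤ e'.1.1 := by
      intro e he e' he' heq
      obtain ⟨a1, a2, a3⟩ := hdat e he
      obtain ⟨b1, b2, b3⟩ := hdat e' he'
      refine a1.adj e' b1.mem₁ ?_ ?_
      · rw [← a1.right_eq, ← b1.right_eq, heq]
      · rw [heq]; exact b1.slope_lt
    intro e he e' he' heq
    simp only at heq
    obtain ⟨a1, a2, a3⟩ := hdat e he
    obtain ⟨b1, b2, b3⟩ := hdat e' he'
    have h2 : (q e).1 = (q e').1 := by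
      refine h.noCross _ a1.mem₂ _ b1.mem₂ ⟨(q e).2, a2, ?_, ?_, ?_, ?_⟩
      · rw [a1.right_eq]; exact a1.w_lt
      · rw [heq]; exact b2
      · rw [heq, b1.right_eq]; exact b1.w_lt
      · refine le_antisymm ?_ (hle e he e' he' heq)
        have := hle e' he' e he heq.symm
        rwa [← heq] at this
    refine h.eq_of_slope a1.mem₁ b1.mem₁ ?_
      (le_antisymm (hsl e he e' he' h2) (hsl e' he' e he h2.symm))
    rw [← a1.right_eq, ← b1.right_eq, h2]
  have hD : D.card ≤ P.card := by
    have hdat : ∀ e ∈ D, IsWedge P Y E e (q e).1 (q e).2 ∧ e.2.1 < (q e).2 ∧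
        lineAt e.1 (q e).2 < Y (q e).2 := by
      intro e he
      obtain ⟨he, hn, hne⟩ := Finset.mem_filter.1 he
      have hw := hq e he hn
      have h1 : e.2.1 < (q e).2 := by
        refine lt_of_le_of_ne hw.left₁ fun heq => ?_
        have e1 := h.left_on _ hw.mem₁
        have e2 := h.left_on _ hw.mem₂
        have e3 := h.right_on _ hw.mem₁
        have e4 := h.right_on _ hw.mem₂
        rw [← hne] at e2
        rw [heq] at e1
        rw [hw.right_eq] at e4
        have := line_eq_of_two hw.w_lt.ne (e1.trans e2.symm) (e3.trans e4.symm)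
        have hs := hw.slope_lt
        rw [this] at hs
        exact lt_irrefl _ hs
      exact ⟨hw, h1, lt_of_le_of_ne hw.low
        (h.vert _ hw.mem₁ _ hw.w_mem h1 hw.w_lt)⟩
    refine Finset.card_le_card_of_injOn (fun e => (q e).2)
      (fun e he => (hdat e he).1.w_mem) ?_
    have hle : ∀ e ∈ D, ∀ e' ∈ D, (q e).2 = (q e').2 →
        lineAt e.1 (q e).2 ≤ lineAt e'.1 (q e).2 := by
      intro e he e' he' heq
      obtain ⟨a1, a2, a3⟩ := hdat e he
      obtain ⟨b1, b2, b3⟩ := hdat e' he'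
      by_contra! hc
      have hl := b1.high
      rw [heq] at hc a3 a2
      have hwl := a1.w_lt
      exact b1.not_between h a1.mem₁ a2 (by rw [← heq]; exact hwl) hc (by linarith)
    intro e he e' he' heq
    simp only at heq
    obtain ⟨a1, a2, a3⟩ := hdat e he
    obtain ⟨b1, b2, b3⟩ := hdat e' he'
    refine h.noCross _ a1.mem₁ _ b1.mem₁ ⟨(q e).2, a2, a1.w_lt, ?_, ?_, ?_⟩
    · rw [heq]; exact b2
    · rw [heq]; exact b1.w_lt
    · refine le_antisymm (hle e he e' he' heq) ?_
      have := hle e' he' e he heq.symm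
      rwa [← heq] at this
  calc E.card ≤ (T ∪ U ∪ D).card := Finset.card_le_card hcover
    _ ≤ T.card + U.card + D.card :=
        (Finset.card_union_le _ _).trans (Nat.add_le_add_right (Finset.card_union_le _ _) _)
    _ ≤ 3 * P.card := by omega

end SzemerediTrotter

section SzemerediTrotterSampling

open Classical in
/-- The ordered pairs of distinct crossing segments. -/
noncomputable def crossings (E : Finset Seg) : Finset (Seg × Seg) :=
  (E ×ˢ E).filter fun p => p.1 ≠ p.2 ∧ SegMeet p.1 p.2

theorem mem_crossings {E : Finset Seg} {p : Seg × Seg} :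
    p ∈ crossings E ↔ (p.1 ∈ E ∧ p.2 ∈ E) ∧ p.1 ≠ p.2 ∧ SegMeet p.1 p.2 := by
  classical
  unfold crossings
  rw [Finset.mem_filter, Finset.mem_product]

theorem IsDrawing.mono {P P' : Finset ℝ} {Y : ℝ → ℝ} {E E' : Finset Seg} (h : IsDrawing P Y E)
    (hP : P' ⊆ P) (hE : E' ⊆ E) (hl : ∀ e ∈ E', e.2.1 ∈ P') (hr : ∀ e ∈ E', e.2.2 ∈ P') :
    IsDrawing P' Y E' :=
  ⟨fun e he => h.lt e (hE he), hl, hr, fun e he => h.left_on e (hE he),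
    fun e he => h.right_on e (hE he), fun e he w hw => h.vert e (hE he) w (hP hw)⟩

theorem IsDrawing.card_le {P : Finset ℝ} {Y : ℝ → ℝ} {E : Finset Seg} (h : IsDrawing P Y E) :
    E.card ≤ 3 * P.card + (crossings E).card := by
  classical
  set G := E.filter fun e => ∀ e' ∈ E, SegMeet e e' → e = e'
  set B := E.filter fun e => ¬ ∀ e' ∈ E, SegMeet e e' → e = e'
  have hG : IsPlane P Y G :=
    { h.mono subset_rfl (Finset.filter_subset _ _)
        (fun e he => h.left_mem e (Finset.mem_filter.1 he).1)
        (fun e he => h.right_mem e (Finset.mem_filter.1 he).1) with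
      noCross := fun e he e' he' => (Finset.mem_filter.1 he).2 e' (Finset.mem_filter.1 he').1 }
  have hB : B ⊆ (crossings E).image Prod.fst := by
    intro e he
    obtain ⟨he, hn⟩ := Finset.mem_filter.1 he
    push Not at hn
    obtain ⟨e', he', hm, hne⟩ := hn
    exact Finset.mem_image.2 ⟨(e, e'), mem_crossings.2 ⟨⟨he, he'⟩, hne, hm⟩, rfl⟩
  have h1 := hG.card_le
  have h2 := (Finset.card_le_card hB).trans Finset.card_image_le
  have h3 : G.card + B.card = E.card := Finset.card_filter_add_card_filter_not _
  omega

theorem IsDrawing.eq_of_line_eq {P : Finset ℝ} {Y : ℝ → ℝ} {E : Finset Seg}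
    (h : IsDrawing P Y E) {e e' : Seg} (he : e ∈ E) (he' : e' ∈ E) (hl : e.1 = e'.1) {t : ℝ}
    (h1 : e.2.1 < t) (h2 : t < e.2.2) (h3 : e'.2.1 < t) (h4 : t < e'.2.2) : e = e' := by
  refine Prod.ext hl (Prod.ext ?_ ?_)
  · rcases lt_trichotomy e.2.1 e'.2.1 with hc | hc | hc
    · refine absurd ?_ (h.vert e he _ (h.left_mem e' he') hc (h3.trans h2))
      rw [hl]; exact h.left_on e' he'
    · exact hc
    · refine absurd ?_ (h.vert e' he' _ (h.left_mem e he) hc (h1.trans h4))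
      rw [← hl]; exact h.left_on e he
  · rcases lt_trichotomy e.2.2 e'.2.2 with hc | hc | hc
    · refine absurd ?_ (h.vert e' he' _ (h.right_mem e he) (h3.trans h2) hc)
      rw [← hl]; exact h.right_on e he
    · exact hc
    · refine absurd ?_ (h.vert e he _ (h.right_mem e' he') (h1.trans h4) hc)
      rw [hl]; exact h.right_on e' he'

theorem IsDrawing.line_ne {P : Finset ℝ} {Y : ℝ → ℝ} {E : Finset Seg} (h : IsDrawing P Y E)
    {p : Seg × Seg} (hp : p ∈ crossings E) : p.1.1 ≠ p.2.1 := by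
  obtain ⟨⟨m1, m2⟩, hne, t, h1, h2, h3, h4, -⟩ := mem_crossings.1 hp
  exact fun hl => hne (h.eq_of_line_eq m1 m2 hl h1 h2 h3 h4)

open Classical in
theorem IsDrawing.card_endpoints {P : Finset ℝ} {Y : ℝ → ℝ} {E : Finset Seg}
    (h : IsDrawing P Y E) {p : Seg × Seg} (hp : p ∈ crossings E) :
    ({p.1.2.1, p.1.2.2, p.2.2.1, p.2.2.2} : Finset ℝ).card = 4 := by
  have hl := h.line_ne hp
  obtain ⟨⟨m1, m2⟩, hne, t, h1, h2, h3, h4, h5⟩ := mem_crossings.1 hp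
  have key : ∀ x, x ≠ t → lineAt p.1.1 x = Y x → lineAt p.2.1 x = Y x → False :=
    fun x hx hx1 hx2 => hl (line_eq_of_two hx (hx1.trans hx2.symm) h5)
  have l1 := h.left_on _ m1
  have l2 := h.left_on _ m2
  have r1 := h.right_on _ m1
  have r2 := h.right_on _ m2
  have n1 : p.1.2.1 ≠ p.1.2.2 := (h1.trans h2).ne
  have n2 : p.1.2.1 ≠ p.2.2.1 := fun hc => key _ h1.ne l1 (by rw [hc]; exact l2)
  have n3 : p.1.2.1 ≠ p.2.2.2 := (h1.trans h4).ne
  have n4 : p.1.2.2 ≠ p.2.2.1 := (h3.trans h2).ne'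
  have n5 : p.1.2.2 ≠ p.2.2.2 := fun hc => key _ h2.ne' r1 (by rw [hc]; exact r2)
  have n6 : p.2.2.1 ≠ p.2.2.2 := (h3.trans h4).ne
  rw [Finset.card_insert_of_notMem (by simp [n1, n2, n3]),
    Finset.card_insert_of_notMem (by simp [n4, n5]),
    Finset.card_insert_of_notMem (by simp [n6]), Finset.card_singleton]

theorem IsDrawing.card_crossings_le {P : Finset ℝ} {Y : ℝ → ℝ} {E : Finset Seg}
    (h : IsDrawing P Y E) {Λ : Finset (ℝ × ℝ)} (hΛ : ∀ e ∈ E, e.1 ∈ Λ) :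
    (crossings E).card ≤ Λ.card ^ 2 := by
  rw [sq, ← Finset.card_product]
  refine Finset.card_le_card_of_injOn (fun p => (p.1.1, p.2.1)) ?_ ?_
  · intro p hp
    obtain ⟨⟨m1, m2⟩, -⟩ := mem_crossings.1 hp
    exact Finset.mem_product.2 ⟨hΛ p.1 m1, hΛ p.2 m2⟩
  · intro p hp q hq hpq
    obtain ⟨e1, e2⟩ := Prod.mk.inj hpq
    have hl := h.line_ne hp
    obtain ⟨⟨m1, m2⟩, hne, t, h1, h2, h3, h4, h5⟩ := mem_crossings.1 hp
    obtain ⟨⟨m1', m2'⟩, hne', t', h1', h2', h3', h4', h5'⟩ := mem_crossings.1 hq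
    have ht : t = t' := by
      by_contra hc
      rw [← e1, ← e2] at h5'
      exact hl (line_eq_of_two hc h5 h5')
    subst ht
    exact Prod.ext (h.eq_of_line_eq m1 m1' e1 h1 h2 h1' h2')
      (h.eq_of_line_eq m2 m2' e2 h3 h4 h3' h4')

open Classical in
theorem card_functions_vanishing {ι : Type*} [Fintype ι] (q : ℕ) [NeZero q] (S : Finset ι) :
    (Finset.univ.filter fun χ : ι → Fin q => ∀ i ∈ S, χ i = 0).card * q ^ S.card =
      Fintype.card (ι → Fin q) := by
  have h1 : (Finset.univ.filter fun χ : ι → Fin q => ∀ i ∈ S, χ i = 0) =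
      Fintype.piFinset fun i => if i ∈ S then {0} else Finset.univ := by
    ext χ
    simp only [Finset.mem_filter, Finset.mem_univ, true_and, Fintype.mem_piFinset]
    refine forall_congr' fun i => ?_
    by_cases hi : i ∈ S <;> simp [hi]
  have h2 : ∀ i, (if i ∈ S then ({0} : Finset (Fin q)) else Finset.univ).card =
      if i ∈ S then 1 else q := by
    intro i
    by_cases hi : i ∈ S <;> simp [hi]
  rw [h1, Fintype.card_piFinset, Finset.prod_congr rfl fun i _ => h2 i, Finset.prod_ite]
  simp only [Finset.prod_const_one, one_mul, Finset.prod_const]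
  rw [← pow_add, Fintype.card_fun, Fintype.card_fin]
  congr 1
  have := Finset.card_filter_add_card_filter_not (s := (Finset.univ : Finset ι)) (· ∈ S)
  rw [Finset.filter_mem_eq_inter, Finset.univ_inter, Finset.card_univ] at this
  omega

open Classical in
/-- A uniformly random subset of density `1 / q`. -/
theorem exists_sampling (P : Finset ℝ) {q : ℕ} (hq : 1 ≤ q) :
    ∃ (Ω : Type) (_ : Fintype Ω) (A : Ω → Finset ℝ), (∀ ω, A ω ⊆ P) ∧ 0 < Fintype.card Ω ∧
      ∀ S ⊆ P, (Finset.univ.filter fun ω => S ⊆ A ω).card * q ^ S.card = Fintype.card Ω := by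
  have : NeZero q := ⟨by omega⟩
  refine ⟨P → Fin q, inferInstance, fun χ => P.filter fun x => ∀ h : x ∈ P, χ ⟨x, h⟩ = 0,
    fun χ => Finset.filter_subset _ _, Fintype.card_pos, fun S hS => ?_⟩
  have h := card_functions_vanishing (ι := P) q (S.subtype (· ∈ P))
  have hc : (S.subtype (· ∈ P)).card = S.card := by
    rw [Finset.card_subtype, Finset.filter_true_of_mem fun x hx => hS hx]
  rw [hc] at h
  convert h using 3
  ext χ
  simp only [Finset.mem_filter, Finset.mem_univ, true_and, Finset.mem_subtype]
  constructor
  · intro h1 i hi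
    exact (Finset.mem_filter.1 (h1 hi)).2 i.2
  · intro h1 x hx
    exact Finset.mem_filter.2 ⟨hS hx, fun hp => h1 ⟨x, hp⟩ hx⟩

theorem IsDrawing.card_le_of_sampling {P : Finset ℝ} {Y : ℝ → ℝ} {E : Finset Seg}
    (h : IsDrawing P Y E) {q : ℕ} (hq : 1 ≤ q) :
    E.card * q ^ 2 ≤ 3 * P.card * q ^ 3 + (crossings E).card := by
  classical
  obtain ⟨Ω, _, A, hA, hpos, hcount⟩ := exists_sampling P hq
  have hswap : ∀ {β : Type} (F : Finset β) (V : β → Finset ℝ) (k : ℕ), (∀ b ∈ F, V b ⊆ P) →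
      (∀ b ∈ F, (V b).card = k) →
      (∑ ω, (F.filter fun b => V b ⊆ A ω).card) * q ^ k = F.card * Fintype.card Ω := by
    intro β F V k hV hk
    have : ∑ ω, (F.filter fun b => V b ⊆ A ω).card =
        ∑ b ∈ F, (Finset.univ.filter fun ω => V b ⊆ A ω).card := by
      simp only [Finset.card_filter]
      exact Finset.sum_comm
    rw [this, Finset.sum_mul, Finset.sum_congr rfl (g := fun _ => Fintype.card Ω)]
    · simp
    · intro b hb
      rw [← hk b hb]
      exact hcount _ (hV b hb)
  have hE := hswap E (fun e => {e.2.1, e.2.2}) 2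
    (fun e he => by
      intro x hx
      rcases Finset.mem_insert.1 hx with rfl | hx
      · exact h.left_mem e he
      · rw [Finset.mem_singleton.1 hx]; exact h.right_mem e he)
    (fun e he => Finset.card_pair (h.lt e he).ne)
  have hP := hswap P (fun x => {x}) 1 (fun x hx => Finset.singleton_subset_iff.2 hx)
    (fun x _ => Finset.card_singleton x)
  have hC := hswap (crossings E) (fun p => {p.1.2.1, p.1.2.2, p.2.2.1, p.2.2.2}) 4
    (fun p hp => by
      obtain ⟨⟨m1, m2⟩, -⟩ := mem_crossings.1 hp
      intro x hx
      simp only [Finset.mem_insert, Finset.mem_singleton] at hx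
      rcases hx with rfl | rfl | rfl | rfl
      · exact h.left_mem _ m1
      · exact h.right_mem _ m1
      · exact h.left_mem _ m2
      · exact h.right_mem _ m2)
    (fun p hp => h.card_endpoints hp)
  have hω : ∀ ω, (E.filter fun e => {e.2.1, e.2.2} ⊆ A ω).card ≤
      3 * (P.filter fun x => {x} ⊆ A ω).card +
        ((crossings E).filter fun p =>
          {p.1.2.1, p.1.2.2, p.2.2.1, p.2.2.2} ⊆ A ω).card := by
    intro ω
    set E' := E.filter fun e => {e.2.1, e.2.2} ⊆ A ω
    have hsub : E' ⊆ E := Finset.filter_subset _ _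
    have hd : IsDrawing (A ω) Y E' := h.mono (hA ω) hsub
      (fun e he => (Finset.mem_filter.1 he).2 (by simp))
      (fun e he => (Finset.mem_filter.1 he).2 (by simp))
    refine hd.card_le.trans (Nat.add_le_add (Nat.mul_le_mul_left _ ?_) ?_)
    · exact Finset.card_le_card fun x hx =>
        Finset.mem_filter.2 ⟨hA ω hx, Finset.singleton_subset_iff.2 hx⟩
    · refine Finset.card_le_card fun p hp => ?_
      obtain ⟨⟨m1, m2⟩, h2⟩ := mem_crossings.1 hp
      refine Finset.mem_filter.2 ⟨mem_crossings.2 ⟨⟨hsub m1, hsub m2⟩, h2⟩, ?_⟩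
      have k1 := (Finset.mem_filter.1 m1).2
      have k2 := (Finset.mem_filter.1 m2).2
      intro x hx
      simp only [Finset.mem_insert, Finset.mem_singleton] at hx
      rcases hx with rfl | rfl | rfl | rfl
      · exact k1 (by simp)
      · exact k1 (by simp)
      · exact k2 (by simp)
      · exact k2 (by simp)
  have hsum := Finset.sum_le_sum fun ω (_ : ω ∈ Finset.univ) => hω ω
  rw [Finset.sum_add_distrib, ← Finset.mul_sum] at hsum
  set sE := ∑ ω, (E.filter fun e => {e.2.1, e.2.2} ⊆ A ω).card
  set sP := ∑ ω, (P.filter fun x => {x} ⊆ A ω).card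
  set sC := ∑ ω, ((crossings E).filter fun p =>
          {p.1.2.1, p.1.2.2, p.2.2.1, p.2.2.2} ⊆ A ω).card
  have := Nat.mul_le_mul_right (q ^ 4) hsum
  refine Nat.le_of_mul_le_mul_right ?_ hpos
  calc E.card * q ^ 2 * Fintype.card Ω = sE * q ^ 4 := by rw [mul_right_comm, ← hE]; ring
    _ ≤ (3 * sP + sC) * q ^ 4 := this
    _ = 3 * (sP * q ^ 1) * q ^ 3 + sC * q ^ 4 := by ring
    _ = _ := by rw [hP, hC]; ring

/-- The Szemerédi–Trotter incidence bound with a free sampling parameter `q`. -/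
theorem szemeredi_trotter (P : Finset ℝ) (Y : ℝ → ℝ) (Λ : Finset (ℝ × ℝ)) {q : ℕ} (hq : 1 ≤ q) :
    ((∑ ℓ ∈ Λ, (P.filter fun x => lineAt ℓ x = Y x).card) * q ^ 2 : ℕ) ≤
      Λ.card * q ^ 2 + 3 * P.card * q ^ 3 + Λ.card ^ 2 := by
  classical
  set E : Finset Seg := (Λ ×ˢ (P ×ˢ P)).filter fun e => e.2.1 < e.2.2 ∧
    lineAt e.1 e.2.1 = Y e.2.1 ∧ lineAt e.1 e.2.2 = Y e.2.2 ∧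
      ∀ w ∈ P, e.2.1 < w → w < e.2.2 → lineAt e.1 w ≠ Y w with hE
  have hmem : ∀ e : Seg, e ∈ E ↔ (e.1 ∈ Λ ∧ e.2.1 ∈ P ∧ e.2.2 ∈ P) ∧ e.2.1 < e.2.2 ∧
    lineAt e.1 e.2.1 = Y e.2.1 ∧ lineAt e.1 e.2.2 = Y e.2.2 ∧
      ∀ w ∈ P, e.2.1 < w → w < e.2.2 → lineAt e.1 w ≠ Y w := by
    intro e
    rw [hE, Finset.mem_filter, Finset.mem_product, Finset.mem_product]
  have hd : IsDrawing P Y E :=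
    ⟨fun e he => ((hmem e).1 he).2.1, fun e he => ((hmem e).1 he).1.2.1,
      fun e he => ((hmem e).1 he).1.2.2, fun e he => ((hmem e).1 he).2.2.1,
      fun e he => ((hmem e).1 he).2.2.2.1, fun e he => ((hmem e).1 he).2.2.2.2⟩
  have h1 := hd.card_le_of_sampling hq
  have h2 := hd.card_crossings_le (Λ := Λ) fun e he => ((hmem e).1 he).1.1
  have h3 : ∑ ℓ ∈ Λ, (P.filter fun x => lineAt ℓ x = Y x).card ≤ E.card + Λ.card := by
    have hfib : E.card = ∑ ℓ ∈ Λ, (E.filter fun e => e.1 = ℓ).card :=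
      Finset.card_eq_sum_card_fiberwise fun e he => ((hmem e).1 he).1.1
    rw [hfib, Finset.card_eq_sum_ones Λ, ← Finset.sum_add_distrib]
    refine Finset.sum_le_sum fun ℓ hℓ => ?_
    set Q := P.filter fun x => lineAt ℓ x = Y x with hQ
    rcases Q.eq_empty_or_nonempty with h0 | hne
    · simp [h0]
    have hnext : ∀ x, ∃ y, x ∈ Q.erase (Q.max' hne) →
        y ∈ Q ∧ x < y ∧ ∀ w ∈ Q, x < w → y ≤ w := by
      intro x
      by_cases hx : x ∈ Q.erase (Q.max' hne)
      · obtain ⟨hx1, hx2⟩ := Finset.mem_erase.1 hx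
        have hlt : x < Q.max' hne := lt_of_le_of_ne (Q.le_max' x hx2) hx1
        obtain ⟨y, hy, hymin⟩ := Finset.exists_min_image (Q.filter fun w => x < w) id
          ⟨_, Finset.mem_filter.2 ⟨Q.max'_mem hne, hlt⟩⟩
        obtain ⟨hy1, hy2⟩ := Finset.mem_filter.1 hy
        exact ⟨y, fun _ => ⟨hy1, hy2, fun w hw hxw => hymin w (Finset.mem_filter.2 ⟨hw, hxw⟩)⟩⟩
      · exact ⟨0, fun h => absurd h hx⟩
    choose nx hnx using hnext
    have : (Q.erase (Q.max' hne)).card ≤ (E.filter fun e => e.1 = ℓ).card := by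
      refine Finset.card_le_card_of_injOn (fun x => (ℓ, x, nx x)) ?_ ?_
      · intro x hx
        obtain ⟨k1, k2, k3⟩ := hnx x hx
        obtain ⟨hy1, hy2⟩ := Finset.mem_filter.1 k1
        obtain ⟨hx1, hx2⟩ := Finset.mem_filter.1 (Finset.mem_of_mem_erase hx)
        refine Finset.mem_filter.2 ⟨(hmem _).2 ⟨⟨hℓ, hx1, hy1⟩, k2, hx2, hy2, ?_⟩, rfl⟩
        intro w hw hxw hwy hcon
        exact absurd (k3 w (Finset.mem_filter.2 ⟨hw, hcon⟩) hxw) (not_le.2 hwy)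
      · intro x _ y _ hxy
        exact (Prod.mk.inj (Prod.mk.inj hxy).2).1
    rw [Finset.card_erase_of_mem (Q.max'_mem hne)] at this
    omega
  calc _ ≤ (E.card + Λ.card) * q ^ 2 := Nat.mul_le_mul_right _ h3
    _ = Λ.card * q ^ 2 + E.card * q ^ 2 := by ring
    _ ≤ _ := by omega

end SzemerediTrotterSampling

section LatticeIncidences

/-- The dot product on `ℤ²`. -/
def dot (n z : ℤ × ℤ) : ℤ := n.1 * z.1 + n.2 * z.2

/-- Rotation by a right angle. -/
def rot (n : ℤ × ℤ) : ℤ × ℤ := (-n.2, n.1)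

/-- A set of pairwise nonparallel nonzero vectors. -/
structure IsDirs (D : Finset (ℤ × ℤ)) : Prop where
  ne_zero : ∀ n ∈ D, n ≠ 0
  eq_of_parallel : ∀ n ∈ D, ∀ n' ∈ D, n.1 * n'.2 = n.2 * n'.1 → n = n'

open Classical in
/-- The number of points of `S` on the line `n · z = s`. -/
noncomputable def cnt (S : Finset (ℤ × ℤ)) (n : ℤ × ℤ) (s : ℤ) : ℕ :=
  (S.filter fun z => dot n z = s).card

theorem eq_of_dot_eq {n n' x y : ℤ × ℤ} (hn : n.1 * n'.2 ≠ n.2 * n'.1)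
    (h1 : dot n x = dot n y) (h2 : dot n' x = dot n' y) : x = y := by
  unfold dot at h1 h2
  have hd : n.1 * n'.2 - n.2 * n'.1 ≠ 0 := sub_ne_zero.2 hn
  refine Prod.ext (mul_left_cancel₀ hd ?_) (mul_left_cancel₀ hd ?_)
  · linear_combination n'.2 * h1 - n.2 * h2
  · linear_combination n.1 * h2 - n'.1 * h1

theorem szemeredi_trotter_lattice {D : Finset (ℤ × ℤ)} (hD : IsDirs D) (A : Finset (ℤ × ℤ))
    (Λ : Finset ((ℤ × ℤ) × ℤ)) (hΛ : ∀ ℓ ∈ Λ, ℓ.1 ∈ D) {q : ℕ} (hq : 1 ≤ q) :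
    (∑ ℓ ∈ Λ, cnt A ℓ.1 ℓ.2) * q ^ 2 ≤ Λ.card * q ^ 2 + 3 * A.card * q ^ 3 + Λ.card ^ 2 := by
  classical
  set K : ℤ := 1 + ∑ z ∈ A, 2 * |z.2| + ∑ ℓ ∈ Λ, |ℓ.1.1| with hK
  have hs1 : 0 ≤ ∑ z ∈ A, 2 * |z.2| := Finset.sum_nonneg fun z _ => by positivity
  have hs2 : 0 ≤ ∑ ℓ ∈ Λ, |ℓ.1.1| := Finset.sum_nonneg fun z _ => by positivity
  have hK1 : ∀ z ∈ A, 2 * |z.2| < K := by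
    intro z hz
    have := Finset.single_le_sum (f := fun z : ℤ × ℤ => 2 * |z.2|)
      (fun i _ => by positivity) hz
    linarith
  have hK2 : ∀ ℓ ∈ Λ, |ℓ.1.1| < K := by
    intro z hz
    have := Finset.single_le_sum (f := fun ℓ : (ℤ × ℤ) × ℤ => |ℓ.1.1|)
      (fun i _ => by positivity) hz
    linarith
  have hden : ∀ ℓ ∈ Λ, ℓ.1.1 - K * ℓ.1.2 ≠ 0 := by
    intro ℓ hℓ h0
    have h1 := hK2 ℓ hℓ
    have h2 : ℓ.1.1 = K * ℓ.1.2 := by linarith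
    by_cases h3 : ℓ.1.2 = 0
    · refine hD.ne_zero _ (hΛ ℓ hℓ) (Prod.ext ?_ h3)
      rw [h2, h3]; simp
    · have h4 : 1 ≤ |ℓ.1.2| := Int.one_le_abs h3
      rw [h2, abs_mul] at h1
      have h5 : |K| = K := abs_of_pos (by linarith)
      rw [h5] at h1
      nlinarith
  set X : ℤ × ℤ → ℝ := fun z => ((K * z.1 + z.2 : ℤ) : ℝ) with hX
  have hXinj : Set.InjOn X A := by
    intro z hz z' hz' h
    have h : K * z.1 + z.2 = K * z'.1 + z'.2 := Int.cast_injective h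
    have h1 := hK1 z hz
    have h2 := hK1 z' hz'
    have h3 : |K * (z.1 - z'.1)| < K := by
      rw [show K * (z.1 - z'.1) = z'.2 - z.2 by linarith]
      exact lt_of_le_of_lt (abs_sub _ _) (by linarith)
    have hz0 : z.1 - z'.1 = 0 := by
      by_contra h0
      have := Int.one_le_abs h0
      rw [abs_mul, abs_of_pos (show 0 < K by linarith)] at h3
      nlinarith
    have e1 : z.1 = z'.1 := by linarith
    exact Prod.ext e1 (by rw [e1] at h; linarith)
  set Y : ℝ → ℝ := fun x => ((Function.invFunOn X A x).1 : ℝ) with hY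
  have hYX : ∀ z ∈ A, Y (X z) = z.1 := by
    intro z hz
    simp only [hY]
    rw [hXinj.leftInvOn_invFunOn hz]
  set den : (ℤ × ℤ) × ℤ → ℝ := fun ℓ => ((ℓ.1.1 - K * ℓ.1.2 : ℤ) : ℝ) with hdenr
  have hden' : ∀ ℓ ∈ Λ, den ℓ ≠ 0 := fun ℓ hℓ => by
    simp only [hdenr]; exact_mod_cast hden ℓ hℓ
  set f : (ℤ × ℤ) × ℤ → ℝ × ℝ := fun ℓ => (-(ℓ.1.2 : ℝ) / den ℓ, (ℓ.2 : ℝ) / den ℓ) with hf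
  have hfinj : Set.InjOn f Λ := by
    intro ℓ hℓ ℓ' hℓ' h
    obtain ⟨h1, h2⟩ := Prod.mk.inj h
    have h3 : ℓ.1 = ℓ'.1 := by
      refine hD.eq_of_parallel _ (hΛ ℓ hℓ) _ (hΛ ℓ' hℓ') ?_
      rw [div_eq_div_iff (hden' ℓ hℓ) (hden' ℓ' hℓ')] at h1
      simp only [hdenr] at h1
      have h1 : -ℓ.1.2 * (ℓ'.1.1 - K * ℓ'.1.2) = -ℓ'.1.2 * (ℓ.1.1 - K * ℓ.1.2) := by
        exact_mod_cast h1
      linarith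
    refine Prod.ext h3 ?_
    have h4 : den ℓ = den ℓ' := by simp only [hdenr]; rw [h3]
    rw [h4, div_left_inj' (hden' ℓ' hℓ')] at h2
    exact_mod_cast h2
  have hinc : ∀ ℓ ∈ Λ, ∀ z ∈ A, dot ℓ.1 z = ℓ.2 ↔ lineAt (f ℓ) (X z) = Y (X z) := by
    intro ℓ hℓ z hz
    rw [hYX z hz]
    have h0 := hden' ℓ hℓ
    simp only [lineAt, hf]
    rw [div_mul_eq_mul_div, ← add_div, div_eq_iff h0]
    simp only [hdenr, hX, dot]
    constructor
    · intro h
      rw [← h]; push_cast; ring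
    · intro h
      have h : -ℓ.1.2 * (K * z.1 + z.2) + ℓ.2 = z.1 * (ℓ.1.1 - K * ℓ.1.2) := by exact_mod_cast h
      linarith
  have key := szemeredi_trotter (A.image X) Y (Λ.image f) hq
  rw [Finset.card_image_of_injOn hXinj, Finset.card_image_of_injOn hfinj,
    Finset.sum_image hfinj] at key
  refine le_trans (Nat.mul_le_mul_right _ (Finset.sum_le_sum fun ℓ hℓ => ?_)) key
  rw [Finset.filter_image, Finset.card_image_of_injOn
    (hXinj.mono (Finset.coe_subset.2 (Finset.filter_subset _ _)))]
  unfold cnt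
  exact Finset.card_le_card fun z hz => by
    obtain ⟨h1, h2⟩ := Finset.mem_filter.1 hz
    exact Finset.mem_filter.2 ⟨h1, (hinc ℓ hℓ z h1).1 h2⟩

/-- The number of `2 ^ k`-rich lines of a set of `4 ^ (k + e)` points. -/
theorem card_rich_le {D : Finset (ℤ × ℤ)} (hD : IsDirs D) {S : Finset (ℤ × ℤ)} {k e : ℕ}
    (hk : 1 ≤ k) (hS : S.card ≤ 4 ^ (k + e)) (Λ : Finset ((ℤ × ℤ) × ℤ))
    (hΛ : ∀ ℓ ∈ Λ, ℓ.1 ∈ D) (hr : ∀ ℓ ∈ Λ, 2 ^ k ≤ cnt S ℓ.1 ℓ.2) :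
    Λ.card ≤ 1400 * 2 ^ (k + 4 * e) := by
  by_contra! hc
  obtain ⟨Λ', hsub, hcard⟩ := Finset.exists_subset_card_eq hc.le
  have h1 := szemeredi_trotter_lattice hD S Λ' (fun ℓ h => hΛ ℓ (hsub h))
    (q := 200 * 2 ^ (2 * e)) (by have := Nat.one_le_two_pow (n := 2 * e); omega)
  have h2 : Λ'.card * 2 ^ k ≤ ∑ ℓ ∈ Λ', cnt S ℓ.1 ℓ.2 := by
    rw [← smul_eq_mul]
    exact Finset.card_nsmul_le_sum _ _ _ fun ℓ h => hr ℓ (hsub h)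
  rw [hcard] at h1 h2
  obtain ⟨k, rfl⟩ : ∃ k', k = k' + 1 := ⟨k - 1, by omega⟩
  set a := 2 ^ k with ha
  set b := 2 ^ e with hb
  have ha1 : 1 ≤ a := Nat.one_le_two_pow
  have hb1 : 1 ≤ b := Nat.one_le_two_pow
  have e1 : 2 ^ (k + 1) = 2 * a := by rw [pow_succ]; ring
  have e2 : 2 ^ (k + 1 + 4 * e) = 2 * a * b ^ 4 := by rw [pow_add, e1, hb, ← pow_mul]; ring
  have e3 : 2 ^ (2 * e) = b ^ 2 := by rw [hb, ← pow_mul]; ring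
  have e4 : 4 ^ (k + 1 + e) = 4 * a ^ 2 * b ^ 2 := by
    rw [pow_add, pow_succ, hb, ha, ← pow_mul, ← pow_mul, mul_comm k, mul_comm e, pow_mul, pow_mul]
    norm_num; ring
  rw [e4] at hS
  rw [e2, e3] at h1
  rw [e1, e2] at h2
  set I := ∑ ℓ ∈ Λ', cnt S ℓ.1 ℓ.2
  have h3 : 1400 * (2 * a * b ^ 4) * (2 * a) * (200 * b ^ 2) ^ 2 ≤ I * (200 * b ^ 2) ^ 2 :=
    Nat.mul_le_mul_right _ h2
  have h4 : 3 * S.card * (200 * b ^ 2) ^ 3 ≤ 3 * (4 * a ^ 2 * b ^ 2) * (200 * b ^ 2) ^ 3 := by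
    gcongr
  have h5 : 0 < a ^ 2 * b ^ 8 := by positivity
  have h6 : a * b ^ 8 ≤ a ^ 2 * b ^ 8 := by
    rw [sq]
    nlinarith [Nat.mul_le_mul_right (a * b ^ 8) ha1]
  nlinarith

/-- Incidences between points and rich lines, counted as pairs (direction, point). -/
theorem card_rich_pairs_le {D : Finset (ℤ × ℤ)} (hD : IsDirs D) {S A : Finset (ℤ × ℤ)}
    {i j k d : ℕ} (hk : 1 ≤ k) (hkj : k ≤ j) (hdk : d ≤ k) (hij : i + d = j)
    (hS : S.card ≤ 4 ^ j) (hA : A.card ≤ 4 ^ i) (s : ℤ) (B : Finset ((ℤ × ℤ) × (ℤ × ℤ)))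
    (hB1 : ∀ b ∈ B, b.1 ∈ D) (hB2 : ∀ b ∈ B, b.2 ∈ A)
    (hB : ∀ b ∈ B, 2 ^ k ≤ cnt S b.1 (dot b.1 b.2 + s)) :
    B.card * 2 ^ (2 * k + d) ≤ 1961403 * 16 ^ j := by
  classical
  obtain ⟨e, rfl⟩ : ∃ e, j = k + e := ⟨j - k, by omega⟩
  set Λ : Finset ((ℤ × ℤ) × ℤ) := B.image fun b => (b.1, dot b.1 b.2)
  have hΛ : ∀ ℓ ∈ Λ, ℓ.1 ∈ D ∧ 2 ^ k ≤ cnt S ℓ.1 (ℓ.2 + s) := by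
    intro ℓ hℓ
    obtain ⟨b, hb, rfl⟩ := Finset.mem_image.1 hℓ
    exact ⟨hB1 b hb, hB b hb⟩
  have hcard : Λ.card ≤ 1400 * 2 ^ (k + 4 * e) := by
    have hinj : Function.Injective fun ℓ : (ℤ × ℤ) × ℤ => (ℓ.1, ℓ.2 + s) := by
      intro ℓ ℓ' h
      obtain ⟨h1, h2⟩ := Prod.mk.inj h
      exact Prod.ext h1 (by linarith)
    rw [← Finset.card_image_of_injective Λ hinj]
    refine card_rich_le hD hk hS _ ?_ ?_
    · intro ℓ hℓ
      obtain ⟨b, hb, rfl⟩ := Finset.mem_image.1 hℓ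
      exact (hΛ b hb).1
    · intro ℓ hℓ
      obtain ⟨b, hb, rfl⟩ := Finset.mem_image.1 hℓ
      exact (hΛ b hb).2
  have hBle : B.card ≤ ∑ ℓ ∈ Λ, cnt A ℓ.1 ℓ.2 := by
    rw [Finset.card_eq_sum_card_fiberwise (f := fun b => (b.1, dot b.1 b.2)) (t := Λ)
      (fun b hb => Finset.mem_image_of_mem _ hb)]
    refine Finset.sum_le_sum fun ℓ _ => ?_
    unfold cnt
    refine Finset.card_le_card_of_injOn Prod.snd ?_ ?_
    · intro b hb
      obtain ⟨hb1, rfl⟩ := Finset.mem_filter.1 hb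
      exact Finset.mem_filter.2 ⟨hB2 b hb1, rfl⟩
    · intro b hb b' hb' h
      obtain ⟨hb1, hb2⟩ := Finset.mem_filter.1 hb
      obtain ⟨hb1', hb2'⟩ := Finset.mem_filter.1 hb'
      exact Prod.ext (by rw [← hb2'] at hb2; exact (Prod.mk.inj hb2).1) h
  have h1 := szemeredi_trotter_lattice hD A Λ (fun ℓ h => (hΛ ℓ h).1)
    (q := 2 ^ (2 * e + d)) Nat.one_le_two_pow
  set L := Λ.card
  have h2 : B.card * (2 ^ (2 * e + d)) ^ 2 ≤
      L * (2 ^ (2 * e + d)) ^ 2 + 3 * 4 ^ i * (2 ^ (2 * e + d)) ^ 3 + L ^ 2 := by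
    refine (Nat.mul_le_mul_right _ hBle).trans (h1.trans ?_)
    gcongr
  have e1 : (2 ^ (2 * e + d)) ^ 2 * 16 ^ (k + e) =
      2 ^ (2 * k + d) * 2 ^ (8 * e + d + 2 * k) := by
    rw [show 16 = 2 ^ 4 by norm_num, ← pow_mul, ← pow_mul, ← pow_add, ← pow_add]
    congr 1; ring
  have t1 : L * (2 ^ (2 * e + d)) ^ 2 ≤ 1400 * 2 ^ (8 * e + d + 2 * k) := by
    calc _ ≤ 1400 * 2 ^ (k + 4 * e) * (2 ^ (2 * e + d)) ^ 2 := Nat.mul_le_mul_right _ hcard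
      _ = 1400 * 2 ^ (k + 4 * e + (2 * e + d) * 2) := by rw [mul_assoc, ← pow_mul, ← pow_add]
      _ ≤ _ := Nat.mul_le_mul_left _ (Nat.pow_le_pow_right two_pos (by omega))
  have t2 : 3 * 4 ^ i * (2 ^ (2 * e + d)) ^ 3 ≤ 3 * 2 ^ (8 * e + d + 2 * k) := by
    rw [show 4 = 2 ^ 2 by norm_num, ← pow_mul, ← pow_mul, mul_assoc, ← pow_add]
    exact Nat.mul_le_mul_left _ (Nat.pow_le_pow_right two_pos (by omega))
  have t3 : L ^ 2 ≤ 1960000 * 2 ^ (8 * e + d + 2 * k) := by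
    calc _ ≤ (1400 * 2 ^ (k + 4 * e)) ^ 2 := by gcongr
      _ = 1960000 * 2 ^ ((k + 4 * e) * 2) := by rw [mul_pow, ← pow_mul]; norm_num
      _ ≤ _ := Nat.mul_le_mul_left _ (Nat.pow_le_pow_right two_pos (by omega))
  have h3 : B.card * (2 ^ (2 * e + d)) ^ 2 ≤ 1961403 * 2 ^ (8 * e + d + 2 * k) := by omega
  have hpos : 0 < (2 ^ (2 * e + d)) ^ 2 := by positivity
  refine Nat.le_of_mul_le_mul_right ?_ hpos
  calc B.card * 2 ^ (2 * k + d) * (2 ^ (2 * e + d)) ^ 2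
      = B.card * (2 ^ (2 * e + d)) ^ 2 * 2 ^ (2 * k + d) := by ring
    _ ≤ 1961403 * 2 ^ (8 * e + d + 2 * k) * 2 ^ (2 * k + d) := Nat.mul_le_mul_right _ h3
    _ = 1961403 * 16 ^ (k + e) * (2 ^ (2 * e + d)) ^ 2 := by
        rw [mul_assoc, mul_assoc, mul_comm (2 ^ (8 * e + d + 2 * k)), ← e1]; ring

/-- Incidences with lines containing at least `2 ^ (j + 1)` points of a set of `4 ^ j` points. -/
theorem card_superrich_pairs_le {D : Finset (ℤ × ℤ)} (hD : IsDirs D) {S : Finset (ℤ × ℤ)}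
    {j : ℕ} (hS : S.card ≤ 4 ^ j) (B : Finset ((ℤ × ℤ) × (ℤ × ℤ)))
    (hB1 : ∀ b ∈ B, b.1 ∈ D) (hB2 : ∀ b ∈ B, b.2 ∈ S)
    (hB : ∀ b ∈ B, 2 ^ (j + 1) ≤ cnt S b.1 (dot b.1 b.2)) :
    B.card ≤ 2 * 4 ^ j := by
  classical
  set Λ : Finset ((ℤ × ℤ) × ℤ) := B.image fun b => (b.1, dot b.1 b.2)
  have hΛ : ∀ ℓ ∈ Λ, ℓ.1 ∈ D ∧ 2 ^ (j + 1) ≤ cnt S ℓ.1 ℓ.2 := by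
    intro ℓ hℓ
    obtain ⟨b, hb, rfl⟩ := Finset.mem_image.1 hℓ
    exact ⟨hB1 b hb, hB b hb⟩
  set T := ∑ ℓ ∈ Λ, cnt S ℓ.1 ℓ.2 with hT
  have hBle : B.card ≤ T := by
    rw [Finset.card_eq_sum_card_fiberwise (f := fun b => (b.1, dot b.1 b.2)) (t := Λ)
      (fun b hb => Finset.mem_image_of_mem _ hb)]
    refine Finset.sum_le_sum fun ℓ _ => ?_
    unfold cnt
    refine Finset.card_le_card_of_injOn Prod.snd ?_ ?_
    · intro b hb
      obtain ⟨hb1, rfl⟩ := Finset.mem_filter.1 hb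
      exact Finset.mem_filter.2 ⟨hB2 b hb1, rfl⟩
    · intro b hb b' hb' h
      obtain ⟨hb1, hb2⟩ := Finset.mem_filter.1 hb
      obtain ⟨hb1', hb2'⟩ := Finset.mem_filter.1 hb'
      exact Prod.ext (by rw [← hb2'] at hb2; exact (Prod.mk.inj hb2).1) h
  have hL : Λ.card * 2 ^ (j + 1) ≤ T := by
    rw [← smul_eq_mul]
    exact Finset.card_nsmul_le_sum _ _ _ fun ℓ h => (hΛ ℓ h).2
  have hTx : T = ∑ x ∈ S, (Λ.filter fun ℓ => dot ℓ.1 x = ℓ.2).card := by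
    simp only [hT, cnt, Finset.card_filter]
    exact Finset.sum_comm
  have hsq : ∑ x ∈ S, (Λ.filter fun ℓ => dot ℓ.1 x = ℓ.2).card ^ 2 ≤ T + Λ.card ^ 2 := by
    have h1 : ∀ x, (Λ.filter fun ℓ => dot ℓ.1 x = ℓ.2).card ^ 2 =
        ∑ p ∈ Λ ×ˢ Λ, if dot p.1.1 x = p.1.2 ∧ dot p.2.1 x = p.2.2 then 1 else 0 := by
      intro x
      rw [sq, ← Finset.card_product, ← Finset.filter_product, Finset.card_filter]
    rw [Finset.sum_congr rfl fun x _ => h1 x, Finset.sum_comm, Finset.sum_product]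
    have h2 : ∀ ℓ ∈ Λ, ∀ ℓ' ∈ Λ, (∑ x ∈ S, if dot ℓ.1 x = ℓ.2 ∧ dot ℓ'.1 x = ℓ'.2 then 1 else 0) ≤
        (if ℓ = ℓ' then cnt S ℓ.1 ℓ.2 else 0) + 1 := by
      intro ℓ hℓ ℓ' hℓ'
      rw [← Finset.card_filter]
      by_cases heq : ℓ = ℓ'
      · subst heq
        simp only [and_self, if_true, cnt]
        omega
      · rw [if_neg heq, zero_add, Finset.card_le_one]
        intro x hx y hy
        obtain ⟨-, hx1, hx2⟩ := Finset.mem_filter.1 hx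
        obtain ⟨-, hy1, hy2⟩ := Finset.mem_filter.1 hy
        refine eq_of_dot_eq (n := ℓ.1) (n' := ℓ'.1) ?_ (hx1.trans hy1.symm) (hx2.trans hy2.symm)
        intro hp
        have := hD.eq_of_parallel _ (hΛ ℓ hℓ).1 _ (hΛ ℓ' hℓ').1 hp
        exact heq (Prod.ext this (by rw [← hx1, ← hx2, this]))
    refine (Finset.sum_le_sum fun ℓ hℓ => Finset.sum_le_sum fun ℓ' hℓ' => h2 ℓ hℓ ℓ' hℓ').trans ?_
    simp only [Finset.sum_add_distrib, Finset.sum_ite_eq, Finset.sum_const, smul_eq_mul, mul_one]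
    refine Nat.add_le_add (Finset.sum_le_sum fun ℓ hℓ => ?_) (by rw [sq])
    simp [hℓ]
  have hcs : T ^ 2 ≤ S.card * (T + Λ.card ^ 2) := by
    rw [hTx] at hsq ⊢
    exact sq_sum_le_card_mul_sum_sq.trans (Nat.mul_le_mul_left _ hsq)
  refine hBle.trans ?_
  have h4 : (Λ.card * 2 ^ (j + 1)) ^ 2 ≤ T ^ 2 := by gcongr
  have h5 : (2 ^ (j + 1)) ^ 2 = 4 * 4 ^ j := by
    rw [← pow_mul, mul_comm, pow_mul, pow_succ]; norm_num; ring
  rw [mul_pow, h5] at h4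
  have h6 : T ^ 2 ≤ 4 ^ j * (T + Λ.card ^ 2) := hcs.trans (Nat.mul_le_mul_right _ hS)
  by_contra! hc
  nlinarith

end LatticeIncidences

section SumLemmas

theorem sum_le_sum_of_injOn {ι κ : Type*} {s : Finset ι} {t : Finset κ} {f : ι → ℝ} {g : κ → ℝ}
    (e : ι → κ) (hmem : ∀ i ∈ s, e i ∈ t) (hinj : Set.InjOn e s) (hfg : ∀ i ∈ s, f i ≤ g (e i))
    (hg : ∀ k ∈ t, 0 ≤ g k) : ∑ i ∈ s, f i ≤ ∑ k ∈ t, g k := by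
  classical
  calc ∑ i ∈ s, f i ≤ ∑ i ∈ s, g (e i) := Finset.sum_le_sum hfg
    _ = ∑ k ∈ s.image e, g k := (Finset.sum_image hinj).symm
    _ ≤ _ := Finset.sum_le_sum_of_subset_of_nonneg
        (Finset.image_subset_iff.2 hmem) fun k hk _ => hg k hk

/-- The square of the norm of the fibrewise sums of `w` along `key`. -/
noncomputable def energy {ι κ : Type*} [DecidableEq κ] (R : Finset ι) (key : ι → κ)
    (w : ι → ℝ) : ℝ :=
  ∑ r ∈ R, ∑ r' ∈ R, if key r = key r' then w r * w r' else 0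

theorem energy_eq {ι κ : Type*} [DecidableEq κ] (R : Finset ι) (key : ι → κ) (w : ι → ℝ)
    {J : Finset κ} (hJ : ∀ r ∈ R, key r ∈ J) :
    energy R key w = ∑ k ∈ J, (∑ r ∈ R with key r = k, w r) ^ 2 := by
  unfold energy
  rw [← Finset.sum_fiberwise_of_maps_to hJ]
  refine Finset.sum_congr rfl fun k _ => ?_
  rw [sq, Finset.sum_mul]
  refine Finset.sum_congr rfl fun r hr => ?_
  rw [Finset.mul_sum, Finset.sum_filter]
  refine Finset.sum_congr rfl fun r' _ => ?_
  rw [(Finset.mem_filter.1 hr).2]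
  simp only [eq_comm]

theorem sum_related_le_energy {ι κ : Type*} [DecidableEq κ] (R : Finset ι) (key : ι → κ)
    (w : ι → ℝ) (rel : κ → κ → Prop) [DecidableRel rel]
    (hsymm : ∀ k k', rel k k' → rel k' k) (K : ℕ)
    (hK : ∀ k, ((R.image key).filter fun k' => rel k k').card ≤ K) :
    ∑ r ∈ R, ∑ r' ∈ R, (if rel (key r) (key r') then w r * w r' else 0) ≤
      K * energy R key w := by
  set J := R.image key
  have hJ : ∀ r ∈ R, key r ∈ J := fun r hr => Finset.mem_image_of_mem _ hr
  set H : κ → ℝ := fun k => ∑ r ∈ R with key r = k, w r with hH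
  have h1 : ∑ r ∈ R, ∑ r' ∈ R, (if rel (key r) (key r') then w r * w r' else 0) =
      ∑ k ∈ J, ∑ k' ∈ J, if rel k k' then H k * H k' else 0 := by
    rw [← Finset.sum_fiberwise_of_maps_to hJ]
    refine Finset.sum_congr rfl fun k _ => ?_
    calc _ = ∑ r ∈ R with key r = k, ∑ k' ∈ J, ∑ r' ∈ R with key r' = k',
          (if rel k k' then w r * w r' else 0) := by
          refine Finset.sum_congr rfl fun r hr => ?_
          rw [← Finset.sum_fiberwise_of_maps_to hJ]
          refine Finset.sum_congr rfl fun k' _ => Finset.sum_congr rfl fun r' hr' => ?_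
          rw [(Finset.mem_filter.1 hr).2, (Finset.mem_filter.1 hr').2]
      _ = _ := by
          rw [Finset.sum_comm]
          refine Finset.sum_congr rfl fun k' _ => ?_
          by_cases h : rel k k'
          · simp only [h, if_true, hH]
            rw [Finset.sum_mul_sum]
          · simp [h]
  rw [h1, energy_eq R key w hJ]
  have hs : ∑ k ∈ J, ∑ k' ∈ J, (if rel k k' then H k' ^ 2 else 0) =
      ∑ k ∈ J, ∑ k' ∈ J, (if rel k k' then H k ^ 2 else 0) := by
    rw [Finset.sum_comm]
    refine Finset.sum_congr rfl fun k _ => Finset.sum_congr rfl fun k' _ => ?_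
    exact if_congr ⟨hsymm _ _, hsymm _ _⟩ rfl rfl
  calc _ ≤ ∑ k ∈ J, ∑ k' ∈ J, ((if rel k k' then H k ^ 2 else 0) / 2 +
        (if rel k k' then H k' ^ 2 else 0) / 2) := by
        refine Finset.sum_le_sum fun k _ => Finset.sum_le_sum fun k' _ => ?_
        split_ifs
        · nlinarith [sq_nonneg (H k - H k')]
        · simp
    _ = ∑ k ∈ J, ∑ k' ∈ J, (if rel k k' then H k ^ 2 else 0) := by
        simp only [Finset.sum_add_distrib, ← Finset.sum_div]
        rw [hs]; ring
    _ ≤ ∑ k ∈ J, K * H k ^ 2 := by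
        refine Finset.sum_le_sum fun k _ => ?_
        rw [← Finset.sum_filter, Finset.sum_const, nsmul_eq_mul]
        gcongr
        exact hK k
    _ = _ := by rw [← Finset.mul_sum]

theorem energy_mono {ι κ : Type*} [DecidableEq κ] {R : Finset ι} {key : ι → κ} {w w' : ι → ℝ}
    (hw : ∀ r ∈ R, 0 ≤ w r) (h : ∀ r ∈ R, w r ≤ w' r) : energy R key w ≤ energy R key w' := by
  refine Finset.sum_le_sum fun r hr => Finset.sum_le_sum fun r' hr' => ?_
  split_ifs
  · exact mul_le_mul (h r hr) (h r' hr') (hw r' hr') ((hw r hr).trans (h r hr))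
  · exact le_rfl

theorem energy_sum_le {ι κ τ : Type*} [DecidableEq κ] (R : Finset ι) (key : ι → κ)
    (K : Finset τ) (φ : τ → ι → ℝ) :
    energy R key (fun r => ∑ t ∈ K, φ t r) ≤ K.card * ∑ t ∈ K, energy R key (φ t) := by
  have hJ : ∀ r ∈ R, key r ∈ R.image key := fun r hr => Finset.mem_image_of_mem _ hr
  rw [energy_eq R key _ hJ, Finset.sum_congr rfl fun t _ => energy_eq R key (φ t) hJ,
    Finset.sum_comm, Finset.mul_sum]
  refine Finset.sum_le_sum fun k _ => ?_
  rw [Finset.sum_comm]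
  exact sq_sum_le_card_mul_sum_sq

/-- Minkowski's inequality for fibrewise sums. -/
theorem energy_sum_le_sq {ι κ τ : Type*} [DecidableEq κ] (R : Finset ι) (key : ι → κ)
    (K : Finset τ) (φ : τ → ι → ℝ) (a B : τ → ℝ) (ha : ∀ t ∈ K, 0 ≤ a t) (hB : ∀ t ∈ K, 0 ≤ B t)
    (h : ∀ t ∈ K, energy R key (φ t) ≤ B t ^ 2) :
    energy R key (fun r => ∑ t ∈ K, a t * φ t r) ≤ (∑ t ∈ K, a t * B t) ^ 2 := by
  have hJ : ∀ r ∈ R, key r ∈ R.image key := fun r hr => Finset.mem_image_of_mem _ hr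
  set J := R.image key
  set n : τ → κ → ℝ := fun t k => ∑ r ∈ R with key r = k, φ t r with hn
  have hE : ∀ t, energy R key (φ t) = ∑ k ∈ J, n t k ^ 2 := fun t => energy_eq R key (φ t) hJ
  rw [energy_eq R key _ hJ]
  have h1 : ∀ k, ∑ r ∈ R with key r = k, ∑ t ∈ K, a t * φ t r = ∑ t ∈ K, a t * n t k := by
    intro k
    rw [Finset.sum_comm]
    exact Finset.sum_congr rfl fun t _ => (Finset.mul_sum _ _ _).symm
  simp only [h1]
  have h2 : ∑ k ∈ J, (∑ t ∈ K, a t * n t k) ^ 2 =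
      ∑ t ∈ K, ∑ t' ∈ K, a t * a t' * ∑ k ∈ J, n t k * n t' k := by
    rw [Finset.sum_congr rfl fun k _ => by rw [sq, Finset.sum_mul_sum], Finset.sum_comm]
    refine Finset.sum_congr rfl fun t _ => ?_
    rw [Finset.sum_comm]
    refine Finset.sum_congr rfl fun t' _ => ?_
    rw [Finset.mul_sum]
    refine Finset.sum_congr rfl fun k _ => ?_
    ring
  rw [h2, sq, Finset.sum_mul_sum]
  refine Finset.sum_le_sum fun t ht => Finset.sum_le_sum fun t' ht' => ?_
  have h3 : ∑ k ∈ J, n t k * n t' k ≤ B t * B t' := by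
    refine le_of_sq_le_sq ?_ (mul_nonneg (hB t ht) (hB t' ht'))
    refine (Finset.sum_mul_sq_le_sq_mul_sq _ _ _).trans ?_
    rw [mul_pow, ← hE, ← hE]
    exact mul_le_mul (h t ht) (h t' ht') (by rw [hE]; positivity) (sq_nonneg _)
  calc _ ≤ a t * a t' * (B t * B t') :=
        mul_le_mul_of_nonneg_left h3 (mul_nonneg (ha t ht) (ha t' ht'))
    _ = _ := by ring

theorem dyadic_le {w l₀ j : ℕ} (h1 : 2 ^ l₀ ≤ w) (h2 : w < 2 ^ (j + 1)) :
    w ≤ ∑ l ∈ Finset.Icc l₀ j, if 2 ^ l ≤ w then 2 ^ (l + 1) else 0 := by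
  have hw : w ≠ 0 := by have := Nat.one_le_two_pow (n := l₀); omega
  have h3 : Nat.log 2 w ∈ Finset.Icc l₀ j := by
    rw [Finset.mem_Icc]
    exact ⟨Nat.le_log_of_pow_le (by norm_num) h1,
      Nat.lt_succ_iff.1 (Nat.log_lt_of_lt_pow hw h2)⟩
  refine le_trans ?_ (Finset.single_le_sum (fun _ _ => Nat.zero_le _) h3)
  rw [if_pos (Nat.pow_log_le_self 2 hw)]
  exact (Nat.lt_pow_succ_log_self (by norm_num) w).le

theorem sum_min_dyadic_le {z : ℝ} (hz : 0 < z) (N : ℕ) : ∀ x y : ℝ, 0 ≤ x → 0 ≤ y →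
    x * y ≤ z ^ 2 → ∑ l ∈ Finset.range N, min (2 ^ l * x) (y / 2 ^ l) ≤ 4 * z := by
  have key : ∀ (N : ℕ) (x y : ℝ), 0 < x → 0 ≤ y → x * y ≤ z ^ 2 →
      (x < z → ∑ l ∈ Finset.range N, min (2 ^ l * x) (y / 2 ^ l) ≤ 4 * z - x) ∧
      (z ≤ x → (∑ l ∈ Finset.range N, min (2 ^ l * x) (y / 2 ^ l)) * x ≤ 2 * z ^ 2) := by
    intro N
    induction N with
    | zero =>
      intro x y hx hy h
      refine ⟨fun h => by simp; linarith, fun h => by simp; positivity⟩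
    | succ N ih =>
      intro x y hx hy h
      obtain ⟨i1, i2⟩ := ih (2 * x) (y / 2) (by linarith) (by linarith) (by linarith)
      rw [Finset.sum_range_succ']
      have hs : ∀ l ∈ Finset.range N, min (2 ^ (l + 1) * x) (y / 2 ^ (l + 1)) =
          min (2 ^ l * (2 * x)) (y / 2 / 2 ^ l) := by
        intro l _
        rw [pow_succ, mul_assoc, div_div, mul_comm 2 (2 ^ l : ℝ)]
      rw [Finset.sum_congr rfl hs]
      set F := ∑ l ∈ Finset.range N, min (2 ^ l * (2 * x)) (y / 2 / 2 ^ l)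
      simp only [pow_zero, one_mul, div_one]
      constructor
      · intro hxz
        have hm := min_le_left x y
        rcases lt_or_ge (2 * x) z with hc | hc
        · linarith [i1 hc]
        · have := i2 hc
          have h4 : F * x ≤ z ^ 2 := by linarith
          have h5 : z ^ 2 ≤ (4 * z - 2 * x) * x := by nlinarith
          have h6 : F ≤ 4 * z - 2 * x := le_of_mul_le_mul_right (h4.trans h5) hx
          linarith
      · intro hxz
        have := i2 (by linarith)
        have hm : min x y * x ≤ z ^ 2 := by nlinarith [min_le_right x y]
        nlinarith
  intro x y hx hy h
  rcases hx.eq_or_lt with rfl | hx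
  · refine (Finset.sum_nonpos fun l _ => ?_).trans (by positivity)
    rw [mul_zero]
    exact min_le_left _ _
  · obtain ⟨h1, h2⟩ := key N x y hx hy h
    rcases lt_or_ge x z with hc | hc
    · linarith [h1 hc]
    · have h3 := h2 hc
      by_contra! hcon
      nlinarith

/-- Schur's test for the kernel `(6 / 7) ^ |i - j|`. -/
theorem schur_geometric (m : ℕ) (lam : ℕ → ℝ) :
    ∑ i ∈ Finset.range m, ∑ j ∈ Finset.range m, lam i * lam j * (6 / 7 : ℝ) ^ (Nat.dist i j) ≤
      14 * ∑ i ∈ Finset.range m, lam i ^ 2 := by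
  have hrow : ∀ i ∈ Finset.range m,
      ∑ j ∈ Finset.range m, (6 / 7 : ℝ) ^ (Nat.dist i j) ≤ 14 := by
    intro i hi
    have hg : ∀ n : ℕ, ∑ k ∈ Finset.range n, (6 / 7 : ℝ) ^ k ≤ 7 := by
      intro n
      rw [geom_sum_eq (by norm_num)]
      have : (0 : ℝ) ≤ (6 / 7) ^ n := by positivity
      rw [div_le_iff_of_neg (by norm_num)]
      linarith
    rw [← Finset.sum_filter_add_sum_filter_not _ (fun j => j ≤ i)]
    have h1 : ∑ j ∈ Finset.range m with j ≤ i, (6 / 7 : ℝ) ^ (Nat.dist i j) ≤ 7 := by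
      refine le_trans (sum_le_sum_of_injOn (t := Finset.range (i + 1))
        (g := fun k => (6 / 7 : ℝ) ^ k) (fun j => i - j) ?_ ?_ ?_ ?_) (hg (i + 1))
      · intro j _; rw [Finset.mem_range]; omega
      · intro j hj j' hj' h
        have a1 := (Finset.mem_filter.1 hj).2
        have a2 := (Finset.mem_filter.1 hj').2
        simp only at h; omega
      · intro j hj
        rw [Nat.dist_comm, Nat.dist_eq_sub_of_le (Finset.mem_filter.1 hj).2]
      · intro k _; positivity
    have h2 : ∑ j ∈ Finset.range m with ¬ j ≤ i, (6 / 7 : ℝ) ^ (Nat.dist i j) ≤ 7 := by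
      refine le_trans (sum_le_sum_of_injOn (t := Finset.range m)
        (g := fun k => (6 / 7 : ℝ) ^ k) (fun j => j - i) ?_ ?_ ?_ ?_) (hg m)
      · intro j hj
        have := Finset.mem_range.1 (Finset.mem_filter.1 hj).1
        rw [Finset.mem_range]; omega
      · intro j hj j' hj' h
        have a1 := (Finset.mem_filter.1 hj).2
        have a2 := (Finset.mem_filter.1 hj').2
        simp only at h; omega
      · intro j hj
        have := (Finset.mem_filter.1 hj).2
        rw [Nat.dist_eq_sub_of_le (by omega)]
      · intro k _; positivity
    linarith
  calc _ ≤ ∑ i ∈ Finset.range m, ∑ j ∈ Finset.range m,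
        (lam i ^ 2 * (6 / 7 : ℝ) ^ (Nat.dist i j) / 2 +
          lam j ^ 2 * (6 / 7 : ℝ) ^ (Nat.dist j i) / 2) := by
        refine Finset.sum_le_sum fun i _ => Finset.sum_le_sum fun j _ => ?_
        rw [Nat.dist_comm j i]
        have : (0 : ℝ) ≤ (6 / 7) ^ (Nat.dist i j) := by positivity
        nlinarith [sq_nonneg (lam i - lam j)]
    _ = ∑ i ∈ Finset.range m, ∑ j ∈ Finset.range m,
        lam i ^ 2 * (6 / 7 : ℝ) ^ (Nat.dist i j) := by
        simp only [Finset.sum_add_distrib]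
        rw [Finset.sum_comm (f := fun i j => lam j ^ 2 * (6 / 7 : ℝ) ^ (Nat.dist j i) / 2)]
        simp only [← Finset.sum_div]
        ring
    _ ≤ _ := by
        rw [Finset.mul_sum]
        refine Finset.sum_le_sum fun i hi => ?_
        rw [← Finset.mul_sum, mul_comm 14]
        exact mul_le_mul_of_nonneg_left (hrow i hi) (sq_nonneg _)

end SumLemmas

section Runs

/-- A finite set `V` of lattice points divided into levels, the `j`-th of which has at most `4 ^ j`
points, with a weight `c j` on the `j`-th level, and a set `D` of directions. -/
structure LevelSystem where
  V : Finset (ℤ × ℤ)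
  D : Finset (ℤ × ℤ)
  lev : ℤ × ℤ → ℕ
  c : ℕ → ℝ
  m : ℕ
  M : ℕ
  L : ℕ
  isDirs : IsDirs D
  lev_le : ∀ x ∈ V, lev x ≤ m
  card_le : ∀ j, (V.filter fun x => lev x = j).card ≤ 4 ^ j
  c_nonneg : ∀ j, 0 ≤ c j
  L_pos : 1 ≤ L

/-- A triple `(n, g, x)` encodes the pair of points `x`, `x + g n`. -/
abbrev Run := (ℤ × ℤ) × ℤ × (ℤ × ℤ)

namespace Run

/-- The second point of a run. -/
def tip (r : Run) : ℤ × ℤ := r.2.2 + r.2.1 • r.1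

/-- The run traversed backwards. -/
def mirror (r : Run) : Run := (r.1, -r.2.1, r.tip)

theorem tip_mirror (r : Run) : r.mirror.tip = r.2.2 := by
  unfold mirror tip
  simp

theorem mirror_mirror (r : Run) : r.mirror.mirror = r := by
  refine Prod.ext rfl (Prod.ext ?_ ?_)
  · simp [mirror]
  · exact r.tip_mirror

end Run

theorem dot_add (n x y : ℤ × ℤ) : dot n (x + y) = dot n x + dot n y := by
  simp only [dot, Prod.fst_add, Prod.snd_add]; ring

theorem dot_smul (n x : ℤ × ℤ) (g : ℤ) : dot n (g • x) = g * dot n x := by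
  simp only [dot, Prod.smul_fst, Prod.smul_snd, smul_eq_mul]; ring

theorem dot_rot_self (n : ℤ × ℤ) : dot (rot n) n = 0 := by
  simp only [dot, rot]; ring

theorem dot_self_pos {n : ℤ × ℤ} (hn : n ≠ 0) : 1 ≤ dot n n := by
  have : 0 < dot n n := by
    unfold dot
    by_contra! hc
    refine hn (Prod.ext ?_ ?_) <;> simp only [Prod.fst_zero, Prod.snd_zero] <;> nlinarith
  omega

theorem smul_dir_inj {n : ℤ × ℤ} (hn : n ≠ 0) {g g' : ℤ} (h : g • n = g' • n) : g = g' := by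
  have h1 := congrArg (dot n) h
  rw [dot_smul, dot_smul] at h1
  exact mul_right_cancel₀ (by have := dot_self_pos hn; omega) h1

theorem IsDirs.eq_of_smul {D : Finset (ℤ × ℤ)} (hD : IsDirs D) {n n' : ℤ × ℤ} (hn : n ∈ D)
    (hn' : n' ∈ D) {g g' : ℤ} (hg : g ≠ 0) (h : g • n = g' • n') : n = n' ∧ g = g' := by
  have h1 : g * n.1 = g' * n'.1 := congrArg Prod.fst h
  have h2 : g * n.2 = g' * n'.2 := congrArg Prod.snd h
  have : n = n' := by
    refine hD.eq_of_parallel n hn n' hn' (mul_left_cancel₀ hg ?_)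
    linear_combination n'.2 * h1 - n'.1 * h2
  subst this
  exact ⟨rfl, smul_dir_inj (hD.ne_zero n hn) h⟩

theorem IsDirs.rot {D : Finset (ℤ × ℤ)} (hD : IsDirs D) : IsDirs (D.image rot) := by
  constructor
  · intro n hn h
    obtain ⟨k, hk, rfl⟩ := Finset.mem_image.1 hn
    obtain ⟨h1, h2⟩ := Prod.mk.inj h
    exact hD.ne_zero k hk (Prod.ext h2 (by simpa using h1))
  · intro n hn n' hn' h
    obtain ⟨k, hk, rfl⟩ := Finset.mem_image.1 hn
    obtain ⟨k', hk', rfl⟩ := Finset.mem_image.1 hn'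
    simp only [_root_.rot] at h
    rw [hD.eq_of_parallel k hk k' hk' (by linarith)]

namespace LevelSystem

variable (X : LevelSystem)

/-- The points of level `j`. -/
def lset (j : ℕ) : Finset (ℤ × ℤ) := X.V.filter fun x => X.lev x = j

/-- The sum of the weights `c j ^ 2 * 4 ^ j`. -/
noncomputable def mass : ℝ := ∑ j ∈ Finset.range (X.m + 1), X.c j ^ 2 * 4 ^ j

/-- The weight of a point. -/
def wt (x : ℤ × ℤ) : ℝ := X.c (X.lev x)

/-- The nonzero integers of size at most `M`. -/
noncomputable def steps : Finset ℤ := (Finset.Icc (-(X.M : ℤ)) X.M).erase 0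

/-- The runs with both points in `V`. -/
noncomputable def runs : Finset Run := (X.D ×ˢ X.steps ×ˢ X.V).filter fun r => r.tip ∈ X.V

/-- Parallel runs of the same length whose resonance function is smaller than `L`. -/
def Near (r r' : Run) : Prop :=
  r.1 = r'.1 ∧ r.2.1 = r'.2.1 ∧ |r.2.1 * (dot r.1 r'.2.2 - dot r.1 r.2.2)| < X.L

instance : DecidableRel X.Near := fun _ _ => inferInstanceAs (Decidable (_ ∧ _ ∧ _))

/-- The quadratic form of the resonance relation. -/
noncomputable def form (w : Run → ℝ) : ℝ :=
  ∑ r ∈ X.runs, ∑ r' ∈ X.runs, if X.Near r r' then w r * w r' else 0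

/-- The position of a run at scale `L`. -/
def key (r : Run) : (ℤ × ℤ) × ℤ × ℤ := (r.1, r.2.1, r.2.1 * dot r.1 r.2.2 / X.L)

variable {X}

theorem mem_lset {j : ℕ} {x : ℤ × ℤ} : x ∈ X.lset j ↔ x ∈ X.V ∧ X.lev x = j :=
  Finset.mem_filter

theorem mem_runs {r : Run} :
    r ∈ X.runs ↔ (r.1 ∈ X.D ∧ r.2.1 ∈ X.steps ∧ r.2.2 ∈ X.V) ∧ r.tip ∈ X.V := by
  unfold runs
  rw [Finset.mem_filter, Finset.mem_product, Finset.mem_product]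

theorem mem_steps {g : ℤ} : g ∈ X.steps ↔ g ≠ 0 ∧ -(X.M : ℤ) ≤ g ∧ g ≤ X.M := by
  unfold steps
  rw [Finset.mem_erase, Finset.mem_Icc]

theorem wt_nonneg (x : ℤ × ℤ) : 0 ≤ X.wt x := X.c_nonneg _

theorem mass_nonneg : 0 ≤ X.mass := Finset.sum_nonneg fun j _ => by positivity

theorem mirror_mem {r : Run} (hr : r ∈ X.runs) : r.mirror ∈ X.runs := by
  obtain ⟨⟨h1, h2, h3⟩, h4⟩ := mem_runs.1 hr
  obtain ⟨k1, k2, k3⟩ := mem_steps.1 h2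
  refine mem_runs.2 ⟨⟨h1, mem_steps.2 ⟨?_, ?_, ?_⟩, h4⟩, ?_⟩
  · exact neg_ne_zero.2 k1
  · change -(X.M : ℤ) ≤ -r.2.1; omega
  · change -r.2.1 ≤ X.M; omega
  · rw [r.tip_mirror]; exact h3

theorem near_mirror {r r' : Run} (h : X.Near r r') : X.Near r.mirror r'.mirror := by
  obtain ⟨h1, h2, h3⟩ := h
  refine ⟨h1, congrArg Neg.neg h2, ?_⟩
  simp only [Run.mirror, Run.tip, dot_add, dot_smul]
  rw [← h1, ← h2]
  convert h3 using 1
  rw [← abs_neg]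
  congr 1
  ring

theorem near_mirror_iff {r r' : Run} : X.Near r.mirror r'.mirror ↔ X.Near r r' := by
  refine ⟨fun h => ?_, near_mirror⟩
  have := near_mirror h
  rwa [r.mirror_mirror, r'.mirror_mirror] at this

theorem form_mirror (w : Run → ℝ) : X.form (fun r => w r.mirror) = X.form w := by
  have hsum : ∀ F : Run → ℝ, ∑ r ∈ X.runs, F r.mirror = ∑ r ∈ X.runs, F r := fun F =>
    Finset.sum_bij' (fun r _ => r.mirror) (fun r _ => r.mirror) (fun r hr => mirror_mem hr)
      (fun r hr => mirror_mem hr) (fun r _ => r.mirror_mirror) (fun r _ => r.mirror_mirror)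
      (fun r _ => rfl)
  unfold form
  rw [← hsum]
  refine Finset.sum_congr rfl fun r _ => ?_
  rw [← hsum]
  refine Finset.sum_congr rfl fun r' _ => ?_
  exact if_congr near_mirror_iff (by simp only [r.mirror_mirror, r'.mirror_mirror]) rfl

theorem form_mono {w w' : Run → ℝ} (h0 : ∀ r ∈ X.runs, 0 ≤ w r)
    (h : ∀ r ∈ X.runs, w r ≤ w' r) : X.form w ≤ X.form w' := by
  refine Finset.sum_le_sum fun r hr => Finset.sum_le_sum fun r' hr' => ?_
  split_ifs
  · exact mul_le_mul (h r hr) (h r' hr') (h0 r' hr') ((h0 r hr).trans (h r hr))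
  · exact le_rfl

theorem near_of_key_eq {r r' : Run} (h : X.key r = X.key r') : X.Near r r' := by
  obtain ⟨h1, h2⟩ := Prod.mk.inj h
  obtain ⟨h2, h3⟩ := Prod.mk.inj h2
  refine ⟨h1, h2, ?_⟩
  rw [← h1, ← h2] at h3
  have hL : (0 : ℤ) < X.L := by have := X.L_pos; omega
  rw [mul_sub]
  set a := r.2.1 * dot r.1 r.2.2
  set b := r.2.1 * dot r.1 r'.2.2
  have a1 := Int.emod_add_mul_ediv a X.L
  have b1 := Int.emod_add_mul_ediv b X.L
  have a2 := Int.emod_nonneg a hL.ne'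
  have b2 := Int.emod_nonneg b hL.ne'
  have a3 := Int.emod_lt_of_pos a hL
  have b3 := Int.emod_lt_of_pos b hL
  rw [h3] at a1
  rw [abs_lt]
  constructor <;> linarith

theorem energy_le_form {w : Run → ℝ} (h0 : ∀ r ∈ X.runs, 0 ≤ w r) :
    energy X.runs X.key w ≤ X.form w := by
  refine Finset.sum_le_sum fun r hr => Finset.sum_le_sum fun r' hr' => ?_
  split_ifs with h1 h2 h2
  · exact le_rfl
  · exact absurd (near_of_key_eq h1) h2
  · exact mul_nonneg (h0 r hr) (h0 r' hr')
  · exact le_rfl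

theorem card_near_le {α : Type*} [DecidableEq α] (J : Finset (α × ℤ × ℤ)) (k : α × ℤ × ℤ)
    (K : ℕ) : (J.filter fun k' => k.1 = k'.1 ∧ k.2.1 = k'.2.1 ∧ |k'.2.2 - k.2.2| < K).card ≤
      2 * K := by
  calc _ ≤ (Finset.Ioo (k.2.2 - K) (k.2.2 + K)).card := by
        refine Finset.card_le_card_of_injOn (fun k' => k'.2.2) ?_ ?_
        · intro k' hk'
          obtain ⟨-, -, -, h⟩ := Finset.mem_filter.1 hk'
          rw [abs_lt] at h
          exact Finset.mem_Ioo.2 ⟨by linarith [h.1], by linarith [h.2]⟩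
        · intro a ha b hb h
          obtain ⟨-, h1, h2, -⟩ := Finset.mem_filter.1 ha
          obtain ⟨-, h3, h4, -⟩ := Finset.mem_filter.1 hb
          exact Prod.ext (h1.symm.trans h3) (Prod.ext (h2.symm.trans h4) h)
    _ ≤ 2 * K := by rw [Int.card_Ioo]; omega

theorem form_le_energy {w : Run → ℝ} (h0 : ∀ r ∈ X.runs, 0 ≤ w r) :
    X.form w ≤ 4 * energy X.runs X.key w := by
  have hL : (0 : ℤ) < X.L := by have := X.L_pos; omega
  have := sum_related_le_energy X.runs X.key w
    (fun k k' => k.1 = k'.1 ∧ k.2.1 = k'.2.1 ∧ |k'.2.2 - k.2.2| < (2 : ℕ))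
    (fun k k' h => ⟨h.1.symm, h.2.1.symm, by rw [abs_sub_comm]; exact h.2.2⟩) (2 * 2)
    (fun k => card_near_le _ k 2)
  refine le_trans ?_ (this.trans_eq (by norm_num))
  refine Finset.sum_le_sum fun r hr => Finset.sum_le_sum fun r' hr' => ?_
  split_ifs with h1 h2 h2
  · exact le_rfl
  · refine absurd ?_ h2
    obtain ⟨e1, e2, e3⟩ := h1
    refine ⟨e1, e2, ?_⟩
    simp only [key]
    rw [← e1, ← e2]
    rw [mul_sub] at e3
    set a := r.2.1 * dot r.1 r.2.2
    set b := r.2.1 * dot r.1 r'.2.2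
    have a1 := Int.emod_add_mul_ediv a X.L
    have b1 := Int.emod_add_mul_ediv b X.L
    have a2 := Int.emod_nonneg a hL.ne'
    have b2 := Int.emod_nonneg b hL.ne'
    have a3 := Int.emod_lt_of_pos a hL
    have b3 := Int.emod_lt_of_pos b hL
    rw [abs_lt] at e3 ⊢
    push_cast
    constructor
    · by_contra! hc
      have : b / (X.L : ℤ) - a / (X.L : ℤ) ≤ -2 := hc
      nlinarith
    · by_contra! hc
      nlinarith
  · exact mul_nonneg (h0 r hr) (h0 r' hr')
  · exact le_rfl

/-- The form is subadditive up to constants on nonnegative functions, and it does not see the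
orientation of the runs. -/
theorem form_le_sum {τ : Type*} (K : Finset τ) (φ : τ → Run → ℝ) {w : Run → ℝ}
    (hw : ∀ r ∈ X.runs, 0 ≤ w r) (hφ : ∀ t ∈ K, ∀ r, 0 ≤ φ t r)
    (h : ∀ r ∈ X.runs, w r ≤ ∑ t ∈ K, (φ t r + φ t r.mirror)) :
    X.form w ≤ 16 * K.card * ∑ t ∈ K, X.form (φ t) := by
  have h1 : energy X.runs X.key w ≤
      energy X.runs X.key (fun r => ∑ t ∈ K, φ t r + ∑ t ∈ K, φ t r.mirror) :=
    energy_mono hw fun r hr => (h r hr).trans_eq Finset.sum_add_distrib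
  have h2 : energy X.runs X.key (fun r => ∑ t ∈ K, φ t r + ∑ t ∈ K, φ t r.mirror) ≤
      2 * (energy X.runs X.key (fun r => ∑ t ∈ K, φ t r) +
        energy X.runs X.key (fun r => ∑ t ∈ K, φ t r.mirror)) := by
    have := energy_sum_le X.runs X.key (Finset.univ : Finset Bool)
      (fun b r => if b then ∑ t ∈ K, φ t r else ∑ t ∈ K, φ t r.mirror)
    simpa using this
  have h3 := energy_sum_le X.runs X.key K φ
  have h4 := energy_sum_le X.runs X.key K fun t r => φ t r.mirror
  have h5 : ∑ t ∈ K, energy X.runs X.key (φ t) ≤ ∑ t ∈ K, X.form (φ t) :=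
    Finset.sum_le_sum fun t ht => energy_le_form fun r _ => hφ t ht r
  have h6 : ∑ t ∈ K, energy X.runs X.key (fun r => φ t r.mirror) ≤ ∑ t ∈ K, X.form (φ t) :=
    Finset.sum_le_sum fun t ht =>
      (energy_le_form fun r _ => hφ t ht r.mirror).trans_eq (form_mirror (φ t))
  have h7 := form_le_energy hw
  have hK : (0 : ℝ) ≤ K.card := Nat.cast_nonneg _
  nlinarith [mul_le_mul_of_nonneg_left h5 hK, mul_le_mul_of_nonneg_left h6 hK]

theorem lev_mem_range {x : ℤ × ℤ} (hx : x ∈ X.V) : X.lev x ∈ Finset.range (X.m + 1) :=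
  Finset.mem_range.2 (Nat.lt_succ_of_le (X.lev_le x hx))

theorem sum_wt_sq_le : ∑ x ∈ X.V, X.wt x ^ 2 ≤ X.mass := by
  rw [← Finset.sum_fiberwise_of_maps_to fun x hx => lev_mem_range hx]
  refine Finset.sum_le_sum fun j _ => ?_
  have h1 : ∑ x ∈ X.V with X.lev x = j, X.wt x ^ 2 = (X.lset j).card * X.c j ^ 2 := by
    rw [← nsmul_eq_mul, ← Finset.sum_const]
    refine Finset.sum_congr rfl fun x hx => ?_
    rw [wt, (Finset.mem_filter.1 hx).2]
  rw [h1, mul_comm]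
  have : ((X.lset j).card : ℝ) ≤ 4 ^ j := by exact_mod_cast X.card_le j
  gcongr

variable (X) in
/-- The point `x` lies on an exceptionally rich line of its level, parallel or orthogonal
to `n`. -/
def Flag (n x : ℤ × ℤ) : Prop :=
  2 ^ (X.lev x + 1) ≤ cnt (X.lset (X.lev x)) n (dot n x) ∨
    2 ^ (X.lev x + 1) ≤ cnt (X.lset (X.lev x)) (rot n) (dot (rot n) x)

open Classical in
theorem card_flag_le (j : ℕ) :
    ((X.D ×ˢ X.lset j).filter fun b => X.Flag b.1 b.2).card ≤ 4 * 4 ^ j := by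
  set B := (X.D ×ˢ X.lset j).filter fun b => 2 ^ (j + 1) ≤ cnt (X.lset j) b.1 (dot b.1 b.2)
  set B' := (X.D ×ˢ X.lset j).filter fun b =>
    2 ^ (j + 1) ≤ cnt (X.lset j) (rot b.1) (dot (rot b.1) b.2)
  have hB : B.card ≤ 2 * 4 ^ j := by
    refine card_superrich_pairs_le X.isDirs (X.card_le j) B ?_ ?_ ?_
    · exact fun b hb => (Finset.mem_product.1 (Finset.mem_filter.1 hb).1).1
    · exact fun b hb => (Finset.mem_product.1 (Finset.mem_filter.1 hb).1).2
    · exact fun b hb => (Finset.mem_filter.1 hb).2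
  have hB' : B'.card ≤ 2 * 4 ^ j := by
    have hinj : Function.Injective fun b : (ℤ × ℤ) × (ℤ × ℤ) => (rot b.1, b.2) := by
      intro b b' h
      obtain ⟨h1, h2⟩ := Prod.mk.inj h
      obtain ⟨h3, h4⟩ := Prod.mk.inj h1
      exact Prod.ext (Prod.ext h4 (neg_injective h3)) h2
    rw [← Finset.card_image_of_injective B' hinj]
    refine card_superrich_pairs_le X.isDirs.rot (X.card_le j) _ ?_ ?_ ?_ <;>
      intro b hb <;> obtain ⟨b', hb', rfl⟩ := Finset.mem_image.1 hb <;>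
      obtain ⟨h1, h2⟩ := Finset.mem_filter.1 hb'
    · exact Finset.mem_image_of_mem _ (Finset.mem_product.1 h1).1
    · exact (Finset.mem_product.1 h1).2
    · exact h2
  have hsub : ((X.D ×ˢ X.lset j).filter fun b => X.Flag b.1 b.2) ⊆ B ∪ B' := by
    intro b hb
    obtain ⟨h1, h2⟩ := Finset.mem_filter.1 hb
    have h3 := (mem_lset.1 (Finset.mem_product.1 h1).2).2
    unfold Flag at h2
    rw [h3] at h2
    rw [Finset.mem_union, Finset.mem_filter, Finset.mem_filter]
    exact h2.imp (fun h => ⟨h1, h⟩) (fun h => ⟨h1, h⟩)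
  have := (Finset.card_le_card hsub).trans (Finset.card_union_le _ _)
  omega

open Classical in
theorem sum_flag_le :
    ∑ b ∈ X.D ×ˢ X.V, (if X.Flag b.1 b.2 then X.wt b.2 ^ 2 else 0) ≤ 4 * X.mass := by
  rw [← Finset.sum_fiberwise_of_maps_to (g := fun b : (ℤ × ℤ) × (ℤ × ℤ) => X.lev b.2)
    fun b hb => lev_mem_range (Finset.mem_product.1 hb).2, mass, Finset.mul_sum]
  refine Finset.sum_le_sum fun j _ => ?_
  rw [← Finset.sum_filter]
  have h1 : ∀ b ∈ ((X.D ×ˢ X.V).filter fun b => X.lev b.2 = j).filter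
      (fun b => X.Flag b.1 b.2), X.wt b.2 ^ 2 = X.c j ^ 2 := by
    intro b hb
    rw [wt, (Finset.mem_filter.1 (Finset.mem_filter.1 hb).1).2]
  rw [Finset.sum_congr rfl h1, Finset.sum_const, nsmul_eq_mul]
  have h2 : (((X.D ×ˢ X.V).filter fun b => X.lev b.2 = j).filter
      (fun b => X.Flag b.1 b.2)).card ≤ 4 * 4 ^ j := by
    refine (Finset.card_le_card ?_).trans (card_flag_le (X := X) j)
    intro b hb
    obtain ⟨h1, h2⟩ := Finset.mem_filter.1 hb
    obtain ⟨h1, h3⟩ := Finset.mem_filter.1 h1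
    obtain ⟨h4, h5⟩ := Finset.mem_product.1 h1
    exact Finset.mem_filter.2 ⟨Finset.mem_product.2 ⟨h4, mem_lset.2 ⟨h5, h3⟩⟩, h2⟩
  have h3 : ((((X.D ×ˢ X.V).filter fun b => X.lev b.2 = j).filter
      (fun b => X.Flag b.1 b.2)).card : ℝ) ≤ 4 * 4 ^ j := by exact_mod_cast h2
  calc _ ≤ 4 * 4 ^ j * X.c j ^ 2 := by gcongr
    _ = _ := by ring

theorem card_steps_le (G : Finset ℤ) {q κ : ℤ} (hq : 1 ≤ q) {L : ℕ}
    (hL : 1 ≤ L) (h : ∀ g ∈ G, |g * (κ - g * q)| < L) : G.card ≤ 3 * L := by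
  have hsub : G ⊆ Finset.Ioo (-(L : ℤ)) L ∪ G.filter fun g => κ = g * q := by
    intro g hg
    rw [Finset.mem_union]
    by_cases hk : κ = g * q
    · exact Or.inr (Finset.mem_filter.2 ⟨hg, hk⟩)
    · left
      have h1 := h g hg
      rw [abs_mul] at h1
      have h2 : 1 ≤ |κ - g * q| := Int.one_le_abs (sub_ne_zero.2 hk)
      have h3 : |g| < L := by nlinarith [abs_nonneg g]
      rw [abs_lt] at h3
      exact Finset.mem_Ioo.2 h3
  have h1 : (G.filter fun g => κ = g * q).card ≤ 1 := by
    rw [Finset.card_le_one]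
    intro a ha b hb
    have e1 := (Finset.mem_filter.1 ha).2
    have e2 := (Finset.mem_filter.1 hb).2
    exact mul_right_cancel₀ (by omega) (e1.symm.trans e2)
  have h2 : (Finset.Ioo (-(L : ℤ)) L).card ≤ 2 * L - 1 := by rw [Int.card_Ioo]; omega
  have := (Finset.card_le_card hsub).trans (Finset.card_union_le _ _)
  omega

open Classical in
variable (X) in
/-- The contribution of the runs with a flagged first point. -/
noncomputable def flagged (r : Run) : ℝ :=
  if X.Flag r.1 r.2.2 then X.wt r.2.2 * X.wt r.tip else 0

open Classical in
theorem form_flagged_le : X.form X.flagged ≤ 12 * X.L * X.mass ^ 2 := by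
  set ψ : (ℤ × ℤ) × (ℤ × ℤ) → ℝ := fun b => if X.Flag b.1 b.2 then X.wt b.2 ^ 2 else 0 with hψ
  have hψ0 : ∀ b, 0 ≤ ψ b := fun b => by simp only [hψ]; split_ifs <;> positivity
  set F : Run → Run → ℝ := fun r r' =>
    if X.Near r r' then ψ (r.1, r.2.2) * X.wt r'.tip ^ 2 else 0 with hF
  have hsw : ∑ r ∈ X.runs, ∑ r' ∈ X.runs, F r' r = ∑ r ∈ X.runs, ∑ r' ∈ X.runs, F r r' :=
    Finset.sum_comm
  have h1 : X.form X.flagged ≤ ∑ r ∈ X.runs, ∑ r' ∈ X.runs, F r r' := by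
    calc X.form X.flagged ≤ ∑ r ∈ X.runs, ∑ r' ∈ X.runs, (F r r' / 2 + F r' r / 2) := by
          refine Finset.sum_le_sum fun r _ => Finset.sum_le_sum fun r' _ => ?_
          have hsymm : X.Near r' r ↔ X.Near r r' := by
            have : ∀ a b, X.Near a b → X.Near b a := fun a b h =>
              ⟨h.1.symm, h.2.1.symm, by rw [← h.1, ← h.2.1, ← abs_neg]; convert h.2.2 using 2; ring⟩
            exact ⟨this _ _, this _ _⟩
          simp only [hF, hsymm]
          by_cases hn : X.Near r r'
          · rw [if_pos hn, if_pos hn, if_pos hn]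
            have a0 := X.wt_nonneg r.2.2
            have a1 := X.wt_nonneg r'.2.2
            have a2 := X.wt_nonneg r.tip
            have a3 := X.wt_nonneg r'.tip
            have n1 := mul_nonneg (hψ0 (r.1, r.2.2)) (sq_nonneg (X.wt r'.tip))
            have n2 := mul_nonneg (hψ0 (r'.1, r'.2.2)) (sq_nonneg (X.wt r.tip))
            by_cases f1 : X.Flag r.1 r.2.2
            · by_cases f2 : X.Flag r'.1 r'.2.2
              · simp only [flagged, hψ, f1, f2, if_true]
                nlinarith [sq_nonneg (X.wt r.2.2 * X.wt r'.tip - X.wt r'.2.2 * X.wt r.tip)]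
              · rw [show X.flagged r' = 0 from if_neg f2, mul_zero]; linarith
            · rw [show X.flagged r = 0 from if_neg f1, zero_mul]; linarith
          · simp [hn]
      _ = _ := by
          simp only [Finset.sum_add_distrib, ← Finset.sum_div]
          rw [hsw]; ring
  have h2 : ∑ r ∈ X.runs, ∑ r' ∈ X.runs, F r r' ≤
      ∑ b ∈ X.D ×ˢ X.V, ∑ y ∈ X.V, 3 * X.L * (ψ b * X.wt y ^ 2) := by
    rw [← Finset.sum_product', ← Finset.sum_product']
    simp only [hF]
    rw [← Finset.sum_filter, ← Finset.sum_fiberwise_of_maps_to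
      (t := (X.D ×ˢ X.V) ×ˢ X.V)
      (g := fun p : Run × Run => ((p.1.1, p.1.2.2), p.2.tip))]
    · refine Finset.sum_le_sum fun t ht => ?_
      set Q := ((X.runs ×ˢ X.runs).filter fun p => X.Near p.1 p.2).filter
        fun p => ((p.1.1, p.1.2.2), p.2.tip) = t with hQ
      have hc : ∀ p ∈ Q, ψ (p.1.1, p.1.2.2) * X.wt p.2.tip ^ 2 = ψ t.1 * X.wt t.2 ^ 2 := by
        intro p hp
        rw [← (Finset.mem_filter.1 hp).2]
      rw [Finset.sum_congr rfl hc, Finset.sum_const, nsmul_eq_mul]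
      refine mul_le_mul_of_nonneg_right ?_ (mul_nonneg (hψ0 _) (sq_nonneg _))
      have hmemQ : ∀ p ∈ Q, p.1 ∈ X.runs ∧ p.2 ∈ X.runs ∧ X.Near p.1 p.2 ∧ p.1.1 = t.1.1 ∧
          p.1.2.2 = t.1.2 ∧ p.2.tip = t.2 := by
        intro p hp
        obtain ⟨k1, k2⟩ := Finset.mem_filter.1 hp
        obtain ⟨k1, k3⟩ := Finset.mem_filter.1 k1
        obtain ⟨k1, k4⟩ := Finset.mem_product.1 k1
        exact ⟨k1, k4, k3, by rw [← k2], by rw [← k2], by rw [← k2]⟩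
      have hQcard : Q.card = (Q.image fun p => p.1.2.1).card := by
        refine (Finset.card_image_of_injOn ?_).symm
        intro p hp p' hp' h
        obtain ⟨-, -, ⟨a1, a2, -⟩, a3, a4, a5⟩ := hmemQ p hp
        obtain ⟨-, -, ⟨b1, b2, -⟩, b3, b4, b5⟩ := hmemQ p' hp'
        have e1 : p.1 = p'.1 := Prod.ext (a3.trans b3.symm) (Prod.ext h (a4.trans b4.symm))
        refine Prod.ext e1 (Prod.ext ?_ (Prod.ext ?_ ?_))
        · rw [← a1, ← b1, e1]
        · rw [← a2, ← b2, e1]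
        · have := a5.trans b5.symm
          unfold Run.tip at this
          rw [← a1, ← b1, ← a2, ← b2, e1] at this
          exact add_right_cancel this
      have : Q.card ≤ 3 * X.L := by
        have htD : t.1.1 ∈ X.D :=
          (Finset.mem_product.1 (Finset.mem_product.1 ht).1).1
        rw [hQcard]
        refine card_steps_le _ (q := dot t.1.1 t.1.1)
          (κ := dot t.1.1 t.2 - dot t.1.1 t.1.2) (dot_self_pos (X.isDirs.ne_zero _ htD)) X.L_pos ?_
        · intro g hg
          obtain ⟨p, hp, rfl⟩ := Finset.mem_image.1 hg
          obtain ⟨-, -, ⟨a1, a2, a6⟩, a3, a4, a5⟩ := hmemQ p hp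
          rw [← a3, ← a4, ← a5]
          unfold Run.tip
          rw [dot_add, dot_smul, ← a2, ← a1]
          convert a6 using 2
          ring
      exact_mod_cast this
    · intro p hp
      obtain ⟨k1, -⟩ := Finset.mem_filter.1 hp
      obtain ⟨k1, k4⟩ := Finset.mem_product.1 k1
      have r1 := mem_runs.1 k1
      have r2 := mem_runs.1 k4
      exact Finset.mem_product.2 ⟨Finset.mem_product.2 ⟨r1.1.1, r1.1.2.2⟩, r2.2⟩
  refine h1.trans (h2.trans ?_)
  have h3 : ∑ b ∈ X.D ×ˢ X.V, ∑ y ∈ X.V, 3 * X.L * (ψ b * X.wt y ^ 2) =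
      3 * X.L * ((∑ b ∈ X.D ×ˢ X.V, ψ b) * ∑ y ∈ X.V, X.wt y ^ 2) := by
    rw [Finset.sum_mul_sum, Finset.mul_sum]
    exact Finset.sum_congr rfl fun b _ => (Finset.mul_sum _ _ _).symm
  rw [h3]
  have h4 : (∑ b ∈ X.D ×ˢ X.V, ψ b) * ∑ y ∈ X.V, X.wt y ^ 2 ≤ 4 * X.mass * X.mass :=
    mul_le_mul sum_flag_le sum_wt_sq_le (Finset.sum_nonneg fun _ _ => sq_nonneg _)
      (by have := X.mass_nonneg; positivity)
  calc _ ≤ 3 * X.L * (4 * X.mass * X.mass) := by gcongr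
    _ = _ := by ring

end LevelSystem

end Runs

section Alone

theorem sum_le_of_tail {ι : Type*} (P : Finset ι) (N : ι → ℕ) (j : ℕ)
    (hN : ∀ b ∈ P, N b < 2 ^ (j + 1)) {x y z : ℝ} (hz : 0 < z) (hx : (P.card : ℝ) ≤ x)
    (hy : ∀ l ≤ j, ((P.filter fun b => 2 ^ l ≤ N b).card : ℝ) * 4 ^ l ≤ y) (hxy : x * y ≤ z ^ 2) :
    ∑ b ∈ P, (N b : ℝ) ≤ 8 * z := by
  have h1 : ∀ b ∈ P, (N b : ℝ) ≤
      ∑ l ∈ Finset.range (j + 1), if 2 ^ l ≤ N b then (2 : ℝ) ^ (l + 1) else 0 := by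
    intro b hb
    rcases Nat.eq_zero_or_pos (N b) with h0 | h0
    · rw [h0, Nat.cast_zero]
      exact Finset.sum_nonneg fun l _ => by split_ifs <;> positivity
    · have := dyadic_le (l₀ := 0) (by rw [pow_zero]; exact h0) (hN b hb)
      rw [← Nat.range_succ_eq_Icc_zero] at this
      exact_mod_cast this
  have h2 : ∀ l ∈ Finset.range (j + 1),
      ∑ b ∈ P, (if 2 ^ l ≤ N b then (2 : ℝ) ^ (l + 1) else 0) ≤
        2 * min (2 ^ l * x) (y / 2 ^ l) := by
    intro l hl
    rw [← Finset.sum_filter, Finset.sum_const, nsmul_eq_mul]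
    have hp : (0 : ℝ) < 2 ^ l := by positivity
    have hc : ((P.filter fun b => 2 ^ l ≤ N b).card : ℝ) ≤ x :=
      le_trans (by exact_mod_cast Finset.card_filter_le _ _) hx
    have hc' := hy l (Nat.lt_succ_iff.1 (Finset.mem_range.1 hl))
    have e4 : (4 : ℝ) ^ l = 2 ^ l * 2 ^ l := by rw [← mul_pow]; norm_num
    rw [pow_succ]
    rcases min_choice (2 ^ l * x) (y / 2 ^ l) with h | h <;> rw [h]
    · nlinarith
    · rw [e4, ← mul_assoc] at hc'
      have := (le_div_iff₀ hp).2 hc'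
      linarith
  calc ∑ b ∈ P, (N b : ℝ) ≤ _ := Finset.sum_le_sum h1
    _ = _ := Finset.sum_comm
    _ ≤ _ := Finset.sum_le_sum h2
    _ ≤ _ := by
      rw [← Finset.mul_sum]
      have hx0 : 0 ≤ x := (Nat.cast_nonneg _).trans hx
      have hy0 : 0 ≤ y := le_trans (by positivity) (hy 0 (Nat.zero_le _))
      have := sum_min_dyadic_le hz (j + 1) x y hx0 hy0 hxy
      linarith

theorem two_pow_le_mul {p q w k : ℕ} (h : p + w = q) (hk : k ≤ 4 * w) :
    (2 : ℝ) ^ p ≤ 2 ^ q * (6 / 7) ^ k := by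
  have h1 : ((6 : ℝ) / 7) ^ (4 * w) ≤ (6 / 7) ^ k :=
    pow_le_pow_of_le_one (by norm_num) (by norm_num) hk
  have h2 : (1 : ℝ) ≤ 2 ^ w * (6 / 7) ^ (4 * w) := by
    rw [pow_mul, ← mul_pow]
    exact one_le_pow₀ (by norm_num)
  calc (2 : ℝ) ^ p ≤ 2 ^ p * (2 ^ w * (6 / 7) ^ (4 * w)) :=
        le_mul_of_one_le_right (by positivity) h2
    _ = 2 ^ q * (6 / 7) ^ (4 * w) := by rw [← h, pow_add]; ring
    _ ≤ _ := by gcongr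

theorem le_geometric {i j u j' : ℕ} {E K : ℝ} (hK : 1 ≤ K) (h1 : E ≤ 2 ^ (2 * (i + j)))
    (h2 : E ≤ K * 2 ^ (i + (i + u) + 2 * j')) :
    E ≤ K * (2 ^ (i + j + (i + u) + j') * (6 / 7) ^ (u + Nat.dist j j')) := by
  have hone : ∀ p k w : ℕ, E ≤ 2 ^ p → p + w = i + j + (i + u) + j' → k ≤ 4 * w →
      E ≤ K * (2 ^ (i + j + (i + u) + j') * (6 / 7) ^ k) := by
    intro p k w hp hw hk
    refine (hp.trans (two_pow_le_mul hw hk)).trans ?_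
    exact le_mul_of_one_le_left (by positivity) hK
  rcases le_total j j' with h | h
  · rw [Nat.dist_eq_sub_of_le h]
    exact hone _ _ (u + (j' - j)) h1 (by omega) (by omega)
  · rw [Nat.dist_eq_sub_of_le_right h]
    rcases le_total u (2 * (j - j')) with hu | hu
    · refine h2.trans ?_
      gcongr
      exact two_pow_le_mul (w := j - j') (by omega) (by omega)
    · exact hone _ _ (u - (j - j')) h1 (by omega) (by omega)

theorem card_rich_rot_pairs_le {D : Finset (ℤ × ℤ)} (hD : IsDirs D) {S A : Finset (ℤ × ℤ)}
    {i j k d : ℕ} (hk : 1 ≤ k) (hkj : k ≤ j) (hdk : d ≤ k) (hij : i + d = j)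
    (hS : S.card ≤ 4 ^ j) (hA : A.card ≤ 4 ^ i) (B : Finset ((ℤ × ℤ) × (ℤ × ℤ)))
    (hB1 : ∀ b ∈ B, b.1 ∈ D) (hB2 : ∀ b ∈ B, b.2 ∈ A)
    (hB : ∀ b ∈ B, 2 ^ k ≤ cnt S (rot b.1) (dot (rot b.1) b.2)) :
    B.card * 2 ^ (2 * k + d) ≤ 1961403 * 16 ^ j := by
  have hinj : Function.Injective fun b : (ℤ × ℤ) × (ℤ × ℤ) => (rot b.1, b.2) := by
    intro b b' h
    obtain ⟨h1, h2⟩ := Prod.mk.inj h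
    obtain ⟨h3, h4⟩ := Prod.mk.inj h1
    exact Prod.ext (Prod.ext h4 (neg_injective h3)) h2
  rw [← Finset.card_image_of_injective B hinj]
  refine card_rich_pairs_le hD.rot hk hkj hdk hij hS hA 0 _ ?_ ?_ ?_ <;>
    intro b hb <;> obtain ⟨b', hb', rfl⟩ := Finset.mem_image.1 hb
  · exact Finset.mem_image_of_mem _ (hB1 b' hb')
  · exact hB2 b' hb'
  · rw [add_zero]; exact hB b' hb'

namespace LevelSystem

variable (X : LevelSystem)

/-- The line through the first point of a run. -/
def line (r : Run) : (ℤ × ℤ) × ℤ × ℤ := (r.1, r.2.1, dot r.1 r.2.2)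

/-- The first point of the run is of level `i`, the second one of level `j ≥ i`, and neither of them
is flagged. -/
def Tame (i j : ℕ) (r : Run) : Prop :=
  X.lev r.2.2 = i ∧ X.lev r.tip = j ∧ i ≤ j ∧ ¬ X.Flag r.1 r.2.2 ∧ ¬ X.Flag r.1 r.tip

/-- The first point of the run is the only point of its level on its line. -/
def Alone (r : Run) : Prop := cnt (X.lset (X.lev r.2.2)) r.1 (dot r.1 r.2.2) ≤ 1

open Classical in
/-- The tame runs of given levels whose first point is alone on its line. -/
noncomputable def aloneRuns (i j : ℕ) : Finset Run :=
  X.runs.filter fun r : Run => X.Tame i j r ∧ X.Alone r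

open Classical in
/-- Pairs of runs on the same lines. -/
noncomputable def alonePairs (i j i' j' : ℕ) : Finset (Run × Run) :=
  (X.aloneRuns i j ×ˢ X.aloneRuns i' j').filter fun p => line p.1 = line p.2

variable {X}

open Classical in
theorem mem_alonePairs {i j i' j' : ℕ} {p : Run × Run} : p ∈ X.alonePairs i j i' j' ↔
    ((p.1 ∈ X.runs ∧ X.Tame i j p.1 ∧ X.Alone p.1) ∧
      (p.2 ∈ X.runs ∧ X.Tame i' j' p.2 ∧ X.Alone p.2)) ∧ line p.1 = line p.2 := by
  unfold alonePairs aloneRuns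
  rw [Finset.mem_filter, Finset.mem_product, Finset.mem_filter, Finset.mem_filter]

theorem eq_of_cnt_le_one {S : Finset (ℤ × ℤ)} {n x y : ℤ × ℤ} {s : ℤ} (h : cnt S n s ≤ 1)
    (hx : x ∈ S) (hy : y ∈ S) (hx' : dot n x = s) (hy' : dot n y = s) : x = y := by
  classical
  unfold cnt at h
  exact Finset.card_le_one.1 h x (Finset.mem_filter.2 ⟨hx, hx'⟩) y (Finset.mem_filter.2 ⟨hy, hy'⟩)

/-- Two alone runs on the same line with first points of the same level agree. -/
theorem eq_of_alone {r r' : Run} (hr : r ∈ X.runs) (hr' : r' ∈ X.runs) (ha : X.Alone r)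
    (hl : X.lev r.2.2 = X.lev r'.2.2) (h : line r = line r') : r = r' := by
  obtain ⟨h1, h2⟩ := Prod.mk.inj h
  obtain ⟨h2, h3⟩ := Prod.mk.inj h2
  refine Prod.ext h1 (Prod.ext h2 ?_)
  refine eq_of_cnt_le_one ha (mem_lset.2 ⟨(mem_runs.1 hr).1.2.2, rfl⟩)
    (mem_lset.2 ⟨(mem_runs.1 hr').1.2.2, hl.symm⟩) rfl ?_
  rw [h3, h1]

/-- A run is determined by its two points. -/
theorem run_ext {r r' : Run} (hr : r ∈ X.runs) (hr' : r' ∈ X.runs) (h1 : r.2.2 = r'.2.2)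
    (h2 : r.tip = r'.tip) : r = r' := by
  unfold Run.tip at h2
  rw [h1] at h2
  obtain ⟨e1, e2⟩ := X.isDirs.eq_of_smul (mem_runs.1 hr).1.1 (mem_runs.1 hr').1.1
    (mem_steps.1 (mem_runs.1 hr).1.2.1).1 (add_left_cancel h2)
  exact Prod.ext e1 (Prod.ext e2 h1)

theorem card_alonePairs_swap (i j i' j' : ℕ) :
    (X.alonePairs i j i' j').card = (X.alonePairs i' j' i j).card := by
  refine Finset.card_bij' (fun p _ => p.swap) (fun p _ => p.swap) ?_ ?_ (fun _ _ => rfl)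
    (fun _ _ => rfl) <;>
  · intro p hp
    rw [mem_alonePairs] at hp ⊢
    exact ⟨⟨hp.1.2, hp.1.1⟩, hp.2.symm⟩

theorem card_alonePairs_le (i j i' j' : ℕ) :
    (X.alonePairs i j i' j').card ≤ 2 ^ (2 * (i + j)) := by
  calc _ ≤ (X.lset i ×ˢ X.lset j).card := by
        refine Finset.card_le_card_of_injOn (fun p => (p.1.2.2, p.1.tip)) ?_ ?_
        · intro p hp
          obtain ⟨⟨⟨h1, h2, -⟩, -⟩, -⟩ := mem_alonePairs.1 hp
          have := mem_runs.1 h1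
          exact Finset.mem_product.2
            ⟨mem_lset.2 ⟨this.1.2.2, h2.1⟩, mem_lset.2 ⟨this.2, h2.2.1⟩⟩
        · intro p hp q hq h
          obtain ⟨⟨⟨h1, h2, h3⟩, k1, k2, k3⟩, hl⟩ := mem_alonePairs.1 hp
          obtain ⟨⟨⟨h1', h2', h3'⟩, k1', k2', k3'⟩, hl'⟩ := mem_alonePairs.1 hq
          obtain ⟨e1, e2⟩ := Prod.mk.inj h
          have e := run_ext h1 h1' e1 e2
          refine Prod.ext e (eq_of_alone k1 k1' k3 (k2.1.trans k2'.1.symm) ?_)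
          rw [← hl, ← hl', e]
    _ ≤ 4 ^ i * 4 ^ j := by
        rw [Finset.card_product]
        exact Nat.mul_le_mul (X.card_le i) (X.card_le j)
    _ = _ := by rw [pow_mul, pow_add]; norm_num

theorem card_alonePairs_self_le (i j j' : ℕ) (hj : j ≠ j') : (X.alonePairs i j i j').card = 0 := by
  rw [Finset.card_eq_zero, Finset.eq_empty_iff_forall_notMem]
  intro p hp
  obtain ⟨⟨⟨h1, h2, h3⟩, k1, k2, k3⟩, hl⟩ := mem_alonePairs.1 hp
  have := eq_of_alone h1 k1 h3 (h2.1.trans k2.1.symm) hl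
  exact hj (h2.2.1.symm.trans (by rw [this]; exact k2.2.1))

open Classical in
theorem card_alonePairs_le_orthogonal {i j i' j' : ℕ} (hi : i < i') (hj' : i' ≤ j') :
    ((X.alonePairs i j i' j').card : ℝ) ≤ 22416 * 2 ^ (i + i' + 2 * j') := by
  set N : (ℤ × ℤ) × (ℤ × ℤ) → ℕ := fun b => cnt (X.lset j') (rot b.1) (dot (rot b.1) b.2) with hN
  set P := (X.D ×ˢ X.lset i').filter fun b =>
    (∃ x ∈ X.lset i, x ≠ b.2 ∧ dot b.1 x = dot b.1 b.2) ∧ N b < 2 ^ (j' + 1) with hP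
  have hmem : ∀ b ∈ P, (b.1 ∈ X.D ∧ b.2 ∈ X.lset i') ∧
      (∃ x ∈ X.lset i, x ≠ b.2 ∧ dot b.1 x = dot b.1 b.2) ∧ N b < 2 ^ (j' + 1) := by
    intro b hb
    rw [hP, Finset.mem_filter, Finset.mem_product] at hb
    exact hb
  have h1 : (X.alonePairs i j i' j').card ≤ ∑ b ∈ P, N b := by
    have : ∑ b ∈ P, N b =
        (P.sigma fun b => (X.lset j').filter fun z =>
          dot (rot b.1) z = dot (rot b.1) b.2).card := by
      rw [Finset.card_sigma]
      rfl
    rw [this]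
    refine Finset.card_le_card_of_injOn (fun p => ⟨(p.2.1, p.2.2.2), p.2.tip⟩) ?_ ?_
    · intro p hp
      obtain ⟨⟨⟨h1, h2, h3⟩, k1, k2, k3⟩, hl⟩ := mem_alonePairs.1 hp
      have hr := mem_runs.1 h1
      have hr' := mem_runs.1 k1
      obtain ⟨l1, l2⟩ := Prod.mk.inj hl
      obtain ⟨l2, l3⟩ := Prod.mk.inj l2
      have htip : dot (rot p.2.1) p.2.tip = dot (rot p.2.1) p.2.2.2 := by
        unfold Run.tip
        rw [dot_add, dot_smul, dot_rot_self, mul_zero, add_zero]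
      refine Finset.mem_sigma.2 ⟨Finset.mem_filter.2 ⟨Finset.mem_product.2
        ⟨hr'.1.1, mem_lset.2 ⟨hr'.1.2.2, k2.1⟩⟩,
        ⟨p.1.2.2, mem_lset.2 ⟨hr.1.2.2, h2.1⟩, ?_, ?_⟩, ?_⟩,
        Finset.mem_filter.2 ⟨mem_lset.2 ⟨hr'.2, k2.2.1⟩, htip⟩⟩
      · intro h
        have := h2.1
        rw [h, k2.1] at this
        omega
      · rw [← l1, l3, l1]
      · by_contra hc
        refine k2.2.2.2.2 (Or.inr ?_)
        rw [k2.2.1, htip]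
        exact not_lt.1 hc
    · intro p hp q hq h
      obtain ⟨⟨⟨h1, h2, h3⟩, k1, k2, k3⟩, hl⟩ := mem_alonePairs.1 hp
      obtain ⟨⟨⟨h1', h2', h3'⟩, k1', k2', k3'⟩, hl'⟩ := mem_alonePairs.1 hq
      obtain ⟨e1, e2⟩ := Sigma.mk.inj h
      have e := run_ext k1 k1' (Prod.mk.inj e1).2 (eq_of_heq e2)
      refine Prod.ext (eq_of_alone h1 h1' h3 (h2.1.trans h2'.1.symm) ?_) e
      rw [hl, hl', e]
  have h2 : (P.card : ℝ) ≤ 4 ^ (i + i') := by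
    have : P.card ≤ (X.lset i ×ˢ X.lset i').card := by
      have hch : ∀ b : (ℤ × ℤ) × (ℤ × ℤ), ∃ x, b ∈ P →
          x ∈ X.lset i ∧ x ≠ b.2 ∧ dot b.1 x = dot b.1 b.2 := by
        intro b
        by_cases hb : b ∈ P
        · obtain ⟨-, ⟨x, hx⟩, -⟩ := hmem b hb
          exact ⟨x, fun _ => hx⟩
        · exact ⟨0, fun h => absurd h hb⟩
      choose f hf using hch
      refine Finset.card_le_card_of_injOn (fun b => (f b, b.2)) ?_ ?_
      · exact fun b hb => Finset.mem_product.2 ⟨(hf b hb).1, (hmem b hb).1.2⟩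
      · intro b hb b' hb' h
        obtain ⟨e1, e2⟩ := Prod.mk.inj h
        obtain ⟨-, f2, f3⟩ := hf b hb
        obtain ⟨-, f2', f3'⟩ := hf b' hb'
        refine Prod.ext ?_ e2
        by_contra hne
        refine f2 (eq_of_dot_eq (n' := b'.1) (fun hpar => hne ?_) f3 ?_)
        · exact X.isDirs.eq_of_parallel _ (hmem b hb).1.1 _ (hmem b' hb').1.1 hpar
        · rw [e1, e2, f3']
    rw [Finset.card_product] at this
    have := this.trans (Nat.mul_le_mul (X.card_le i) (X.card_le i'))
    rw [← pow_add] at this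
    exact_mod_cast this
  have h3 : ∀ l ≤ j', ((P.filter fun b => 2 ^ l ≤ N b).card : ℝ) * 4 ^ l ≤ 1961403 * 16 ^ j' := by
    intro l hl
    rcases Nat.eq_zero_or_pos l with rfl | hl0
    · have : (4 : ℝ) ^ (i + i') ≤ 16 ^ j' := by
        calc (4 : ℝ) ^ (i + i') ≤ 4 ^ (2 * j') := pow_le_pow_right₀ (by norm_num) (by omega)
          _ = _ := by rw [pow_mul]; norm_num
      have h4 : ((P.filter fun b => 2 ^ 0 ≤ N b).card : ℝ) ≤ P.card := by
        exact_mod_cast Finset.card_filter_le _ _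
      have h5 : (0 : ℝ) < 16 ^ j' := by positivity
      linarith
    · have := card_rich_rot_pairs_le X.isDirs (i := j') (d := 0) hl0 hl (Nat.zero_le _)
        (add_zero _) (X.card_le j')
        ((X.card_le i').trans (Nat.pow_le_pow_right (by norm_num) hj'))
        (P.filter fun b => 2 ^ l ≤ N b)
        (fun b hb => (hmem b (Finset.mem_filter.1 hb).1).1.1)
        (fun b hb => (hmem b (Finset.mem_filter.1 hb).1).1.2)
        (fun b hb => (Finset.mem_filter.1 hb).2)
      rw [add_zero, pow_mul] at this
      norm_num at this
      exact_mod_cast this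
  have h4 := sum_le_of_tail P N j' (fun b hb => (hmem b hb).2.2)
    (z := 1401 * 2 ^ (i + i' + 2 * j')) (by positivity) h2 h3 (by
      rw [mul_pow, ← pow_mul]
      have : (2 : ℝ) ^ ((i + i' + 2 * j') * 2) = 4 ^ (i + i') * 16 ^ j' := by
        rw [show (4 : ℝ) = 2 ^ 2 by norm_num, show (16 : ℝ) = 2 ^ 4 by norm_num, ← pow_mul,
          ← pow_mul, ← pow_add]
        congr 1; ring
      rw [this]
      have : (0 : ℝ) < 4 ^ (i + i') * 16 ^ j' := by positivity
      nlinarith)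
  calc ((X.alonePairs i j i' j').card : ℝ) ≤ ∑ b ∈ P, (N b : ℝ) := by exact_mod_cast h1
    _ ≤ _ := h4
    _ ≤ _ := by
      have : (0 : ℝ) < 2 ^ (i + i' + 2 * j') := by positivity
      linarith

theorem card_alonePairs_le_geometric (i j i' j' : ℕ) :
    ((X.alonePairs i j i' j').card : ℝ) ≤
      22416 * (2 ^ (i + j + i' + j') * (6 / 7) ^ (Nat.dist i i' + Nat.dist j j')) := by
  wlog h : i ≤ i' generalizing i j i' j'
  · have := this i' j' i j (le_of_not_ge h)
    rw [card_alonePairs_swap, Nat.dist_comm i, Nat.dist_comm j]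
    rwa [show i + j + i' + j' = i' + j' + i + j by ring]
  have b1 : ((X.alonePairs i j i' j').card : ℝ) ≤ 2 ^ (2 * (i + j)) := by
    exact_mod_cast card_alonePairs_le (X := X) i j i' j'
  rcases h.eq_or_lt with rfl | h
  · by_cases hj : j = j'
    · subst hj
      rw [Nat.dist_self, Nat.dist_self, show i + j + i + j = 2 * (i + j) by ring]
      have : (0 : ℝ) < 2 ^ (2 * (i + j)) := by positivity
      simp only [add_zero, pow_zero]
      linarith
    · rw [card_alonePairs_self_le i j j' hj]
      simp only [Nat.cast_zero]
      positivity
  · by_cases hj' : i' ≤ j'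
    · obtain ⟨u, rfl⟩ := Nat.exists_eq_add_of_le h.le
      rw [Nat.dist_eq_sub_of_le h.le, Nat.add_sub_cancel_left]
      exact le_geometric (by norm_num) b1 (card_alonePairs_le_orthogonal h hj')
    · have : (X.alonePairs i j i' j').card = 0 := by
        rw [Finset.card_eq_zero, Finset.eq_empty_iff_forall_notMem]
        intro p hp
        exact hj' (mem_alonePairs.1 hp).1.2.2.1.2.2.1
      rw [this, Nat.cast_zero]
      positivity

open Classical in
variable (X) in
/-- The contribution of the tame runs whose first point is alone on its line. -/
noncomputable def alone (r : Run) : ℝ :=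
  if X.Tame (X.lev r.2.2) (X.lev r.tip) r ∧ X.Alone r then X.wt r.2.2 * X.wt r.tip else 0

theorem alone_nonneg (r : Run) : 0 ≤ X.alone r := by
  unfold alone
  split_ifs
  · exact mul_nonneg (wt_nonneg _) (wt_nonneg _)
  · exact le_rfl

open Classical in
theorem energy_alone_le : energy X.runs line X.alone ≤ 22416 * (14 * X.mass) ^ 2 := by
  set R := Finset.range (X.m + 1)
  set lam : ℕ → ℝ := fun j => X.c j * 2 ^ j with hlam
  have hlam2 : ∑ i ∈ R, lam i ^ 2 = X.mass := by
    refine Finset.sum_congr rfl fun i _ => ?_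
    rw [hlam, mul_pow, ← pow_mul, mul_comm i 2, pow_mul]
    norm_num
  have h1 : energy X.runs line X.alone ≤ ∑ q ∈ (R ×ˢ R) ×ˢ (R ×ˢ R),
      ((X.alonePairs q.1.1 q.1.2 q.2.1 q.2.2).card : ℝ) *
        (X.c q.1.1 * X.c q.1.2 * (X.c q.2.1 * X.c q.2.2)) := by
    unfold energy
    rw [← Finset.sum_product', ← Finset.sum_filter, ← Finset.sum_fiberwise_of_maps_to
      (t := (R ×ˢ R) ×ˢ (R ×ˢ R)) (g := fun p : Run × Run =>
        ((X.lev p.1.2.2, X.lev p.1.tip), (X.lev p.2.2.2, X.lev p.2.tip)))]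
    · refine Finset.sum_le_sum fun q _ => ?_
      set Q := ((X.runs ×ˢ X.runs).filter fun p => line p.1 = line p.2).filter fun p =>
        ((X.lev p.1.2.2, X.lev p.1.tip), (X.lev p.2.2.2, X.lev p.2.tip)) = q with hQ
      clear_value Q
      calc ∑ p ∈ Q, X.alone p.1 * X.alone p.2
          ≤ ∑ p ∈ Q with p ∈ X.alonePairs q.1.1 q.1.2 q.2.1 q.2.2,
              X.c q.1.1 * X.c q.1.2 * (X.c q.2.1 * X.c q.2.2) := by
            rw [Finset.sum_filter]
            refine Finset.sum_le_sum fun p hp => ?_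
            rw [hQ] at hp
            obtain ⟨h1, rfl⟩ := Finset.mem_filter.1 hp
            obtain ⟨h1, h2⟩ := Finset.mem_filter.1 h1
            obtain ⟨h1, h3⟩ := Finset.mem_product.1 h1
            by_cases g1 : X.Tame (X.lev p.1.2.2) (X.lev p.1.tip) p.1 ∧ X.Alone p.1
            · by_cases g2 : X.Tame (X.lev p.2.2.2) (X.lev p.2.tip) p.2 ∧ X.Alone p.2
              · rw [if_pos (mem_alonePairs.2 ⟨⟨⟨h1, g1⟩, h3, g2⟩, h2⟩), alone, alone, if_pos g1,
                  if_pos g2]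
                rfl
              · rw [show X.alone p.2 = 0 from if_neg g2, mul_zero]
                have := X.c_nonneg
                split_ifs
                · exact mul_nonneg (mul_nonneg (this _) (this _)) (mul_nonneg (this _) (this _))
                · exact le_rfl
            · rw [show X.alone p.1 = 0 from if_neg g1, zero_mul]
              have := X.c_nonneg
              split_ifs
              · exact mul_nonneg (mul_nonneg (this _) (this _)) (mul_nonneg (this _) (this _))
              · exact le_rfl
        _ ≤ _ := by
            rw [Finset.sum_const, nsmul_eq_mul]
            have := X.c_nonneg
            refine mul_le_mul_of_nonneg_right ?_
              (mul_nonneg (mul_nonneg (this _) (this _)) (mul_nonneg (this _) (this _)))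
            exact_mod_cast Finset.card_le_card fun p hp => (Finset.mem_filter.1 hp).2
    · intro p hp
      obtain ⟨h1, h3⟩ := Finset.mem_product.1 (Finset.mem_filter.1 hp).1
      have h1 := mem_runs.1 h1
      have h3 := mem_runs.1 h3
      simp only [R, Finset.mem_product]
      exact ⟨⟨lev_mem_range h1.1.2.2, lev_mem_range h1.2⟩, lev_mem_range h3.1.2.2,
        lev_mem_range h3.2⟩
  refine h1.trans ?_
  calc _ ≤ ∑ q ∈ (R ×ˢ R) ×ˢ (R ×ˢ R), 22416 *
        ((lam q.1.1 * lam q.2.1 * (6 / 7) ^ Nat.dist q.1.1 q.2.1) *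
          (lam q.1.2 * lam q.2.2 * (6 / 7) ^ Nat.dist q.1.2 q.2.2)) := by
        refine Finset.sum_le_sum fun q _ => ?_
        have := X.c_nonneg
        refine (mul_le_mul_of_nonneg_right (card_alonePairs_le_geometric q.1.1 q.1.2 q.2.1 q.2.2)
          (mul_nonneg (mul_nonneg (this _) (this _)) (mul_nonneg (this _) (this _)))).trans_eq ?_
        simp only [hlam, pow_add]
        ring
    _ = 22416 * ((∑ i ∈ R, ∑ i' ∈ R, lam i * lam i' * (6 / 7 : ℝ) ^ Nat.dist i i') *
          ∑ j ∈ R, ∑ j' ∈ R, lam j * lam j' * (6 / 7 : ℝ) ^ Nat.dist j j') := by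
        rw [← Finset.mul_sum]
        congr 1
        rw [← Finset.sum_product', Finset.sum_mul_sum, ← Finset.sum_product']
        refine Finset.sum_bij' (fun q _ => ((q.1.1, q.2.1), (q.1.2, q.2.2)))
          (fun q _ => ((q.1.1, q.2.1), (q.1.2, q.2.2))) ?_ ?_ (fun _ _ => rfl) (fun _ _ => rfl)
          (fun _ _ => rfl) <;>
        · intro q hq
          simp only [Finset.mem_product] at hq ⊢
          tauto
    _ ≤ _ := by
        have hs := schur_geometric (X.m + 1) lam
        rw [hlam2] at hs
        have h0 : 0 ≤ ∑ i ∈ R, ∑ i' ∈ R, lam i * lam i' * (6 / 7 : ℝ) ^ Nat.dist i i' := by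
          have := X.c_nonneg
          exact Finset.sum_nonneg fun i _ => Finset.sum_nonneg fun i' _ => by
            have h3 := this i; have h4 := this i'; positivity
        have := mul_le_mul hs hs h0 (h0.trans hs)
        rw [sq]
        linarith

theorem form_alone_le : X.form X.alone ≤ 8787072 * X.L * X.mass ^ 2 := by
  have h1 := sum_related_le_energy X.runs line X.alone
    (fun k k' => k.1 = k'.1 ∧ k.2.1 = k'.2.1 ∧ |k'.2.2 - k.2.2| < X.L)
    (fun k k' h => ⟨h.1.symm, h.2.1.symm, by rw [abs_sub_comm]; exact h.2.2⟩) (2 * X.L)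
    (fun k => card_near_le _ k X.L)
  have h2 : X.form X.alone ≤ (2 * X.L : ℕ) * energy X.runs line X.alone := by
    refine le_trans ?_ h1
    refine Finset.sum_le_sum fun r hr => Finset.sum_le_sum fun r' hr' => ?_
    split_ifs with h1 h2 h2
    · exact le_rfl
    · refine absurd ?_ h2
      obtain ⟨e1, e2, e3⟩ := h1
      refine ⟨e1, e2, ?_⟩
      simp only [line]
      rw [← e1]
      have hg : 1 ≤ |r.2.1| := Int.one_le_abs (mem_steps.1 (mem_runs.1 hr).1.2.1).1
      rw [abs_mul] at e3
      nlinarith [abs_nonneg (dot r.1 r'.2.2 - dot r.1 r.2.2)]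
    · exact mul_nonneg (alone_nonneg r) (alone_nonneg r')
    · exact le_rfl
  refine h2.trans ((mul_le_mul_of_nonneg_left energy_alone_le (Nat.cast_nonneg _)).trans_eq ?_)
  push_cast
  ring

end LevelSystem

end Alone

section Crowded

theorem le_mul_two_pow_sub {a C p q : ℕ} (h : a * 2 ^ p ≤ C * 2 ^ q) (hpq : p ≤ q) :
    (a : ℝ) ≤ C * 2 ^ (q - p) := by
  obtain ⟨t, rfl⟩ := Nat.exists_eq_add_of_le hpq
  rw [Nat.add_sub_cancel_left]
  have : a ≤ C * 2 ^ t := by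
    refine Nat.le_of_mul_le_mul_right (h.trans_eq ?_) (Nat.two_pow_pos p)
    rw [pow_add]; ring
  exact_mod_cast this

theorem sixteen_pow (j : ℕ) : 16 ^ j = 2 ^ (4 * j) := by rw [pow_mul]; norm_num

theorem sum_inv_sq_le (G : Finset ℤ) (hG : ∀ g ∈ G, g ≠ 0) :
    ∑ g ∈ G, 1 / (g : ℝ) ^ 2 ≤ 4 := by
  set n := G.sup Int.natAbs + 1
  have hmem : ∀ g ∈ G, g.natAbs ∈ Finset.Ioo 0 n := fun g hg =>
    Finset.mem_Ioo.2 ⟨Int.natAbs_pos.2 (hG g hg), Nat.lt_succ_of_le (Finset.le_sup hg)⟩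
  rw [← Finset.sum_fiberwise_of_maps_to hmem]
  have h1 : ∀ k ∈ Finset.Ioo 0 n,
      ∑ g ∈ G with g.natAbs = k, 1 / (g : ℝ) ^ 2 ≤ 2 * ((k : ℝ) ^ 2)⁻¹ := by
    intro k _
    have hc : ∀ g ∈ G.filter fun g => g.natAbs = k, 1 / (g : ℝ) ^ 2 = ((k : ℝ) ^ 2)⁻¹ := by
      intro g hg
      rw [← (Finset.mem_filter.1 hg).2, one_div, Nat.cast_natAbs, Int.cast_abs, sq_abs]
    rw [Finset.sum_congr rfl hc, Finset.sum_const, nsmul_eq_mul]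
    refine mul_le_mul_of_nonneg_right ?_ (by positivity)
    have : (G.filter fun g => g.natAbs = k) ⊆ {(k : ℤ), -(k : ℤ)} := by
      intro g hg
      have := (Finset.mem_filter.1 hg).2
      rw [Finset.mem_insert, Finset.mem_singleton]
      omega
    exact_mod_cast (Finset.card_le_card this).trans Finset.card_le_two
  refine (Finset.sum_le_sum h1).trans ?_
  rw [← Finset.mul_sum]
  have := sum_Ioo_inv_sq_le (α := ℝ) 0 n
  norm_num at this
  linarith

theorem card_multiples_le (S : Finset ℤ) {g : ℤ} (hg : g ≠ 0) {L : ℕ}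
    (hS : ∀ s ∈ S, s ≠ 0 ∧ |g * s| < L) : (S.card : ℝ) ≤ 2 * L / |(g : ℝ)| := by
  have hg0 : 0 < |g| := abs_pos.2 hg
  set K := (L : ℤ) / |g|
  have hK0 : 0 ≤ K := Int.ediv_nonneg (Int.natCast_nonneg _) hg0.le
  have h1 : S ⊆ (Finset.Icc (-K) K).erase 0 := by
    intro s hs
    obtain ⟨h1, h2⟩ := hS s hs
    rw [abs_mul] at h2
    have : |s| ≤ K := (Int.le_ediv_iff_mul_le hg0).2 (by linarith)
    rw [Finset.mem_erase, Finset.mem_Icc]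
    exact ⟨h1, abs_le.1 this⟩
  have h2 : (S.card : ℤ) ≤ 2 * K := by
    have := Finset.card_le_card h1
    rw [Finset.card_erase_of_mem (Finset.mem_Icc.2 ⟨by omega, hK0⟩), Int.card_Icc] at this
    omega
  have h3 : K * |g| ≤ L := Int.ediv_mul_le _ hg0.ne'
  have h4 : (S.card : ℤ) * |g| ≤ 2 * L := by nlinarith
  rw [le_div_iff₀ (by exact_mod_cast hg0)]
  exact_mod_cast h4

namespace LevelSystem

variable (X : LevelSystem)

open Classical in
/-- The tame runs of given levels whose first point is not alone on its line. -/
noncomputable def crowdedRuns (i j : ℕ) : Finset Run :=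
  X.runs.filter fun r : Run => X.Tame i j r ∧ ¬ X.Alone r

/-- Pairs of nearby crowded runs. -/
noncomputable def crowdedPairs (i j : ℕ) : Finset (Run × Run) :=
  (X.crowdedRuns i j ×ˢ X.crowdedRuns i j).filter fun p => X.Near p.1 p.2

variable {X}

open Classical in
theorem mem_crowdedRuns {i j : ℕ} {r : Run} :
    r ∈ X.crowdedRuns i j ↔ r ∈ X.runs ∧ X.Tame i j r ∧ ¬ X.Alone r := by
  unfold crowdedRuns
  rw [Finset.mem_filter]

theorem mem_crowdedPairs {i j : ℕ} {p : Run × Run} : p ∈ X.crowdedPairs i j ↔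
    (p.1 ∈ X.crowdedRuns i j ∧ p.2 ∈ X.crowdedRuns i j) ∧ X.Near p.1 p.2 := by
  unfold crowdedPairs
  rw [Finset.mem_filter, Finset.mem_product]

theorem two_le_cnt_of_crowded {i j : ℕ} {r : Run} (h : r ∈ X.crowdedRuns i j) :
    2 ≤ cnt (X.lset i) r.1 (dot r.1 r.2.2) ∧ cnt (X.lset i) r.1 (dot r.1 r.2.2) < 2 ^ (i + 1) := by
  obtain ⟨-, ⟨h1, -, -, h2, -⟩, h3⟩ := mem_crowdedRuns.1 h
  unfold Alone at h3
  unfold Flag at h2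
  rw [h1] at h2 h3
  push Not at h2 h3
  exact ⟨h3, h2.1⟩

theorem dot_rot_tip (r : Run) : dot (rot r.1) r.tip = dot (rot r.1) r.2.2 := by
  unfold Run.tip
  rw [dot_add, dot_smul, dot_rot_self, mul_zero, add_zero]

theorem sum_orthogonal_le {i j k d : ℕ} (hk : 1 ≤ k) (hki : k ≤ i) (hij : i + d = j)
    (P : Finset ((ℤ × ℤ) × (ℤ × ℤ))) (hP1 : ∀ b ∈ P, b.1 ∈ X.D) (hP2 : ∀ b ∈ P, b.2 ∈ X.lset i)
    (hM : ∀ b ∈ P, 2 ^ k ≤ cnt (X.lset i) b.1 (dot b.1 b.2))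
    (hN : ∀ b ∈ P, cnt (X.lset j) (rot b.1) (dot (rot b.1) b.2) < 2 ^ (j + 1)) :
    ∑ b ∈ P, (cnt (X.lset j) (rot b.1) (dot (rot b.1) b.2) : ℝ) ≤
      19614030 * (2 ^ (2 * i + 2 * j - k) * (6 / 7) ^ (2 * d)) := by
  classical
  set N : (ℤ × ℤ) × (ℤ × ℤ) → ℕ := fun b => cnt (X.lset j) (rot b.1) (dot (rot b.1) b.2) with hNdef
  set T : ℝ := 2 ^ (2 * i + 2 * j - k) * (6 / 7) ^ (2 * d) with hT
  have hT0 : 0 < T := by positivity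
  set e := max d 1 with he
  have hcard : ∀ Q ⊆ P, (Q.card : ℝ) ≤ 1961403 * 2 ^ (4 * i - (2 * k + 0)) := by
    intro Q hQ
    refine le_mul_two_pow_sub (C := 1961403) ?_ (by omega)
    rw [← sixteen_pow]
    refine card_rich_pairs_le X.isDirs hk hki (Nat.zero_le _) (add_zero _) (X.card_le i)
      (X.card_le i) 0 Q (fun b hb => hP1 b (hQ hb)) (fun b hb => hP2 b (hQ hb)) fun b hb => ?_
    rw [add_zero]
    exact hM b (hQ hb)
  have hlow : ∑ b ∈ P with ¬ 2 ^ e ≤ N b, (N b : ℝ) ≤ 2 * 1961403 * T := by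
    calc ∑ b ∈ P with ¬ 2 ^ e ≤ N b, (N b : ℝ)
        ≤ ∑ b ∈ P with ¬ 2 ^ e ≤ N b, (2 : ℝ) ^ e := by
          refine Finset.sum_le_sum fun b hb => ?_
          have := (not_le.1 (Finset.mem_filter.1 hb).2).le
          exact_mod_cast this
      _ ≤ 1961403 * 2 ^ (4 * i - (2 * k + 0)) * 2 ^ (d + 1) := by
          rw [Finset.sum_const, nsmul_eq_mul]
          gcongr
          · exact hcard _ (Finset.filter_subset _ _)
          · norm_num
          · omega
      _ = 2 * 1961403 * 2 ^ (4 * i - (2 * k + 0) + d) := by rw [pow_add, pow_add]; ring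
      _ ≤ 2 * 1961403 * T := by
          gcongr
          exact two_pow_le_mul (w := k + d) (by omega) (by omega)
  have htail : ∀ l, 1 ≤ l → d ≤ l → l ≤ j → ∀ Q ⊆ P, (∀ b ∈ Q, 2 ^ l ≤ N b) →
      (Q.card : ℝ) * 4 ^ l ≤ 1961403 * 2 ^ (4 * j - d) := by
    intro l hl hdl hlj Q hQ hQN
    have h1 := card_rich_rot_pairs_le X.isDirs hl hlj hdl hij (X.card_le j) (X.card_le i) Q
      (fun b hb => hP1 b (hQ hb)) (fun b hb => hP2 b (hQ hb)) hQN
    rw [sixteen_pow] at h1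
    have h2 := le_mul_two_pow_sub (a := Q.card * 4 ^ l) (C := 1961403) (p := d) (q := 4 * j)
      (by
        refine le_of_eq_of_le ?_ h1
        rw [pow_add, pow_mul]
        norm_num [mul_assoc]) (by omega)
    exact_mod_cast h2
  have hhigh : ∑ b ∈ P with 2 ^ e ≤ N b, (N b : ℝ) ≤ 8 * (1961403 * T) := by
    refine sum_le_of_tail (P.filter fun b => 2 ^ e ≤ N b) N j
      (fun b hb => hN b (Finset.mem_filter.1 hb).1) (by positivity)
      (hcard _ (Finset.filter_subset _ _)) (y := 1961403 * 2 ^ (4 * j - d)) ?_ ?_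
    · intro l hl
      rcases le_total e l with hel | hel
      · exact htail l (by omega) (by omega) hl _
          ((Finset.filter_subset _ _).trans (Finset.filter_subset _ _))
          fun b hb => (Finset.mem_filter.1 hb).2
      · calc _ ≤ ((P.filter fun b => 2 ^ e ≤ N b).card : ℝ) * 4 ^ e := by
              gcongr
              · exact Finset.filter_subset _ _
              · norm_num
          _ ≤ _ := htail e (by omega) (by omega) (by omega) _ (Finset.filter_subset _ _)
              fun b hb => (Finset.mem_filter.1 hb).2
    · calc _ = 1961403 ^ 2 * (2 : ℝ) ^ (4 * i - (2 * k + 0) + (4 * j - d)) := by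
            rw [pow_add]; ring
        _ ≤ 1961403 ^ 2 * (2 ^ (4 * i + 4 * j - 2 * k) * (6 / 7) ^ (4 * d)) := by
            gcongr
            exact two_pow_le_mul (w := d) (by omega) le_rfl
        _ = _ := by
            rw [hT, mul_pow, mul_pow, ← pow_mul, ← pow_mul]
            congr 3 <;> omega
  rw [← Finset.sum_filter_add_sum_filter_not P fun b => 2 ^ e ≤ N b]
  linarith

open Classical in
/-- Pairs of crowded runs on the same lines. -/
theorem card_crowdedPairs_same_le {i j d : ℕ} (hij : i + d = j) :
    (((X.crowdedPairs i j).filter fun p => dot p.1.1 p.2.2.2 = dot p.1.1 p.1.2.2).card : ℝ) ≤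
      39228060 * i * (2 ^ (2 * i + 2 * j) * (6 / 7) ^ (2 * d)) := by
  set M : (ℤ × ℤ) × (ℤ × ℤ) → ℕ := fun b => cnt (X.lset i) b.1 (dot b.1 b.2) with hM
  set N : (ℤ × ℤ) × (ℤ × ℤ) → ℕ := fun b => cnt (X.lset j) (rot b.1) (dot (rot b.1) b.2) with hN
  set P := (X.D ×ˢ X.lset i).filter fun b => (2 ≤ M b ∧ M b < 2 ^ (i + 1)) ∧ N b < 2 ^ (j + 1)
    with hP
  have hmem : ∀ b ∈ P, (b.1 ∈ X.D ∧ b.2 ∈ X.lset i) ∧ (2 ≤ M b ∧ M b < 2 ^ (i + 1)) ∧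
      N b < 2 ^ (j + 1) := by
    intro b hb
    rw [hP, Finset.mem_filter, Finset.mem_product] at hb
    exact hb
  have h1 : ((X.crowdedPairs i j).filter fun p => dot p.1.1 p.2.2.2 = dot p.1.1 p.1.2.2).card ≤
      ∑ b ∈ P, M b * N b := by
    have : ∑ b ∈ P, M b * N b =
        (P.sigma fun b => ((X.lset i).filter fun z => dot b.1 z = dot b.1 b.2) ×ˢ
          ((X.lset j).filter fun z => dot (rot b.1) z = dot (rot b.1) b.2)).card := by
      rw [Finset.card_sigma]
      exact Finset.sum_congr rfl fun b _ => (Finset.card_product _ _).symm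
    rw [this]
    refine Finset.card_le_card_of_injOn
      (fun p => ⟨(p.1.1, p.1.2.2), (p.2.2.2, p.1.tip)⟩) ?_ ?_
    · intro p hp
      obtain ⟨hp, hdot⟩ := Finset.mem_filter.1 hp
      obtain ⟨⟨c1, c2⟩, hn⟩ := mem_crowdedPairs.1 hp
      obtain ⟨h1, h2, h3⟩ := mem_crowdedRuns.1 c1
      obtain ⟨k1, k2, k3⟩ := mem_crowdedRuns.1 c2
      have hr := mem_runs.1 h1
      have hr' := mem_runs.1 k1
      refine Finset.mem_sigma.2 ⟨Finset.mem_filter.2 ⟨Finset.mem_product.2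
        ⟨hr.1.1, mem_lset.2 ⟨hr.1.2.2, h2.1⟩⟩, two_le_cnt_of_crowded c1, ?_⟩,
        Finset.mem_product.2 ⟨Finset.mem_filter.2 ⟨mem_lset.2 ⟨hr'.1.2.2, k2.1⟩, hdot⟩,
          Finset.mem_filter.2 ⟨mem_lset.2 ⟨hr.2, h2.2.1⟩, dot_rot_tip p.1⟩⟩⟩
      by_contra hc
      refine h2.2.2.2.2 (Or.inr ?_)
      rw [h2.2.1, dot_rot_tip]
      exact not_lt.1 hc
    · intro p hp q hq h
      obtain ⟨hp, -⟩ := Finset.mem_filter.1 hp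
      obtain ⟨hq, -⟩ := Finset.mem_filter.1 hq
      obtain ⟨⟨c1, c2⟩, hn1, hn2, -⟩ := mem_crowdedPairs.1 hp
      obtain ⟨⟨c1', c2'⟩, hn1', hn2', -⟩ := mem_crowdedPairs.1 hq
      obtain ⟨e1, e2⟩ := Sigma.mk.inj h
      obtain ⟨e3, e4⟩ := Prod.mk.inj (eq_of_heq e2)
      have e := run_ext (mem_crowdedRuns.1 c1).1 (mem_crowdedRuns.1 c1').1 (Prod.mk.inj e1).2 e4
      refine Prod.ext e (Prod.ext ?_ (Prod.ext ?_ e3))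
      · rw [← hn1, ← hn1', e]
      · rw [← hn2, ← hn2', e]
  have h2 : ∑ b ∈ P, M b * N b ≤
      ∑ k ∈ Finset.Icc 1 i, 2 ^ (k + 1) * ∑ b ∈ P with 2 ^ k ≤ M b, N b := by
    calc ∑ b ∈ P, M b * N b
        ≤ ∑ b ∈ P, ∑ k ∈ Finset.Icc 1 i, if 2 ^ k ≤ M b then 2 ^ (k + 1) * N b else 0 := by
          refine Finset.sum_le_sum fun b hb => ?_
          have h := (hmem b hb).2.1
          refine (Nat.mul_le_mul_right _ (dyadic_le (l₀ := 1) h.1 h.2)).trans_eq ?_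
          rw [Finset.sum_mul]
          exact Finset.sum_congr rfl fun k _ => by rw [ite_mul, zero_mul]
      _ = _ := by
          rw [Finset.sum_comm]
          refine Finset.sum_congr rfl fun k _ => ?_
          rw [← Finset.sum_filter, Finset.mul_sum]
  have h3 : ∀ k ∈ Finset.Icc 1 i, (2 : ℝ) ^ (k + 1) * ∑ b ∈ P with 2 ^ k ≤ M b, (N b : ℝ) ≤
      39228060 * (2 ^ (2 * i + 2 * j) * (6 / 7) ^ (2 * d)) := by
    intro k hk
    obtain ⟨hk1, hki⟩ := Finset.mem_Icc.1 hk
    have := sum_orthogonal_le hk1 hki hij (P.filter fun b => 2 ^ k ≤ M b)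
      (fun b hb => (hmem b (Finset.mem_filter.1 hb).1).1.1)
      (fun b hb => (hmem b (Finset.mem_filter.1 hb).1).1.2)
      (fun b hb => (Finset.mem_filter.1 hb).2)
      (fun b hb => (hmem b (Finset.mem_filter.1 hb).1).2.2)
    calc _ ≤ (2 : ℝ) ^ (k + 1) * (19614030 * (2 ^ (2 * i + 2 * j - k) * (6 / 7) ^ (2 * d))) :=
          mul_le_mul_of_nonneg_left this (by positivity)
      _ = 39228060 * ((2 ^ k * 2 ^ (2 * i + 2 * j - k)) * (6 / 7) ^ (2 * d)) := by
          rw [pow_succ]; ring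
      _ = _ := by rw [← pow_add, Nat.add_sub_cancel' (by omega)]
  calc _ ≤ ((∑ k ∈ Finset.Icc 1 i, 2 ^ (k + 1) * ∑ b ∈ P with 2 ^ k ≤ M b, N b : ℕ) : ℝ) := by
        exact_mod_cast h1.trans h2
    _ = ∑ k ∈ Finset.Icc 1 i, (2 : ℝ) ^ (k + 1) * ∑ b ∈ P with 2 ^ k ≤ M b, (N b : ℝ) := by
        push_cast; rfl
    _ ≤ _ := Finset.sum_le_sum h3
    _ = _ := by
        rw [Finset.sum_const, Nat.card_Icc, nsmul_eq_mul, Nat.add_sub_cancel]; ring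

end LevelSystem

end Crowded

section CrowdedForm

namespace LevelSystem

variable {X : LevelSystem}

theorem sum_shifted_le {i j : ℕ} {g s : ℤ} (R : Finset Run)
    (hR : ∀ r ∈ R, r ∈ X.crowdedRuns i j ∧ r.2.1 = g)
    (hN : ∀ r ∈ R, 2 ≤ cnt (X.lset i) r.1 (dot r.1 r.2.2 + s) ∧
      cnt (X.lset i) r.1 (dot r.1 r.2.2 + s) < 2 ^ (i + 1))
    {z : ℝ} (hz : 0 < z) (hRz : (R.card : ℝ) ≤ z ^ 2) :
    ∑ r ∈ R, (cnt (X.lset i) r.1 (dot r.1 r.2.2 + s) : ℝ) ≤ 11208 * (z * 4 ^ i) := by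
  classical
  set N : Run → ℕ := fun r => cnt (X.lset i) r.1 (dot r.1 r.2.2 + s) with hNdef
  rcases R.eq_empty_or_nonempty with rfl | ⟨r₀, hr₀⟩
  · rw [Finset.sum_empty]; positivity
  have hi : 1 ≤ i := by
    by_contra! h
    have := hN r₀ hr₀
    rw [Nat.lt_one_iff.1 h] at this
    omega
  have htail : ∀ l, 1 ≤ l → l ≤ i →
      ((R.filter fun b => 2 ^ l ≤ N b).card : ℝ) * 4 ^ l ≤ 1961403 * 16 ^ i := by
    intro l hl hli
    set Q := R.filter fun b => 2 ^ l ≤ N b with hQ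
    have hinj : Set.InjOn (fun r : Run => (r.1, r.2.2)) Q := by
      intro r hr r' hr' h
      obtain ⟨e1, e2⟩ := Prod.mk.inj h
      refine Prod.ext e1 (Prod.ext ?_ e2)
      rw [(hR r (Finset.mem_filter.1 hr).1).2, (hR r' (Finset.mem_filter.1 hr').1).2]
    have h1 := card_rich_pairs_le X.isDirs hl hli (Nat.zero_le _) (add_zero _) (X.card_le i)
      (X.card_le i) s (Q.image fun r => (r.1, r.2.2)) ?_ ?_ ?_
    · rw [Finset.card_image_of_injOn hinj, add_zero, pow_mul] at h1
      norm_num at h1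
      exact_mod_cast h1
    all_goals
      intro b hb
      obtain ⟨r, hr, rfl⟩ := Finset.mem_image.1 hb
      obtain ⟨h1, h2⟩ := Finset.mem_filter.1 hr
      obtain ⟨h3, h4, -⟩ := mem_crowdedRuns.1 (hR r h1).1
    · exact (mem_runs.1 h3).1.1
    · exact mem_lset.2 ⟨(mem_runs.1 h3).1.2.2, h4.1⟩
    · exact h2
  refine (sum_le_of_tail R N i (fun r hr => (hN r hr).2) (z := 1401 * (z * 4 ^ i)) (by positivity)
    hRz (y := 1961403 * 16 ^ i) ?_ ?_).trans_eq (by ring)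
  · intro l hl
    rcases Nat.eq_zero_or_pos l with rfl | hl0
    · have h1 := htail 1 le_rfl hi
      have e : (R.filter fun b => 2 ^ 1 ≤ N b) = R :=
        Finset.filter_true_of_mem fun r hr => by rw [pow_one]; exact (hN r hr).1
      rw [e] at h1
      have : ((R.filter fun b => 2 ^ 0 ≤ N b).card : ℝ) ≤ R.card := by
        exact_mod_cast Finset.card_filter_le _ _
      have := (Nat.cast_nonneg R.card : (0 : ℝ) ≤ _)
      nlinarith [pow_zero (4 : ℝ)]
    · exact htail l hl0 hl
  · have : (4 : ℝ) ^ i * 4 ^ i = 16 ^ i := by rw [← mul_pow]; norm_num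
    have h2 : 0 ≤ z ^ 2 * (4 ^ i * 4 ^ i) := by positivity
    rw [← this]
    nlinarith

open Classical in
theorem card_crowdedPairs_shifted_le {i j d : ℕ} (hij : i + d = j) :
    (((X.crowdedPairs i j).filter fun p => ¬ dot p.1.1 p.2.2.2 = dot p.1.1 p.1.2.2).card : ℝ) ≤
      56040 * X.L * (2 ^ (2 * i + 2 * j) * (6 / 7) ^ (2 * d)) := by
  set W := (X.crowdedPairs i j).filter fun p => ¬ dot p.1.1 p.2.2.2 = dot p.1.1 p.1.2.2 with hW
  set sft : Run × Run → ℤ := fun p => dot p.1.1 p.2.2.2 - dot p.1.1 p.1.2.2 with hsft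
  set C : ℤ → Finset Run := fun g => (X.crowdedRuns i j).filter fun r => r.2.1 = g with hC
  set G := W.image fun p => p.1.2.1 with hG
  set S : ℤ → Finset ℤ := fun g => (W.filter fun p => p.1.2.1 = g).image sft with hS
  set a : ℝ := 2 ^ (i + j) with ha
  have ha0 : 0 < a := by positivity
  set z : ℤ → ℝ := fun g => (a / |(g : ℝ)| + |(g : ℝ)| * (C g).card / a) / 2 with hz
  have hmemW : ∀ p ∈ W, ((p.1 ∈ X.crowdedRuns i j ∧ p.2 ∈ X.crowdedRuns i j) ∧ X.Near p.1 p.2) ∧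
      ¬ dot p.1.1 p.2.2.2 = dot p.1.1 p.1.2.2 := by
    intro p hp
    rw [hW, Finset.mem_filter, mem_crowdedPairs] at hp
    exact hp
  have hG0 : ∀ g ∈ G, g ≠ 0 := by
    intro g hg
    obtain ⟨p, hp, rfl⟩ := Finset.mem_image.1 hg
    exact (mem_steps.1 (mem_runs.1 (mem_crowdedRuns.1 (hmemW p hp).1.1.1).1).1.2.1).1
  have habs : ∀ g ∈ G, (0 : ℝ) < |(g : ℝ)| := fun g hg =>
    abs_pos.2 (Int.cast_ne_zero.2 (hG0 g hg))
  have hfib : ∀ g ∈ G, ∀ s, ((W.filter fun p => p.1.2.1 = g ∧ sft p = s).card : ℝ) ≤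
      11208 * (z g * 4 ^ i) := by
    intro g hg s
    set R := (C g).filter fun r => 2 ≤ cnt (X.lset i) r.1 (dot r.1 r.2.2 + s) ∧
      cnt (X.lset i) r.1 (dot r.1 r.2.2 + s) < 2 ^ (i + 1) with hR
    have h1 : (W.filter fun p => p.1.2.1 = g ∧ sft p = s).card ≤
        ∑ r ∈ R, cnt (X.lset i) r.1 (dot r.1 r.2.2 + s) := by
      have : ∑ r ∈ R, cnt (X.lset i) r.1 (dot r.1 r.2.2 + s) =
          (R.sigma fun r => (X.lset i).filter fun w => dot r.1 w = dot r.1 r.2.2 + s).card := by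
        rw [Finset.card_sigma]
        rfl
      rw [this]
      refine Finset.card_le_card_of_injOn (fun p => ⟨p.1, p.2.2.2⟩) ?_ ?_
      · intro p hp
        obtain ⟨hp, hpg, hps⟩ := Finset.mem_filter.1 hp
        obtain ⟨⟨⟨c1, c2⟩, hn1, -⟩, -⟩ := hmemW p hp
        have hdot : dot p.1.1 p.2.2.2 = dot p.1.1 p.1.2.2 + s := by
          rw [← hps, hsft]; ring
        obtain ⟨k1, k2, k3⟩ := mem_crowdedRuns.1 c2
        refine Finset.mem_sigma.2 ⟨Finset.mem_filter.2 ⟨Finset.mem_filter.2 ⟨c1, hpg⟩, ?_⟩,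
          Finset.mem_filter.2 ⟨mem_lset.2 ⟨(mem_runs.1 k1).1.2.2, k2.1⟩, hdot⟩⟩
        rw [← hdot, hn1]
        exact two_le_cnt_of_crowded c2
      · intro p hp q hq h
        obtain ⟨⟨-, hn1, hn2, -⟩, -⟩ := hmemW p (Finset.mem_filter.1 hp).1
        obtain ⟨⟨-, hm1, hm2, -⟩, -⟩ := hmemW q (Finset.mem_filter.1 hq).1
        obtain ⟨e1, e2⟩ := Sigma.mk.inj h
        refine Prod.ext e1 (Prod.ext ?_ (Prod.ext ?_ (eq_of_heq e2)))
        · rw [← hn1, ← hm1, e1]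
        · rw [← hn2, ← hm2, e1]
    have hg0 := habs g hg
    have hc0 : (0 : ℝ) ≤ (C g).card := Nat.cast_nonneg _
    have h2 := sum_shifted_le (X := X) (i := i) (j := j) (g := g) (s := s) R
      (fun r hr => Finset.mem_filter.1 (Finset.mem_filter.1 hr).1)
      (fun r hr => (Finset.mem_filter.1 hr).2) (z := z g)
      (by
        have : 0 < a / |(g : ℝ)| := by positivity
        have : 0 ≤ |(g : ℝ)| * (C g).card / a := by positivity
        simp only [hz]; linarith)
      (by
        have h3 : (R.card : ℝ) ≤ (C g).card := by exact_mod_cast Finset.card_filter_le _ _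
        have h4 : a / |(g : ℝ)| * (|(g : ℝ)| * (C g).card / a) = (C g).card := by
          field_simp
        simp only [hz]
        nlinarith [sq_nonneg (a / |(g : ℝ)| - |(g : ℝ)| * (C g).card / a)])
    refine le_trans ?_ h2
    exact_mod_cast h1
  have hSg : ∀ g ∈ G, ((S g).card : ℝ) ≤ 2 * X.L / |(g : ℝ)| := by
    intro g hg
    refine card_multiples_le (S g) (hG0 g hg) fun s hs => ?_
    obtain ⟨p, hp, rfl⟩ := Finset.mem_image.1 hs
    obtain ⟨hpW, hpg⟩ := Finset.mem_filter.1 hp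
    obtain ⟨⟨-, -, -, h⟩, hne⟩ := hmemW p hpW
    rw [hpg] at h
    exact ⟨sub_ne_zero.2 hne, h⟩
  have hsumC : ∑ g ∈ G, ((C g).card : ℝ) ≤ a ^ 2 := by
    have h1 : ∑ g ∈ G, (C g).card ≤ (X.crowdedRuns i j).card := by
      rw [Finset.sum_card_fiberwise_eq_card_filter]
      exact Finset.card_filter_le _ _
    have h2 : (X.crowdedRuns i j).card ≤ (X.lset i ×ˢ X.lset j).card := by
      refine Finset.card_le_card_of_injOn (fun r => (r.2.2, r.tip)) ?_ ?_
      · intro r hr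
        obtain ⟨h1, h2, -⟩ := mem_crowdedRuns.1 hr
        have := mem_runs.1 h1
        exact Finset.mem_product.2 ⟨mem_lset.2 ⟨this.1.2.2, h2.1⟩, mem_lset.2 ⟨this.2, h2.2.1⟩⟩
      · intro r hr r' hr' h
        obtain ⟨e1, e2⟩ := Prod.mk.inj h
        exact run_ext (mem_crowdedRuns.1 hr).1 (mem_crowdedRuns.1 hr').1 e1 e2
    rw [Finset.card_product] at h2
    have h3 := h1.trans (h2.trans (Nat.mul_le_mul (X.card_le i) (X.card_le j)))
    calc _ ≤ ((4 ^ i * 4 ^ j : ℕ) : ℝ) := by exact_mod_cast h3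
      _ = a ^ 2 := by
        push_cast
        rw [ha, ← pow_add, ← pow_mul, mul_comm (i + j) 2, pow_mul]
        norm_num
  have hcard : (W.card : ℝ) ≤ ∑ g ∈ G, (S g).card * (11208 * (z g * 4 ^ i)) := by
    have h1 : W.card = ∑ g ∈ G, ∑ s ∈ S g, (W.filter fun p => p.1.2.1 = g ∧ sft p = s).card := by
      rw [Finset.card_eq_sum_card_fiberwise (f := fun p : Run × Run => p.1.2.1) (t := G)
        fun p hp => Finset.mem_image_of_mem _ hp]
      refine Finset.sum_congr rfl fun g _ => ?_
      rw [Finset.card_eq_sum_card_fiberwise (f := sft) (t := S g)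
        fun p hp => Finset.mem_image_of_mem _ hp]
      exact Finset.sum_congr rfl fun s _ => by rw [Finset.filter_filter]
    rw [h1]
    push_cast
    refine Finset.sum_le_sum fun g hg => ?_
    rw [← nsmul_eq_mul, ← Finset.sum_const]
    exact Finset.sum_le_sum fun s _ => hfib g hg s
  have hL0 : (0 : ℝ) ≤ X.L := Nat.cast_nonneg _
  calc (W.card : ℝ) ≤ _ := hcard
    _ ≤ ∑ g ∈ G, 11208 * 4 ^ i * X.L * (a * (1 / (g : ℝ) ^ 2) + (C g).card / a) := by
        refine Finset.sum_le_sum fun g hg => ?_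
        have hg0 := habs g hg
        have hz0 : 0 ≤ z g := by simp only [hz]; positivity
        calc _ ≤ 2 * X.L / |(g : ℝ)| * (11208 * (z g * 4 ^ i)) :=
              mul_le_mul_of_nonneg_right (hSg g hg) (by positivity)
          _ = _ := by
              rw [← sq_abs]
              simp only [hz]
              field_simp
    _ = 11208 * 4 ^ i * X.L * (a * ∑ g ∈ G, 1 / (g : ℝ) ^ 2 + (∑ g ∈ G, ((C g).card : ℝ)) / a) := by
        rw [← Finset.mul_sum, Finset.sum_add_distrib, ← Finset.mul_sum, Finset.sum_div]
    _ ≤ 11208 * 4 ^ i * X.L * (a * 4 + a ^ 2 / a) := by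
        gcongr
        exact sum_inv_sq_le G hG0
    _ = 56040 * X.L * 2 ^ (2 * i + (i + j)) := by
        rw [pow_add 2 (2 * i), pow_mul, ← ha, sq, mul_div_assoc, div_self ha0.ne']
        norm_num
        ring
    _ ≤ _ := by
        gcongr
        exact two_pow_le_mul (w := d) (by omega) (by omega)

theorem card_crowdedPairs_le (i j d : ℕ) (hij : i + d = j) (hm : i ≤ X.m) :
    ((X.crowdedPairs i j).card : ℝ) ≤
      39228060 * (X.m + X.L) * (2 ^ (i + j) * (6 / 7) ^ d) ^ 2 := by
  classical
  have h1 := card_crowdedPairs_same_le (X := X) hij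
  have h2 := card_crowdedPairs_shifted_le (X := X) hij
  have h3 : (2 ^ (i + j) * (6 / 7 : ℝ) ^ d) ^ 2 = 2 ^ (2 * i + 2 * j) * (6 / 7) ^ (2 * d) := by
    rw [mul_pow, ← pow_mul, ← pow_mul]
    congr 2 <;> ring
  rw [h3]
  set T : ℝ := 2 ^ (2 * i + 2 * j) * (6 / 7) ^ (2 * d)
  have hT : 0 < T := by positivity
  rw [← Finset.card_filter_add_card_filter_not fun p : Run × Run =>
    dot p.1.1 p.2.2.2 = dot p.1.1 p.1.2.2]
  push_cast
  have h4 : (i : ℝ) * T ≤ X.m * T := by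
    have : (i : ℝ) ≤ X.m := by exact_mod_cast hm
    gcongr
  have h5 : (0 : ℝ) ≤ X.L * T := by positivity
  nlinarith

open Classical in
variable (X) in
/-- The contribution of the tame runs whose first point is not alone on its line. -/
noncomputable def crowded (r : Run) : ℝ :=
  if X.Tame (X.lev r.2.2) (X.lev r.tip) r ∧ ¬ X.Alone r then X.wt r.2.2 * X.wt r.tip else 0

theorem crowded_nonneg (r : Run) : 0 ≤ X.crowded r := by
  unfold crowded
  split_ifs
  · exact mul_nonneg (wt_nonneg _) (wt_nonneg _)
  · exact le_rfl

open Classical in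
theorem energy_crowded_le :
    energy X.runs X.key X.crowded ≤ 39228060 * (X.m + X.L) * (14 * X.mass) ^ 2 := by
  set R := Finset.range (X.m + 1) with hR
  set K : ℝ := 39228060 * (X.m + X.L) with hK
  have hK0 : 0 ≤ K := by positivity
  set lam : ℕ → ℝ := fun j => X.c j * 2 ^ j with hlam
  have hlam2 : ∑ i ∈ R, lam i ^ 2 = X.mass := by
    refine Finset.sum_congr rfl fun i _ => ?_
    rw [hlam, mul_pow, ← pow_mul, mul_comm i 2, pow_mul]
    norm_num
  set φ : ℕ × ℕ → Run → ℝ := fun q r => if r ∈ X.crowdedRuns q.1 q.2 then 1 else 0 with hφ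
  set B : ℕ × ℕ → ℝ := fun q => √K * (2 ^ (q.1 + q.2) * (6 / 7) ^ Nat.dist q.1 q.2) with hB
  have hc := X.c_nonneg
  have h1 : energy X.runs X.key X.crowded ≤
      energy X.runs X.key (fun r => ∑ q ∈ R ×ˢ R, X.c q.1 * X.c q.2 * φ q r) := by
    refine energy_mono (fun r _ => crowded_nonneg r) fun r hr => ?_
    have hφ0 : ∀ q ∈ R ×ˢ R, 0 ≤ X.c q.1 * X.c q.2 * φ q r := by
      intro q _
      refine mul_nonneg (mul_nonneg (hc _) (hc _)) ?_
      simp only [hφ]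
      split_ifs <;> norm_num
    by_cases h : X.Tame (X.lev r.2.2) (X.lev r.tip) r ∧ ¬ X.Alone r
    · have hr' := mem_runs.1 hr
      refine le_trans (le_of_eq ?_) (Finset.single_le_sum hφ0 (a := (X.lev r.2.2, X.lev r.tip))
        (Finset.mem_product.2 ⟨lev_mem_range hr'.1.2.2, lev_mem_range hr'.2⟩))
      simp only [hφ]
      rw [crowded, if_pos h, if_pos (mem_crowdedRuns.2 ⟨hr, h⟩), mul_one]
      rfl
    · rw [show X.crowded r = 0 from if_neg h]
      exact Finset.sum_nonneg hφ0
  have h2 : ∀ q ∈ R ×ˢ R, energy X.runs X.key (φ q) ≤ B q ^ 2 := by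
    intro q hq
    have hcount : energy X.runs X.key (φ q) ≤ (X.crowdedPairs q.1 q.2).card := by
      unfold energy
      rw [← Finset.sum_product']
      calc _ ≤ ∑ p ∈ X.runs ×ˢ X.runs, if p ∈ X.crowdedPairs q.1 q.2 then (1 : ℝ) else 0 := by
            refine Finset.sum_le_sum fun p _ => ?_
            by_cases hk : X.key p.1 = X.key p.2
            · rw [if_pos hk]
              simp only [hφ, mem_crowdedPairs, near_of_key_eq hk, and_true]
              split_ifs <;> simp_all
            · rw [if_neg hk]
              split_ifs <;> norm_num
        _ = ∑ p ∈ (X.runs ×ˢ X.runs) with p ∈ X.crowdedPairs q.1 q.2, (1 : ℝ) := by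
            rw [Finset.sum_filter]
            exact Finset.sum_congr rfl fun p _ => by congr
        _ ≤ _ := by
            rw [Finset.sum_const, nsmul_eq_mul, mul_one]
            exact_mod_cast Finset.card_le_card fun p hp => (Finset.mem_filter.1 hp).2
    refine hcount.trans ?_
    rw [hB, mul_pow, Real.sq_sqrt hK0]
    rcases le_total q.1 q.2 with h | h
    · rw [Nat.dist_eq_sub_of_le h]
      exact card_crowdedPairs_le _ _ _ (Nat.add_sub_cancel' h)
        (Nat.lt_succ_iff.1 (Finset.mem_range.1 (Finset.mem_product.1 hq).1))
    · rcases h.eq_or_lt with h | h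
      · rw [h, Nat.dist_self]
        exact card_crowdedPairs_le _ _ _ (add_zero _)
          (Nat.lt_succ_iff.1 (Finset.mem_range.1 (Finset.mem_product.1 hq).1))
      · have : (X.crowdedPairs q.1 q.2).card = 0 := by
          rw [Finset.card_eq_zero, Finset.eq_empty_iff_forall_notMem]
          intro p hp
          exact absurd (mem_crowdedRuns.1 (mem_crowdedPairs.1 hp).1.1).2.1.2.2.1 (not_le.2 h)
        rw [this, Nat.cast_zero]
        positivity
  have h3 := energy_sum_le_sq X.runs X.key (R ×ˢ R) φ (fun q => X.c q.1 * X.c q.2) B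
    (fun q _ => mul_nonneg (hc _) (hc _)) (fun q _ => by simp only [hB]; positivity) h2
  have h4 : ∑ q ∈ R ×ˢ R, X.c q.1 * X.c q.2 * B q ≤ √K * (14 * X.mass) := by
    have hs := schur_geometric (X.m + 1) lam
    rw [hlam2] at hs
    refine le_trans (le_of_eq ?_) (mul_le_mul_of_nonneg_left hs (Real.sqrt_nonneg K))
    rw [Finset.sum_product, Finset.mul_sum]
    refine Finset.sum_congr rfl fun i _ => ?_
    rw [Finset.mul_sum]
    refine Finset.sum_congr rfl fun j _ => ?_
    simp only [hB, hlam, pow_add]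
    ring
  have h5 : 0 ≤ ∑ q ∈ R ×ˢ R, X.c q.1 * X.c q.2 * B q :=
    Finset.sum_nonneg fun q _ => mul_nonneg (mul_nonneg (hc _) (hc _)) (by
      simp only [hB]; positivity)
  calc _ ≤ _ := h1.trans h3
    _ ≤ (√K * (14 * X.mass)) ^ 2 := pow_le_pow_left₀ h5 h4 2
    _ = _ := by rw [mul_pow, Real.sq_sqrt hK0]

theorem form_crowded_le : X.form X.crowded ≤ 30754799040 * (X.m + X.L) * X.mass ^ 2 := by
  refine (form_le_energy fun r _ => crowded_nonneg r).trans ?_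
  refine (mul_le_mul_of_nonneg_left energy_crowded_le (by norm_num)).trans_eq ?_
  ring

theorem flagged_nonneg (r : Run) : 0 ≤ X.flagged r := by
  unfold flagged
  split_ifs
  · exact mul_nonneg (wt_nonneg _) (wt_nonneg _)
  · exact le_rfl

/-- The resonance form of a level system. -/
theorem form_wt_le : X.form (fun r => X.wt r.2.2 * X.wt r.tip) ≤
    2000000000000 * (X.m + X.L) * X.mass ^ 2 := by
  classical
  have h := form_le_sum (X := X) (Finset.univ : Finset (Fin 3)) ![X.flagged, X.alone, X.crowded]
    (w := fun r => X.wt r.2.2 * X.wt r.tip)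
    (fun r _ => mul_nonneg (wt_nonneg _) (wt_nonneg _)) ?_ ?_
  · have h1 := form_flagged_le (X := X)
    have h2 := form_alone_le (X := X)
    have h3 := form_crowded_le (X := X)
    rw [Fin.sum_univ_three] at h
    simp only [Finset.card_univ, Fintype.card_fin, Matrix.cons_val] at h
    have h4 : 0 ≤ X.m * X.mass ^ 2 := by positivity
    have h5 : 0 ≤ X.L * X.mass ^ 2 := by positivity
    norm_num at h
    nlinarith
  · intro t _ r
    fin_cases t
    · exact flagged_nonneg r
    · exact alone_nonneg r
    · exact crowded_nonneg r
  · intro r _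
    rw [Fin.sum_univ_three]
    simp only [Matrix.cons_val]
    have f0 := flagged_nonneg (X := X) r
    have f1 := flagged_nonneg (X := X) r.mirror
    have a0 := alone_nonneg (X := X) r
    have a1 := alone_nonneg (X := X) r.mirror
    have c0 := crowded_nonneg (X := X) r
    have c1 := crowded_nonneg (X := X) r.mirror
    have hm1 : r.mirror.2.2 = r.tip := rfl
    have hm2 : r.mirror.1 = r.1 := rfl
    have hm3 := r.tip_mirror
    by_cases hf : X.Flag r.1 r.2.2
    · have : X.flagged r = X.wt r.2.2 * X.wt r.tip := if_pos hf
      linarith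
    by_cases hg : X.Flag r.1 r.tip
    · have : X.flagged r.mirror = X.wt r.2.2 * X.wt r.tip := by
        rw [flagged, hm1, hm2, hm3, if_pos hg, mul_comm]
      linarith
    rcases le_total (X.lev r.2.2) (X.lev r.tip) with hl | hl
    · have ht : X.Tame (X.lev r.2.2) (X.lev r.tip) r := ⟨rfl, rfl, hl, hf, hg⟩
      by_cases ha : X.Alone r
      · have : X.alone r = X.wt r.2.2 * X.wt r.tip := if_pos ⟨ht, ha⟩
        linarith
      · have : X.crowded r = X.wt r.2.2 * X.wt r.tip := if_pos ⟨ht, ha⟩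
        linarith
    · have ht : X.Tame (X.lev r.mirror.2.2) (X.lev r.mirror.tip) r.mirror := by
        refine ⟨rfl, rfl, ?_, ?_, ?_⟩
        · rwa [hm1, hm3]
        · rwa [hm1, hm2]
        · rwa [hm2, hm3]
      by_cases ha : X.Alone r.mirror
      · have : X.alone r.mirror = X.wt r.2.2 * X.wt r.tip := by
          rw [alone, if_pos ⟨ht, ha⟩, hm1, hm3, mul_comm]
        linarith
      · have : X.crowded r.mirror = X.wt r.2.2 * X.wt r.tip := by
          rw [crowded, if_pos ⟨ht, ha⟩, hm1, hm3, mul_comm]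
        linarith

end LevelSystem

end CrowdedForm

section Levels

variable {α : Type*}

theorem exists_rank (V : Finset α) (f : α → ℝ) :
    ∃ r : α → ℕ, Set.InjOn r V ∧ (∀ x ∈ V, r x < V.card) ∧ (∀ k < V.card, ∃ x ∈ V, r x = k) ∧
      ∀ x ∈ V, ∀ y ∈ V, r x ≤ r y → f y ≤ f x := by
  classical
  induction V using Finset.induction_on_min_value f with
  | empty => exact ⟨fun _ => 0, by simp, by simp, by simp, by simp⟩
  | insert a s ha hmin ih =>
    obtain ⟨r, h1, h2, h3, h4⟩ := ih
    have hr : ∀ x ∈ s, Function.update r a s.card x = r x := fun x hx =>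
      Function.update_of_ne (ne_of_mem_of_not_mem hx ha) _ _
    refine ⟨Function.update r a s.card, ?_, ?_, ?_, ?_⟩
    · rw [Finset.coe_insert, Set.injOn_insert (by exact_mod_cast ha)]
      refine ⟨fun x hx y hy h => h1 hx hy (by rwa [hr x hx, hr y hy] at h), ?_⟩
      rintro ⟨x, hx, h⟩
      rw [hr x hx, Function.update_self] at h
      exact (h2 x hx).ne h
    · intro x hx
      rw [Finset.card_insert_of_notMem ha]
      rcases Finset.mem_insert.1 hx with rfl | hx
      · rw [Function.update_self]; omega
      · rw [hr x hx]; have := h2 x hx; omega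
    · intro k hk
      rw [Finset.card_insert_of_notMem ha] at hk
      rcases (Nat.lt_succ_iff.1 hk).eq_or_lt with rfl | hk
      · exact ⟨a, Finset.mem_insert_self _ _, Function.update_self ..⟩
      · obtain ⟨x, hx, rfl⟩ := h3 k hk
        exact ⟨x, Finset.mem_insert_of_mem hx, hr x hx⟩
    · intro x hx y hy h
      rcases Finset.mem_insert.1 hx with rfl | hxs
      · rcases Finset.mem_insert.1 hy with rfl | hys
        · exact le_rfl
        · rw [Function.update_self, hr y hys] at h
          exact absurd (h2 y hys) (not_lt.2 h)
      · rcases Finset.mem_insert.1 hy with rfl | hys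
        · exact hmin x hxs
        · rw [hr x hxs, hr y hys] at h
          exact h4 x hxs y hys h

theorem exists_levels (V : Finset α) (f : α → ℝ) (hf : ∀ x ∈ V, 0 ≤ f x) {m : ℕ}
    (hV : V.card ≤ 4 ^ m) :
    ∃ (lev : α → ℕ) (c : ℕ → ℝ), (∀ x ∈ V, lev x ≤ m) ∧
      (∀ j, (V.filter fun x => lev x = j).card ≤ 4 ^ j) ∧ (∀ j, 0 ≤ c j) ∧
      (∀ x ∈ V, f x ≤ c (lev x)) ∧
      ∑ j ∈ Finset.range (m + 1), c j ^ 2 * 4 ^ j ≤ 17 * ∑ x ∈ V, f x ^ 2 := by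
  classical
  obtain ⟨r, hinj, hlt, hsurj, hanti⟩ := exists_rank V f
  set lev : α → ℕ := fun x => Nat.clog 4 (r x + 1) with hlev
  have hle : ∀ x j, lev x ≤ j ↔ r x < 4 ^ j := fun x j => Nat.clog_le_iff_le_pow (by norm_num)
  have hc : ∀ j, ∃ c : ℝ, 0 ≤ c ∧ (∀ x ∈ V, lev x = j → f x ≤ c) ∧
      (c = 0 ∨ ∃ x ∈ V, lev x = j ∧ c = f x) := by
    intro j
    rcases (V.filter fun x => lev x = j).eq_empty_or_nonempty with h | h
    · refine ⟨0, le_rfl, fun x hx hj => ?_, Or.inl rfl⟩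
      exact absurd (Finset.mem_filter.2 ⟨hx, hj⟩) (h ▸ Finset.notMem_empty x)
    · obtain ⟨x, hx, hmax⟩ := Finset.exists_max_image _ f h
      obtain ⟨hxV, hxj⟩ := Finset.mem_filter.1 hx
      exact ⟨f x, hf x hxV, fun y hy hj => hmax y (Finset.mem_filter.2 ⟨hy, hj⟩),
        Or.inr ⟨x, hxV, hxj, rfl⟩⟩
  choose c hc0 hcf hceq using hc
  refine ⟨lev, c, fun x hx => (hle x m).2 ((hlt x hx).trans_le hV), fun j => ?_, hc0,
    fun x hx => hcf _ x hx rfl, ?_⟩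
  · rw [← Finset.card_range (4 ^ j)]
    refine Finset.card_le_card_of_injOn r (fun x hx => ?_)
      (hinj.mono fun x hx => (Finset.mem_filter.1 hx).1)
    exact Finset.mem_coe.2 (Finset.mem_range.2 ((hle x j).1 (Finset.mem_filter.1 hx).2.le))
  set F : ℕ → ℝ := fun j => ∑ x ∈ V with lev x = j, f x ^ 2 with hF
  have hF0 : ∀ j, 0 ≤ F j := fun j => Finset.sum_nonneg fun x _ => sq_nonneg _
  have hFsum : ∀ n, ∑ j ∈ Finset.range n, F j ≤ ∑ x ∈ V, f x ^ 2 := fun n =>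
    Finset.sum_fiberwise_le_sum_of_sum_fiber_nonneg fun j _ => hF0 j
  have h0 : c 0 ^ 2 * 4 ^ 0 ≤ F 0 := by
    rw [pow_zero, mul_one]
    rcases hceq 0 with h | ⟨x, hx, hxj, h⟩
    · rw [h]; simpa using hF0 0
    · rw [h]
      exact Finset.single_le_sum (f := fun x => f x ^ 2) (fun x _ => sq_nonneg _)
        (Finset.mem_filter.2 ⟨hx, hxj⟩)
  have hstep : ∀ k, c (k + 1) ^ 2 * 4 ^ (k + 1) ≤ 16 * F k := by
    intro k
    rcases hceq (k + 1) with h | ⟨x, hx, hxj, h⟩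
    · rw [h]
      have := hF0 k
      simpa using this
    have hxr : 4 ^ k ≤ r x := by
      by_contra! hlt'
      have := (hle x k).2 hlt'
      omega
    have hcard : 4 ^ k - 4 ^ k / 4 ≤ (V.filter fun y => lev y = k).card := by
      rw [← Nat.card_Ico]
      refine Finset.card_le_card_of_surjOn r fun i hi => ?_
      obtain ⟨h1, h2⟩ := Finset.mem_Ico.1 hi
      obtain ⟨y, hy, rfl⟩ := hsurj i (h2.trans_le (hxr.trans (hlt x hx).le))
      refine ⟨y, Finset.mem_filter.2 ⟨hy, le_antisymm ((hle y k).2 h2) ?_⟩, rfl⟩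
      by_contra! hlt'
      have h3 := (hle y (k - 1)).1 (by omega)
      rw [show k = k - 1 + 1 by omega, pow_succ, Nat.mul_div_cancel _ (by norm_num)] at h1
      omega
    have hcard' : (4 : ℝ) ^ k ≤ 4 * (V.filter fun y => lev y = k).card := by
      have : 4 ^ k ≤ 4 * (V.filter fun y => lev y = k).card := by omega
      exact_mod_cast this
    have hsum : (V.filter fun y => lev y = k).card * c (k + 1) ^ 2 ≤ F k := by
      rw [← nsmul_eq_mul]
      refine Finset.card_nsmul_le_sum _ _ _ fun y hy => ?_
      obtain ⟨hyV, hyk⟩ := Finset.mem_filter.1 hy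
      have := hanti y hyV x hx (((hle y k).1 hyk.le).le.trans hxr)
      rw [h]
      exact pow_le_pow_left₀ (hf x hx) this 2
    rw [pow_succ 4]
    nlinarith [mul_le_mul_of_nonneg_left hcard' (sq_nonneg (c (k + 1)))]
  rw [Finset.sum_range_succ']
  have h1 : ∑ k ∈ Finset.range m, c (k + 1) ^ 2 * 4 ^ (k + 1) ≤ 16 * ∑ k ∈ Finset.range m, F k := by
    rw [Finset.mul_sum]
    exact Finset.sum_le_sum fun k _ => hstep k
  have h2 := hFsum m
  have h3 := hFsum 1
  rw [Finset.sum_range_one] at h3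
  linarith

end Levels

section Resonance

/-- Primitive lattice vectors, normalised up to sign. -/
def Primitive (n : ℤ × ℤ) : Prop := IsCoprime n.1 n.2 ∧ (0 < n.1 ∨ n.1 = 0 ∧ 0 < n.2)

theorem Primitive.ne_zero {n : ℤ × ℤ} (hn : Primitive n) : n ≠ 0 := by
  rintro rfl
  rcases hn.2 with h | ⟨-, h⟩ <;> exact lt_irrefl _ h

theorem Primitive.eq_one {n : ℤ × ℤ} (hn : Primitive n) (h : n.1 = 0) : n.2 = 1 := by
  obtain ⟨h1, h2⟩ := hn
  rw [h, isCoprime_zero_left] at h1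
  rcases h2 with h2 | ⟨-, h2⟩
  · omega
  · rcases Int.isUnit_iff.1 h1 with h3 | h3 <;> omega

theorem Primitive.eq_of_parallel {n n' : ℤ × ℤ} (hn : Primitive n) (hn' : Primitive n')
    (h : n.1 * n'.2 = n.2 * n'.1) : n = n' := by
  rcases hn.2 with h1 | ⟨h1, h2⟩
  · have hd : n.1 ∣ n'.1 := hn.1.dvd_of_dvd_mul_left ⟨n'.2, h.symm⟩
    have hd' : n'.1 ∣ n.1 := hn'.1.dvd_of_dvd_mul_right ⟨n.2, by linarith⟩
    have h1' : 0 < n'.1 := by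
      rcases hn'.2 with h3 | ⟨h3, -⟩
      · exact h3
      · rw [h3, zero_dvd_iff] at hd'
        omega
    have he : n.1 = n'.1 := Int.dvd_antisymm h1.le h1'.le hd hd'
    refine Prod.ext he ?_
    rw [← he, mul_comm n.2] at h
    exact (mul_left_cancel₀ h1.ne' h).symm
  · have h3 : n'.1 = 0 := by
      rw [h1, zero_mul] at h
      exact (mul_eq_zero.1 h.symm).resolve_left h2.ne'
    exact Prod.ext (h1.trans h3.symm) ((hn.eq_one h1).trans (hn'.eq_one h3).symm)

theorem exists_eq_smul_primitive {v : ℤ × ℤ} (hv : v ≠ 0) :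
    ∃ p : (ℤ × ℤ) × ℤ, v = p.2 • p.1 ∧ Primitive p.1 := by
  have hg : 0 < Int.gcd v.1 v.2 := by
    rw [Int.gcd_pos_iff]
    by_contra! h
    exact hv (Prod.ext h.1 h.2)
  obtain ⟨a, b, hab, h1, h2⟩ := Int.exists_gcd_one hg
  have hc : IsCoprime a b := Int.isCoprime_iff_gcd_eq_one.2 hab
  have hab0 : ¬ (a = 0 ∧ b = 0) := by
    rintro ⟨rfl, rfl⟩
    simp at hab
  by_cases hs : 0 < a ∨ a = 0 ∧ 0 < b
  · refine ⟨((a, b), Int.gcd v.1 v.2), Prod.ext ?_ ?_, hc, hs⟩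
    · simp only [Prod.smul_fst, smul_eq_mul]; linarith
    · simp only [Prod.smul_snd, smul_eq_mul]; linarith
  · refine ⟨((-a, -b), -Int.gcd v.1 v.2), Prod.ext ?_ ?_, hc.neg_neg, ?_⟩
    · simp only [Prod.smul_fst, smul_eq_mul]; linarith
    · simp only [Prod.smul_snd, smul_eq_mul]; linarith
    · change 0 < -a ∨ -a = 0 ∧ 0 < -b
      omega

/-- The resonance relation between pairs of frequencies, up to an error `L` in the energies. -/
def Resonant (L : ℕ) (p p' : (ℤ × ℤ) × (ℤ × ℤ)) : Prop :=
  p.1 + p.2 = p'.1 + p'.2 ∧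
    |dot p.1 p.1 + dot p.2 p.2 - dot p'.1 p'.1 - dot p'.2 p'.2| < L

open Classical in
theorem sum_resonant_le (V : Finset (ℤ × ℤ)) (f : ℤ × ℤ → ℝ) (hf : ∀ x, 0 ≤ f x) {m L : ℕ}
    (hV : V.card ≤ 4 ^ m) (hL : 1 ≤ L) :
    ∑ p ∈ V ×ˢ V, ∑ p' ∈ V ×ˢ V,
        (if Resonant L p p' then f p.1 * f p.2 * (f p'.1 * f p'.2) else 0) ≤
      1000000000000000 * (m + L) * (∑ x ∈ V, f x ^ 2) ^ 2 := by
  obtain ⟨lev, c, hlev, hcard, hc0, hfc, hmass⟩ := exists_levels V f (fun x _ => hf x) hV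
  choose! dir hdir hprim using fun (v : ℤ × ℤ) (hv : v ≠ 0) => exists_eq_smul_primitive hv
  set D := (((V ×ˢ V).image fun q => q.2 - q.1).erase 0).image fun v => (dir v).1 with hD
  have hDp : ∀ n ∈ D, Primitive n := by
    intro n hn
    obtain ⟨v, hv, rfl⟩ := Finset.mem_image.1 hn
    exact hprim v (Finset.mem_erase.1 hv).1
  let X : LevelSystem :=
    { V := V
      D := D
      lev := lev
      c := c
      m := m
      M := (V ×ˢ V).sup fun q => (dir (q.2 - q.1)).2.natAbs
      L := L
      isDirs := ⟨fun n hn => (hDp n hn).ne_zero,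
        fun n hn n' hn' => (hDp n hn).eq_of_parallel (hDp n' hn')⟩
      lev_le := hlev
      card_le := hcard
      c_nonneg := hc0
      L_pos := hL }
  set S := ∑ x ∈ V, f x ^ 2 with hS
  have hS0 : 0 ≤ S := Finset.sum_nonneg fun x _ => sq_nonneg _
  set run : ℤ × ℤ → ℤ × ℤ → Run := fun x y => ((dir (y - x)).1, (dir (y - x)).2, x) with hrun
  have htip : ∀ x y, x ≠ y → (run x y).tip = y := by
    intro x y hxy
    change x + (dir (y - x)).2 • (dir (y - x)).1 = y
    rw [← hdir (y - x) (sub_ne_zero.2 hxy.symm), add_sub_cancel]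
  have hmem : ∀ x ∈ V, ∀ y ∈ V, x ≠ y → run x y ∈ X.runs := by
    intro x hx y hy hxy
    have hv : y - x ≠ 0 := sub_ne_zero.2 hxy.symm
    have hq : (x, y) ∈ V ×ˢ V := Finset.mem_product.2 ⟨hx, hy⟩
    refine LevelSystem.mem_runs.2 ⟨⟨?_, LevelSystem.mem_steps.2 ⟨?_, ?_⟩, hx⟩, ?_⟩
    · exact Finset.mem_image_of_mem (fun v => (dir v).1)
        (Finset.mem_erase.2 ⟨hv, Finset.mem_image_of_mem (fun q : (ℤ × ℤ) × ℤ × ℤ => q.2 - q.1) hq⟩)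
    · intro h
      refine hv ((hdir _ hv).trans ?_)
      rw [show (dir (y - x)).2 = 0 from h, zero_smul]
    · have h : (dir (y - x)).2.natAbs ≤ X.M :=
        Finset.le_sup (f := fun q : (ℤ × ℤ) × ℤ × ℤ => (dir (q.2 - q.1)).2.natAbs) hq
      change -(X.M : ℤ) ≤ (dir (y - x)).2 ∧ (dir (y - x)).2 ≤ X.M
      omega
    · rw [htip x y hxy]
      exact hy
  have hform : X.form (fun r => f r.2.2 * f r.tip) ≤ 2000000000000 * (m + L) * (17 * S) ^ 2 := by
    refine (LevelSystem.form_mono (w' := fun r => X.wt r.2.2 * X.wt r.tip)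
      (fun r _ => mul_nonneg (hf _) (hf _)) fun r hr => ?_).trans (X.form_wt_le.trans ?_)
    · obtain ⟨⟨-, -, h1⟩, h2⟩ := LevelSystem.mem_runs.1 hr
      exact mul_le_mul (hfc _ h1) (hfc _ h2) (hf _) (hc0 _)
    · have : X.mass ≤ 17 * S := hmass
      have := LevelSystem.mass_nonneg (X := X)
      change 2000000000000 * ((m : ℝ) + L) * X.mass ^ 2 ≤ _
      gcongr
  set P := ((V ×ˢ V) ×ˢ (V ×ˢ V)).filter fun q => Resonant L q.1 q.2 with hP
  set F : ((ℤ × ℤ) × ℤ × ℤ) × ((ℤ × ℤ) × ℤ × ℤ) → ℝ :=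
    fun q => f q.1.1 * f q.1.2 * (f q.2.1 * f q.2.2) with hF
  have hsplit : ∑ p ∈ V ×ˢ V, ∑ p' ∈ V ×ˢ V,
      (if Resonant L p p' then f p.1 * f p.2 * (f p'.1 * f p'.2) else 0) = ∑ q ∈ P, F q := by
    rw [← Finset.sum_product', ← Finset.sum_filter]
  have hdiag : ∑ q ∈ P with q.1.1 = q.2.1, F q ≤ S ^ 2 := by
    have : S ^ 2 = ∑ p ∈ V ×ˢ V, f p.1 ^ 2 * f p.2 ^ 2 := by
      rw [sq, hS, Finset.sum_mul_sum, Finset.sum_product]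
    rw [this]
    have heq : ∀ q ∈ P.filter fun q => q.1.1 = q.2.1, q.1 = q.2 := by
      intro q hq
      obtain ⟨hq, h⟩ := Finset.mem_filter.1 hq
      refine Prod.ext h ?_
      have := (Finset.mem_filter.1 hq).2.1
      rw [h] at this
      exact add_left_cancel this
    refine sum_le_sum_of_injOn Prod.fst (fun q hq => ?_) (fun q hq q' hq' h => ?_)
      (fun q hq => ?_) fun p _ => by positivity
    · exact (Finset.mem_product.1 (Finset.mem_filter.1 (Finset.mem_filter.1 hq).1).1).1
    · exact Prod.ext h (by rw [← heq q hq, ← heq q' hq', h])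
    · rw [hF]
      simp only
      rw [← heq q hq]
      exact le_of_eq (by ring)
  have hoff : ∑ q ∈ P with ¬ q.1.1 = q.2.1, F q ≤ X.form (fun r => f r.2.2 * f r.tip) := by
    have : X.form (fun r => f r.2.2 * f r.tip) = ∑ s ∈ (X.runs ×ˢ X.runs) with X.Near s.1 s.2,
        f s.1.2.2 * f s.1.tip * (f s.2.2.2 * f s.2.tip) := by
      rw [Finset.sum_filter, Finset.sum_product]
      rfl
    rw [this]
    have hq' : ∀ q ∈ P.filter fun q => ¬ q.1.1 = q.2.1,
        (q.1.1 ∈ V ∧ q.1.2 ∈ V ∧ q.2.1 ∈ V ∧ q.2.2 ∈ V) ∧ q.1.1 ≠ q.2.1 ∧ q.2.2 ≠ q.1.2 ∧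
          q.1.2 - q.2.2 = q.2.1 - q.1.1 ∧ |dot (q.2.1 - q.1.1) (q.2.2 - q.1.1)| < L := by
      intro q hq
      obtain ⟨hq, hne⟩ := Finset.mem_filter.1 hq
      obtain ⟨hq, hr1, hr2⟩ := Finset.mem_filter.1 hq
      obtain ⟨h1, h2⟩ := Finset.mem_product.1 hq
      obtain ⟨h1, h3⟩ := Finset.mem_product.1 h1
      obtain ⟨h2, h4⟩ := Finset.mem_product.1 h2
      have hdiff : q.1.2 - q.2.2 = q.2.1 - q.1.1 := by
        rw [sub_eq_sub_iff_add_eq_add, add_comm, hr1]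
      refine ⟨⟨h1, h3, h2, h4⟩, hne, fun h => hne ?_, hdiff, ?_⟩
      · rw [h, sub_self, eq_comm, sub_eq_zero] at hdiff
        exact hdiff.symm
      · have e1 := congrArg Prod.fst hr1
        have e2 := congrArg Prod.snd hr1
        simp only [Prod.fst_add, Prod.snd_add] at e1 e2
        have : dot q.1.1 q.1.1 + dot q.1.2 q.1.2 - dot q.2.1 q.2.1 - dot q.2.2 q.2.2 =
            2 * dot (q.2.1 - q.1.1) (q.2.2 - q.1.1) := by
          have e1' : q.1.2.1 = q.2.1.1 + q.2.2.1 - q.1.1.1 := by linarith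
          have e2' : q.1.2.2 = q.2.1.2 + q.2.2.2 - q.1.1.2 := by linarith
          simp only [dot, Prod.fst_sub, Prod.snd_sub, e1', e2']
          ring
        rw [this, abs_mul, abs_two] at hr2
        have := abs_nonneg (dot (q.2.1 - q.1.1) (q.2.2 - q.1.1))
        linarith
    refine sum_le_sum_of_injOn (fun q => (run q.1.1 q.2.1, run q.2.2 q.1.2)) (fun q hq => ?_)
      (fun q hq q' hqq h => ?_) (fun q hq => ?_) fun s _ => mul_nonneg (mul_nonneg (hf _) (hf _))
        (mul_nonneg (hf _) (hf _))
    · obtain ⟨⟨h1, h2, h3, h4⟩, k1, k2, k3, k4⟩ := hq' q hq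
      refine Finset.mem_filter.2 ⟨Finset.mem_product.2 ⟨hmem _ h1 _ h3 k1, hmem _ h4 _ h2 k2⟩,
        ?_, ?_, ?_⟩
      · simp only [hrun, k3]
      · simp only [hrun, k3]
      · change |(dir (q.2.1 - q.1.1)).2 * (dot (dir (q.2.1 - q.1.1)).1 q.2.2 -
          dot (dir (q.2.1 - q.1.1)).1 q.1.1)| < L
        rw [hdir _ (sub_ne_zero.2 k1.symm)] at k4
        convert k4 using 2
        simp only [dot, Prod.smul_fst, Prod.smul_snd, smul_eq_mul, Prod.fst_sub, Prod.snd_sub]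
        ring
    · obtain ⟨-, k1, k2, -⟩ := hq' q hq
      obtain ⟨-, l1, l2, -⟩ := hq' q' hqq
      obtain ⟨e1, e2⟩ := Prod.mk.inj h
      have t1 := congrArg Run.tip e1
      have t2 := congrArg Run.tip e2
      rw [htip _ _ k1, htip _ _ l1] at t1
      rw [htip _ _ k2, htip _ _ l2] at t2
      exact Prod.ext (Prod.ext (congrArg (fun r : Run => r.2.2) e1) t2)
        (Prod.ext t1 (congrArg (fun r : Run => r.2.2) e2))
    · obtain ⟨-, k1, k2, -⟩ := hq' q hq
      simp only [htip _ _ k1, htip _ _ k2]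
      simp only [hF, hrun]
      exact le_of_eq (by ring)
  rw [hsplit, ← Finset.sum_filter_add_sum_filter_not P fun q => q.1.1 = q.2.1]
  have h1 : S ^ 2 ≤ (m + L) * S ^ 2 := by
    have : (1 : ℝ) ≤ L := by exact_mod_cast hL
    have : (0 : ℝ) ≤ m := Nat.cast_nonneg _
    nlinarith [sq_nonneg S]
  nlinarith

end Resonance

section Fourier

/-- The period square. -/
def cell : Set (ℝ × ℝ) := Set.Icc ((0 : ℝ), (0 : ℝ)) ((2 * π), (2 * π))

theorem isCompact_cell : IsCompact cell := isCompact_Icc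

/-- The space-time character of frequency `n`. -/
noncomputable def chr (n : ℤ × ℤ × ℤ) (t : ℝ) (x : ℝ × ℝ) : ℂ :=
  Complex.exp (Complex.I * ((n.1 : ℂ) * x.1 + (n.2.1 : ℂ) * x.2 + (n.2.2 : ℂ) * t))

theorem continuous_chr (n : ℤ × ℤ × ℤ) : Continuous (Function.uncurry (chr n)) := by
  unfold chr Function.uncurry
  fun_prop

theorem chr_mul_conj (n n' : ℤ × ℤ × ℤ) (t : ℝ) (x : ℝ × ℝ) :
    chr n t x * starRingEnd ℂ (chr n' t x) = chr (n - n') t x := by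
  unfold chr
  rw [← Complex.exp_conj, ← Complex.exp_add]
  congr 1
  simp only [map_mul, map_add, Complex.conj_I, Complex.conj_ofReal, map_intCast, Prod.fst_sub,
    Prod.snd_sub, Int.cast_sub]
  ring

theorem integral_period_exp (n : ℤ) (s : ℝ) :
    ∫ t in s..(s + 2 * π), Complex.exp (Complex.I * ((n : ℂ) * t)) =
      if n = 0 then ((2 * π : ℝ) : ℂ) else 0 := by
  split_ifs with h
  · simp [h]
  · have hc : Complex.I * (n : ℂ) ≠ 0 := mul_ne_zero Complex.I_ne_zero (Int.cast_ne_zero.2 h)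
    simp only [← mul_assoc]
    rw [integral_exp_mul_complex hc, div_eq_zero_iff]
    left
    rw [sub_eq_zero, Complex.ofReal_add, mul_add, Complex.exp_add]
    have : Complex.I * (n : ℂ) * ((2 * π : ℝ) : ℂ) = n * (2 * π * Complex.I) := by
      push_cast
      ring
    rw [this, Complex.exp_int_mul_two_pi_mul_I, mul_one]

theorem setIntegral_period_exp (n : ℤ) :
    ∫ x in Set.Icc (0 : ℝ) (2 * π), Complex.exp (Complex.I * ((n : ℂ) * x)) =
      if n = 0 then ((2 * π : ℝ) : ℂ) else 0 := by
  have h := integral_period_exp n 0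
  rw [zero_add] at h
  rw [integral_Icc_eq_integral_Ioc, ← intervalIntegral.integral_of_le Real.two_pi_pos.le, h]

theorem integral_chr (n : ℤ × ℤ × ℤ) (s : ℝ) :
    ∫ t in s..(s + 2 * π), ∫ x in cell, chr n t x =
      if n = 0 then (((2 * π) ^ 3 : ℝ) : ℂ) else 0 := by
  have hx : ∀ t : ℝ, ∫ x in cell, chr n t x = Complex.exp (Complex.I * ((n.2.2 : ℂ) * t)) *
      ((if n.1 = 0 then ((2 * π : ℝ) : ℂ) else 0) *
        (if n.2.1 = 0 then ((2 * π : ℝ) : ℂ) else 0)) := by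
    intro t
    rw [← setIntegral_period_exp n.1, ← setIntegral_period_exp n.2.1,
      ← setIntegral_prod_mul (fun x : ℝ => Complex.exp (Complex.I * ((n.1 : ℂ) * x)))
        (fun x : ℝ => Complex.exp (Complex.I * ((n.2.1 : ℂ) * x))), Set.Icc_prod_Icc,
      ← integral_const_mul]
    refine integral_congr_ae (Filter.Eventually.of_forall fun x => ?_)
    simp only [chr, ← Complex.exp_add]
    congr 1
    ring
  simp only [hx]
  rw [intervalIntegral.integral_mul_const, integral_period_exp]
  by_cases h : n = 0
  · subst h
    simp only [Prod.fst_zero, Prod.snd_zero, if_true]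
    push_cast
    ring
  · rw [if_neg h]
    have : ¬ (n.1 = 0 ∧ n.2.1 = 0 ∧ n.2.2 = 0) := fun hn =>
      h (Prod.ext hn.1 (Prod.ext hn.2.1 hn.2.2))
    split_ifs <;> simp_all

variable {ι : Type*}

theorem integral_sq_norm_sum_chr_le (K : Finset ι) (φ : ι → ℤ × ℤ × ℤ) (b : ι → ℂ) (s : ℝ) :
    ∫ t in s..(s + 2 * π), ∫ x in cell, ‖∑ k ∈ K, b k * chr (φ k) t x‖ ^ 2 ≤
      (2 * π) ^ 3 * ∑ k ∈ K, ∑ k' ∈ K, if φ k = φ k' then ‖b k‖ * ‖b k'‖ else 0 := by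
  have hexp : ∀ t x, ((‖∑ k ∈ K, b k * chr (φ k) t x‖ ^ 2 : ℝ) : ℂ) =
      ∑ k ∈ K, ∑ k' ∈ K, b k * starRingEnd ℂ (b k') * chr (φ k - φ k') t x := by
    intro t x
    rw [← Complex.normSq_eq_norm_sq, ← Complex.mul_conj, map_sum, Finset.sum_mul_sum]
    refine Finset.sum_congr rfl fun k _ => Finset.sum_congr rfl fun k' _ => ?_
    rw [map_mul, ← chr_mul_conj]
    ring
  have hcont : ∀ n, Continuous fun t => ∫ x in cell, chr n t x := fun n =>
    continuous_parametric_integral_of_continuous (continuous_chr n) isCompact_cell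
  have hchr_int : ∀ n t, IntegrableOn (chr n t) cell := fun n t =>
    ((continuous_chr n).comp (Continuous.prodMk_right t)).continuousOn.integrableOn_compact
      isCompact_cell
  have hval : ((∫ t in s..(s + 2 * π), ∫ x in cell, ‖∑ k ∈ K, b k * chr (φ k) t x‖ ^ 2 : ℝ) : ℂ) =
      ∑ k ∈ K, ∑ k' ∈ K, b k * starRingEnd ℂ (b k') *
        if φ k - φ k' = 0 then (((2 * π) ^ 3 : ℝ) : ℂ) else 0 := by
    rw [← intervalIntegral.integral_ofReal]
    simp only [← integral_complex_ofReal, hexp]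
    have hx : ∀ t : ℝ, ∫ x in cell, ∑ k ∈ K, ∑ k' ∈ K,
        b k * starRingEnd ℂ (b k') * chr (φ k - φ k') t x = ∑ k ∈ K, ∑ k' ∈ K,
          b k * starRingEnd ℂ (b k') * ∫ x in cell, chr (φ k - φ k') t x := by
      intro t
      rw [integral_finsetSum _ fun k _ => integrable_finsetSum _ fun k' _ =>
        (hchr_int _ t).const_mul _]
      refine Finset.sum_congr rfl fun k _ => ?_
      rw [integral_finsetSum _ fun k' _ => (hchr_int _ t).const_mul _]
      exact Finset.sum_congr rfl fun k' _ => integral_const_mul _ _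
    simp only [hx]
    rw [intervalIntegral.integral_finsetSum fun k _ => (continuous_finsetSum _ fun k' _ =>
      (hcont _).const_mul _).intervalIntegrable _ _]
    refine Finset.sum_congr rfl fun k _ => ?_
    rw [intervalIntegral.integral_finsetSum fun k' _ =>
      ((hcont _).const_mul _).intervalIntegrable _ _]
    refine Finset.sum_congr rfl fun k' _ => ?_
    rw [intervalIntegral.integral_const_mul, integral_chr]
  refine (Real.le_norm_self _).trans ?_
  rw [← Complex.norm_real, hval, Finset.mul_sum]
  refine (norm_sum_le _ _).trans (Finset.sum_le_sum fun k _ => ?_)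
  rw [Finset.mul_sum]
  refine (norm_sum_le _ _).trans (Finset.sum_le_sum fun k' _ => ?_)
  simp only [sub_eq_zero]
  split_ifs
  · rw [norm_mul, norm_mul, RCLike.norm_conj, Complex.norm_real,
      Real.norm_of_nonneg (by positivity)]
    exact le_of_eq (by ring)
  · simp

end Fourier

section Strichartz

/-- The free Schrödinger evolution of the Fourier coefficients `a` on `V`. -/
noncomputable def wave (V : Finset (ℤ × ℤ)) (a : ℤ × ℤ → ℂ) (t : ℝ) (x : ℝ × ℝ) : ℂ :=
  ∑ ξ ∈ V, a ξ * Complex.exp (Complex.I * ((ξ.1 : ℂ) * (x.1 : ℂ) + (ξ.2 : ℂ) * (x.2 : ℂ)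
    - (t : ℂ) * ((ξ.1 : ℂ) ^ 2 + (ξ.2 : ℂ) ^ 2)))

/-- A Dirichlet kernel of length `L` centred at `s`. -/
noncomputable def kernel (L : ℕ) (s t : ℝ) : ℂ :=
  ∑ j ∈ Finset.range L, Complex.exp (Complex.I * ((j : ℂ) * ((t : ℂ) - s)))

theorem continuous_wave (V : Finset (ℤ × ℤ)) (a : ℤ × ℤ → ℂ) :
    Continuous (Function.uncurry (wave V a)) := by
  unfold wave Function.uncurry
  fun_prop

theorem continuous_kernel (L : ℕ) (s : ℝ) : Continuous (kernel L s) := by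
  unfold kernel
  fun_prop

theorem half_le_norm_kernel {L : ℕ} {s t : ℝ} (h : |t - s| * L ≤ 1 / 2) :
    (L : ℝ) / 2 ≤ ‖kernel L s t‖ := by
  refine le_trans ?_ (Complex.re_le_norm _)
  rw [kernel, Complex.re_sum]
  have : ∀ j ∈ Finset.range L,
      (1 : ℝ) / 2 ≤ (Complex.exp (Complex.I * ((j : ℂ) * ((t : ℂ) - s)))).re := by
    intro j hj
    have he : Complex.I * ((j : ℂ) * ((t : ℂ) - s)) = ((j * (t - s) : ℝ) : ℂ) * Complex.I := by
      push_cast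
      ring
    rw [he, Complex.exp_ofReal_mul_I_re]
    refine le_trans ?_ Real.one_sub_sq_div_two_le_cos
    have hj' : (j : ℝ) ≤ L := by exact_mod_cast (Finset.mem_range.1 hj).le
    have h1 : |(j : ℝ) * (t - s)| ≤ 1 / 2 := by
      rw [abs_mul, Nat.abs_cast, mul_comm]
      exact (mul_le_mul_of_nonneg_left hj' (abs_nonneg _)).trans h
    have h2 := sq_le_sq' (abs_le.1 h1).1 (abs_le.1 h1).2
    linarith
  refine le_trans (le_of_eq ?_) (Finset.card_nsmul_le_sum _ _ _ this)
  rw [Finset.card_range, nsmul_eq_mul]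
  ring

/-- The frequency of the product of a mode of the kernel and two modes of the wave. -/
def freq (k : ℕ × (ℤ × ℤ) × (ℤ × ℤ)) : ℤ × ℤ × ℤ :=
  (k.2.1.1 + k.2.2.1, k.2.1.2 + k.2.2.2, k.1 - dot k.2.1 k.2.1 - dot k.2.2 k.2.2)

theorem kernel_mul_wave_sq (V : Finset (ℤ × ℤ)) (a : ℤ × ℤ → ℂ) (L : ℕ) (s t : ℝ) (x : ℝ × ℝ) :
    kernel L s t * wave V a t x ^ 2 = ∑ k ∈ Finset.range L ×ˢ (V ×ˢ V),
      a k.2.1 * a k.2.2 * Complex.exp (-(Complex.I * (k.1 * s))) * chr (freq k) t x := by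
  rw [sq, wave, Finset.sum_mul_sum, ← Finset.sum_product', kernel, Finset.sum_mul_sum,
    ← Finset.sum_product']
  refine Finset.sum_congr rfl fun k _ => ?_
  have h : ∀ A B e₀ e₁ e₂ e₃ e₄ : ℂ, Complex.exp (e₀ + (e₁ + e₂)) = Complex.exp (e₃ + e₄) →
      Complex.exp e₀ * (A * Complex.exp e₁ * (B * Complex.exp e₂)) =
        A * B * Complex.exp e₃ * Complex.exp e₄ := by
    intro A B e₀ e₁ e₂ e₃ e₄ h
    simp only [Complex.exp_add] at h
    linear_combination A * B * h
  refine h _ _ _ _ _ _ _ (congrArg Complex.exp ?_)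
  simp only [freq, dot]
  push_cast
  ring

theorem resonant_of_freq_eq {L : ℕ} {k k' : ℕ × (ℤ × ℤ) × (ℤ × ℤ)} (hk : k.1 < L) (hk' : k'.1 < L)
    (h : freq k = freq k') : Resonant L k.2 k'.2 := by
  obtain ⟨h1, h2⟩ := Prod.mk.inj h
  obtain ⟨h2, h3⟩ := Prod.mk.inj h2
  refine ⟨Prod.ext h1 h2, ?_⟩
  rw [abs_lt]
  constructor <;> omega

open Classical in
theorem sum_freq_eq_le (V : Finset (ℤ × ℤ)) (f : ℤ × ℤ → ℝ) (hf : ∀ x, 0 ≤ f x) (L : ℕ) :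
    ∑ k ∈ Finset.range L ×ˢ (V ×ˢ V), ∑ k' ∈ Finset.range L ×ˢ (V ×ˢ V),
        (if freq k = freq k' then f k.2.1 * f k.2.2 * (f k'.2.1 * f k'.2.2) else 0) ≤
      L * ∑ p ∈ V ×ˢ V, ∑ p' ∈ V ×ˢ V,
        if Resonant L p p' then f p.1 * f p.2 * (f p'.1 * f p'.2) else 0 := by
  rw [← Finset.sum_product', ← Finset.sum_product', ← Finset.sum_filter, ← Finset.sum_filter,
    ← nsmul_eq_mul, ← Finset.card_range L, ← Finset.sum_const, ← Finset.sum_product',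
    Finset.card_range]
  refine sum_le_sum_of_injOn (fun q => (q.1.1, (q.1.2, q.2.2))) (fun q hq => ?_)
    (fun q hq q' hq' h => ?_) (fun q _ => le_rfl) fun q _ => mul_nonneg (mul_nonneg (hf _) (hf _))
      (mul_nonneg (hf _) (hf _))
  · obtain ⟨hq, he⟩ := Finset.mem_filter.1 hq
    obtain ⟨h1, h2⟩ := Finset.mem_product.1 hq
    obtain ⟨h1, h3⟩ := Finset.mem_product.1 h1
    obtain ⟨h2, h4⟩ := Finset.mem_product.1 h2
    exact Finset.mem_product.2 ⟨h1, Finset.mem_filter.2 ⟨Finset.mem_product.2 ⟨h3, h4⟩,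
      resonant_of_freq_eq (Finset.mem_range.1 h1) (Finset.mem_range.1 h2) he⟩⟩
  · have e := congrArg (fun n : ℤ × ℤ × ℤ => n.2.2) (Finset.mem_filter.1 hq).2
    have e' := congrArg (fun n : ℤ × ℤ × ℤ => n.2.2) (Finset.mem_filter.1 hq').2
    obtain ⟨h1, h2⟩ := Prod.mk.inj h
    obtain ⟨h2, h3⟩ := Prod.mk.inj h2
    simp only [freq, h1, h2, h3] at e e'
    refine Prod.ext (Prod.ext h1 h2) (Prod.ext ?_ h3)
    omega

theorem integral_norm_wave_pow_four_le (V : Finset (ℤ × ℤ)) (a : ℤ × ℤ → ℂ) {m L : ℕ}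
    (hV : V.card ≤ 4 ^ m) (hL : 1 ≤ L) {t₀ t₁ : ℝ} (ht : t₀ ≤ t₁) (hI : (t₁ - t₀) * L ≤ 1) :
    ∫ t in t₀..t₁, ∫ x in cell, ‖wave V a t x‖ ^ 4 ≤
      32000000000000000 * π ^ 3 * ((m + L) / L) * (∑ ξ ∈ V, ‖a ξ‖ ^ 2) ^ 2 := by
  classical
  set s := (t₀ + t₁) / 2 with hs
  set F : ℝ → ℝ := fun t => ∫ x in cell, ‖wave V a t x‖ ^ 4 with hF
  have hL1 : (1 : ℝ) ≤ L := by exact_mod_cast hL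
  have hL0 : (0 : ℝ) < L := by linarith
  have hF0 : ∀ t, 0 ≤ F t := fun t => integral_nonneg fun x => by positivity
  have hFc : Continuous F :=
    continuous_parametric_integral_of_continuous (f := fun t x => ‖wave V a t x‖ ^ 4)
      ((continuous_pow 4).comp (continuous_wave V a).norm) isCompact_cell
  have hG : ∀ t, ‖kernel L s t‖ ^ 2 * F t =
      ∫ x in cell, ‖∑ k ∈ Finset.range L ×ˢ (V ×ˢ V), a k.2.1 * a k.2.2 *
        Complex.exp (-(Complex.I * (k.1 * s))) * chr (freq k) t x‖ ^ 2 := by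
    intro t
    rw [hF, ← integral_const_mul]
    refine integral_congr_ae (Filter.Eventually.of_forall fun x => ?_)
    simp only [← kernel_mul_wave_sq, norm_mul, norm_pow]
    ring
  have hGc : Continuous fun t => ‖kernel L s t‖ ^ 2 * F t :=
    ((continuous_kernel L s).norm.pow 2).mul hFc
  have hlen : t₁ - t₀ ≤ 1 := by nlinarith
  have hpi := Real.pi_gt_three
  have hlow : ∀ t ∈ Set.Icc t₀ t₁, F t ≤ 4 / L ^ 2 * (‖kernel L s t‖ ^ 2 * F t) := by
    intro t htI
    have h1 : |t - s| ≤ (t₁ - t₀) / 2 := by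
      rw [abs_le]
      constructor <;> linarith [htI.1, htI.2]
    have h2 : |t - s| * L ≤ 1 / 2 := by nlinarith
    have h3 := pow_le_pow_left₀ (by positivity) (half_le_norm_kernel h2) 2
    have h4 : 1 ≤ 4 / (L : ℝ) ^ 2 * ‖kernel L s t‖ ^ 2 := by
      rw [div_mul_eq_mul_div, le_div_iff₀ (by positivity)]
      linarith
    calc F t = 1 * F t := (one_mul _).symm
      _ ≤ 4 / (L : ℝ) ^ 2 * ‖kernel L s t‖ ^ 2 * F t := mul_le_mul_of_nonneg_right h4 (hF0 t)
      _ = _ := by ring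
  have hup : ∫ t in t₀..t₁, F t ≤
      4 / (L : ℝ) ^ 2 * ∫ t in (s - π)..(s - π + 2 * π), ‖kernel L s t‖ ^ 2 * F t := by
    rw [← intervalIntegral.integral_const_mul]
    have hc : Continuous fun t => 4 / (L : ℝ) ^ 2 * (‖kernel L s t‖ ^ 2 * F t) :=
      hGc.const_mul _
    refine (intervalIntegral.integral_mono_on ht (hFc.intervalIntegrable _ _)
      (hc.intervalIntegrable _ _) hlow).trans ?_
    refine intervalIntegral.integral_mono_interval (by linarith) ht (by linarith)
      (Filter.Eventually.of_forall fun t => ?_) (hc.intervalIntegrable _ _)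
    have := hF0 t
    simp only [Pi.zero_apply]
    positivity
  refine hup.trans ?_
  simp only [hG]
  have hP := integral_sq_norm_sum_chr_le (Finset.range L ×ˢ (V ×ˢ V)) freq
    (fun k => a k.2.1 * a k.2.2 * Complex.exp (-(Complex.I * (k.1 * s)))) (s - π)
  have hnorm : ∀ k : ℕ × (ℤ × ℤ) × (ℤ × ℤ),
      ‖a k.2.1 * a k.2.2 * Complex.exp (-(Complex.I * (k.1 * s)))‖ = ‖a k.2.1‖ * ‖a k.2.2‖ := by
    intro k
    have : -(Complex.I * ((k.1 : ℂ) * s)) = ((-(k.1 * s) : ℝ) : ℂ) * Complex.I := by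
      push_cast
      ring
    rw [norm_mul, norm_mul, this, Complex.norm_exp_ofReal_mul_I, mul_one]
  simp only [hnorm] at hP
  have h1 := sum_freq_eq_le V (fun ξ => ‖a ξ‖) (fun ξ => norm_nonneg _) L
  have h2 := sum_resonant_le V (fun ξ => ‖a ξ‖) (fun ξ => norm_nonneg _) hV hL
  have h3 := h1.trans (mul_le_mul_of_nonneg_left h2 hL0.le)
  have h4 : (0 : ℝ) ≤ (2 * π) ^ 3 := by positivity
  refine (mul_le_mul_of_nonneg_left (hP.trans (mul_le_mul_of_nonneg_left (le_trans (le_of_eq ?_) h3)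
    h4)) (by positivity)).trans (le_of_eq ?_)
  · refine Finset.sum_congr rfl fun k _ => Finset.sum_congr rfl fun k' _ => ?_
    congr
  · field_simp
    ring

theorem exists_scales {N : ℕ} (hN : 2 ≤ N) :
    ∃ m L : ℕ, N ≤ 2 ^ m ∧ 1 ≤ L ∧ (L : ℝ) ≤ max 1 (Real.log N) ∧ m ≤ 4 * L := by
  set ℓ := max 1 (Real.log N) with hℓ
  have h1 : 1 ≤ ℓ := le_max_left _ _
  have h2 : 1 ≤ ⌊ℓ⌋₊ := Nat.one_le_floor_iff _ |>.2 h1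
  refine ⟨Nat.clog 2 N, ⌊ℓ⌋₊, Nat.le_pow_clog one_lt_two N, h2, Nat.floor_le (by linarith), ?_⟩
  have h3 := Nat.pow_pred_clog_lt_self one_lt_two (show 1 < N by omega)
  set m := Nat.clog 2 N
  have h4 : ((m.pred : ℕ) : ℝ) * Real.log 2 ≤ Real.log N := by
    rw [← Real.log_pow]
    refine Real.log_le_log (by positivity) ?_
    exact_mod_cast h3.le
  have h5 := Nat.lt_floor_add_one ℓ
  have h6 : Real.log N ≤ ℓ := le_max_right _ _
  have h7 := Real.log_two_gt_d9
  have h8 : (1 : ℝ) ≤ ⌊ℓ⌋₊ := by exact_mod_cast h2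
  have h9 : (m : ℝ) ≤ m.pred + 1 := by
    have : m ≤ m.pred + 1 := by rw [Nat.pred_eq_sub_one]; omega
    exact_mod_cast this
  have : (m : ℝ) ≤ 4 * ⌊ℓ⌋₊ := by nlinarith
  exact_mod_cast this

end Strichartz

/-- **Frequency-localized local Strichartz estimate (Lemma 4.3 / estimate (4.1)).**
There exists `c > 0` such that for every integer `N ≥ 2`, every cube
`C = (0,N]² + Nξ₀` with `ξ₀ ∈ ℤ²`, every interval `I = [t₀, t₁] ⊂ ℝ` of length
`t₁ - t₀ ≤ 1 / Log N`, and every `a : ℤ² → ℂ` supported on `C ∩ ℤ²`, the free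
Schrödinger evolution `u(t,x) = ∑_{ξ ∈ C∩ℤ²} a ξ · exp(i(ξ·x − t|ξ|²))`
satisfies `‖u‖_{L⁴(I×𝕋²)} ≤ c ‖a‖_{ℓ²}`, where `Log x = max 1 (ln x)`. Here
`C ∩ ℤ² = Ioc (Nξ₀₁) (Nξ₀₁+N) × Ioc (Nξ₀₂) (Nξ₀₂+N)`. -/
theorem cube_localized_L4_strichartz_T2 :
    ∃ c : ℝ, 0 < c ∧
      ∀ (N : ℕ) (ξ₀ : ℤ × ℤ) (t₀ t₁ : ℝ) (a : ℤ × ℤ → ℂ), 2 ≤ N →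
        t₀ ≤ t₁ → t₁ - t₀ ≤ 1 / max 1 (Real.log (N : ℝ)) →
        (∀ ξ ∉ (Finset.Ioc ((N:ℤ) * ξ₀.1) ((N:ℤ) * ξ₀.1 + N)) ×ˢ
                 (Finset.Ioc ((N:ℤ) * ξ₀.2) ((N:ℤ) * ξ₀.2 + N)), a ξ = 0) →
        (∫ t in t₀..t₁,
            ∫ x in Set.Icc ((0:ℝ), (0:ℝ)) ((2 * π), (2 * π)),
              ‖∑ ξ ∈ (Finset.Ioc ((N:ℤ) * ξ₀.1) ((N:ℤ) * ξ₀.1 + N)) ×ˢ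
                       (Finset.Ioc ((N:ℤ) * ξ₀.2) ((N:ℤ) * ξ₀.2 + N)),
                  a ξ * Complex.exp (Complex.I *
                    ((ξ.1 : ℂ) * (x.1 : ℂ) + (ξ.2 : ℂ) * (x.2 : ℂ)
                      - (t : ℂ) * ((ξ.1 : ℂ) ^ 2 + (ξ.2 : ℂ) ^ 2)))‖ ^ 4) ^ ((1:ℝ)/4)
          ≤ c * (∑ ξ ∈ (Finset.Ioc ((N:ℤ) * ξ₀.1) ((N:ℤ) * ξ₀.1 + N)) ×ˢ
                        (Finset.Ioc ((N:ℤ) * ξ₀.2) ((N:ℤ) * ξ₀.2 + N)),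
                  ‖a ξ‖ ^ 2) ^ ((1:ℝ)/2) := by
  refine ⟨(160000000000000000 * π ^ 3) ^ ((1 : ℝ) / 4), by positivity, ?_⟩
  intro N ξ₀ t₀ t₁ a hN ht hI _
  obtain ⟨m, L, hm, hL, hLle, hmL⟩ := exists_scales hN
  set V := (Finset.Ioc ((N : ℤ) * ξ₀.1) ((N : ℤ) * ξ₀.1 + N)) ×ˢ
    (Finset.Ioc ((N : ℤ) * ξ₀.2) ((N : ℤ) * ξ₀.2 + N)) with hVdef
  have hV : V.card ≤ 4 ^ m := by
    rw [hVdef, Finset.card_product, Int.card_Ioc, Int.card_Ioc, add_sub_cancel_left,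
      add_sub_cancel_left, Int.toNat_natCast, show 4 = 2 * 2 from rfl, mul_pow]
    exact Nat.mul_le_mul hm hm
  have hL1 : (1 : ℝ) ≤ L := by exact_mod_cast hL
  have hlen : (t₁ - t₀) * L ≤ 1 := by
    have hpos : 0 < max 1 (Real.log (N : ℝ)) := lt_max_of_lt_left one_pos
    rw [le_div_iff₀ hpos] at hI
    exact (mul_le_mul_of_nonneg_left hLle (sub_nonneg.2 ht)).trans hI
  have h := integral_norm_wave_pow_four_le V a hV hL ht hlen
  set S := ∑ ξ ∈ V, ‖a ξ‖ ^ 2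
  have hS : 0 ≤ S := Finset.sum_nonneg fun ξ _ => sq_nonneg _
  have hratio : ((m : ℝ) + L) / L ≤ 5 := by
    have : (m : ℝ) ≤ 4 * L := by exact_mod_cast hmL
    rw [div_le_iff₀ (by linarith)]
    linarith
  have h' : ∫ t in t₀..t₁, ∫ x in cell, ‖wave V a t x‖ ^ 4 ≤
      160000000000000000 * π ^ 3 * S ^ 2 := by
    refine h.trans ?_
    have : 0 ≤ π ^ 3 * S ^ 2 := by positivity
    nlinarith
  have h0 : 0 ≤ ∫ t in t₀..t₁, ∫ x in cell, ‖wave V a t x‖ ^ 4 :=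
    intervalIntegral.integral_nonneg ht fun t _ => integral_nonneg fun x => by positivity
  refine (Real.rpow_le_rpow h0 h' (by norm_num : (0 : ℝ) ≤ 1 / 4)).trans (le_of_eq ?_)
  rw [Real.mul_rpow (by positivity) (by positivity), ← Real.rpow_natCast S 2, ← Real.rpow_mul hS]
  norm_num
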